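/- Let s ∈ (−3/4, 0) and let ψ be an even smooth function on ℝ with ψ = 1 on [−1,1] and support in [−2,2]. For every θ ∈ (0, 1/2) and κ ∈ (0, 3/2) there exist b ∈ (1/2, 1), N₁ ≥ 1 and a constant C > 0, all depending only on ν, μ, s, θ, κ and ψ, such that for every N ≥ N₁, every multiplier m = m_{N,s} as below, every δ ∈ (0,1), and all Schwartz functions u, v on ℝ², one has ‖ψ(t/δ) ∂_x I(uv)‖_{X_{0, b−1}} ≤ C ( δ^{θ} + N^{−κ} ) ‖Iu‖_{X_{0,b}} ‖Iv‖_{X_{0,b}}. (The key bilinear estimate, Proposition 3.2, stated for full-space functions.) -/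

import Mathlib

open MeasureTheory Real
open scoped ENNReal NNReal Classical

noncomputable section

/-- Phase function of the linear Benjamin equation: `φ(ξ) = -ν ξ|ξ| + μ ξ³`. -/
def phase (ν μ ξ : ℝ) : ℝ := -ν * ξ * |ξ| + μ * ξ ^ 3

/-- Derivative of the phase: `φ'(ξ) = -2ν|ξ| + 3μξ²`. -/
def dphase (ν μ ξ : ℝ) : ℝ := -2 * ν * |ξ| + 3 * μ * ξ ^ 2

/-- The frequency threshold `a = 2·max(1, |2ν/(3μ)|)`. -/
def aconst (ν μ : ℝ) : ℝ := 2 * max 1 |2 * ν / (3 * μ)|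

/-- Fourier transform in the space variable. -/
def FT (f : ℝ → ℂ) (ξ : ℝ) : ℂ := ∫ x : ℝ, Complex.exp (-(Complex.I * ξ * x)) * f x

/-- Space-time Fourier transform. -/
def FT2 (u : ℝ → ℝ → ℂ) (ξ τ : ℝ) : ℂ :=
  ∫ x : ℝ, ∫ t : ℝ, Complex.exp (-(Complex.I * (ξ * x + τ * t))) * u x t

/-- Mixed norm `‖f‖_{L^p_x L^q_t}` (with exponents in `ℝ≥0∞`). -/
def mixedLpLq (p q : ℝ≥0∞) (f : ℝ → ℝ → ℂ) : ℝ≥0∞ :=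
  if p = ∞ then essSup (fun x => eLpNorm (f x) q volume) volume
  else (∫⁻ x : ℝ, eLpNorm (f x) q volume ^ p.toReal) ^ (1 / p.toReal)

/-- The Bourgain norm `‖u‖_{X_{s,b}}` associated to the Benjamin phase function. -/
def XNorm (ν μ s b : ℝ) (u : ℝ → ℝ → ℂ) : ℝ≥0∞ :=
  (∫⁻ ξ : ℝ, ∫⁻ τ : ℝ,
      ENNReal.ofReal ((1 + ξ ^ 2) ^ s * (1 + (τ - phase ν μ ξ) ^ 2) ^ b) *
        (‖FT2 u ξ τ‖₊ : ℝ≥0∞) ^ 2) ^ (1 / 2 : ℝ)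

/-- The free Benjamin group `S(t)` applied to initial data `u₀`, as a function of `(x,t)`. -/
def Sgrp (ν μ : ℝ) (u₀ : ℝ → ℂ) (x t : ℝ) : ℂ :=
  (2 * π)⁻¹ • ∫ ξ : ℝ, Complex.exp (Complex.I * (ξ * x + phase ν μ ξ * t)) * FT u₀ ξ

/-- `D_x^α S(t) P^a u₀` : the Benjamin group composed with the Fourier restriction
`P^a` to `{|ξ| ≥ a}` and the derivative operator `D_x^α`. -/
def DSgrpPa (ν μ α : ℝ) (u₀ : ℝ → ℂ) (x t : ℝ) : ℂ :=
  (2 * π)⁻¹ • ∫ ξ : ℝ,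
    if aconst ν μ ≤ |ξ| then
      (↑(|ξ| ^ α) : ℂ) * Complex.exp (Complex.I * (ξ * x + phase ν μ ξ * t)) * FT u₀ ξ
    else 0

/-- `D_x^α P^a F` acting in the space variable of a space-time function `F`. -/
def DPa (ν μ α : ℝ) (F : ℝ → ℝ → ℂ) (x t : ℝ) : ℂ :=
  (2 * π)⁻¹ • ∫ ξ : ℝ,
    if aconst ν μ ≤ |ξ| then
      (↑(|ξ| ^ α) : ℂ) * Complex.exp (Complex.I * (ξ * x)) * FT (fun y => F y t) ξ
    else 0
/-- An admissible `I`-method multiplier `m = m_{N,s}`: smooth, even, valued in `(0,1]`,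
nonincreasing in `|ξ|`, equal to `1` for `|ξ| ≤ N`, and equal to `N^{-s}|ξ|^s` for `|ξ| ≥ 2N`. -/
structure AdmissibleMultiplier (N s : ℝ) (m : ℝ → ℝ) : Prop where
  smooth : ContDiff ℝ (⊤ : ℕ∞) m
  even : ∀ ξ, m (-ξ) = m ξ
  pos : ∀ ξ, 0 < m ξ
  le_one : ∀ ξ, m ξ ≤ 1
  mono : ∀ ξ η : ℝ, |ξ| ≤ |η| → m η ≤ m ξ
  eq_one : ∀ ξ : ℝ, |ξ| ≤ N → m ξ = 1
  eq_pow : ∀ ξ : ℝ, 2 * N ≤ |ξ| → m ξ = N ^ (-s) * |ξ| ^ s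

/-- `α₃(ξ₁,ξ₂,ξ₃) = i(φ(ξ₁)+φ(ξ₂)+φ(ξ₃))`. -/
def alpha3 (ν μ ξ₁ ξ₂ ξ₃ : ℝ) : ℂ :=
  Complex.I * ((phase ν μ ξ₁ + phase ν μ ξ₂ + phase ν μ ξ₃ : ℝ) : ℂ)

/-- `α₄(ξ₁,ξ₂,ξ₃,ξ₄) = i(φ(ξ₁)+φ(ξ₂)+φ(ξ₃)+φ(ξ₄))`. -/
def alpha4 (ν μ ξ₁ ξ₂ ξ₃ ξ₄ : ℝ) : ℂ :=
  Complex.I * ((phase ν μ ξ₁ + phase ν μ ξ₂ + phase ν μ ξ₃ + phase ν μ ξ₄ : ℝ) : ℂ)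

/-- The trilinear multiplier `M₃`. -/
def M3 (m : ℝ → ℝ) (ξ₁ ξ₂ ξ₃ : ℝ) : ℂ :=
  -(2 * Complex.I / 3) * ((m ξ₁ ^ 2 * ξ₁ + m ξ₂ ^ 2 * ξ₂ + m ξ₃ ^ 2 * ξ₃ : ℝ) : ℂ)

/-- `σ₃ = -M₃/α₃` where `M₃ ≠ 0`, and `σ₃ = 0` where `M₃ = 0`. -/
def sigma3 (ν μ : ℝ) (m : ℝ → ℝ) (ξ₁ ξ₂ ξ₃ : ℝ) : ℂ :=
  if M3 m ξ₁ ξ₂ ξ₃ = 0 then 0 else -M3 m ξ₁ ξ₂ ξ₃ / alpha3 ν μ ξ₁ ξ₂ ξ₃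

/-- The symmetrized quadrilinear multiplier
`M₄ = -(3/4) i [σ₃(ξ₁,ξ₂,ξ₃+ξ₄)(ξ₃+ξ₄)]_{sym}`, the symmetrization being the
average over all permutations of the four arguments. -/
def M4 (ν μ : ℝ) (m : ℝ → ℝ) (ξ : Fin 4 → ℝ) : ℂ :=
  -(3 / 4) * Complex.I * ((24 : ℂ)⁻¹ *
    ∑ p : Equiv.Perm (Fin 4),
      sigma3 ν μ m (ξ (p 0)) (ξ (p 1)) (ξ (p 2) + ξ (p 3)) * ((ξ (p 2) + ξ (p 3) : ℝ) : ℂ))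

/-- `M̃₄ = 1_Ω · M₄`, where `Ω = {|ξ_j| ≥ N for all j}`. -/
def Mt4 (ν μ N : ℝ) (m : ℝ → ℝ) (ξ : Fin 4 → ℝ) : ℂ :=
  if ∀ j, N ≤ |ξ j| then M4 ν μ m ξ else 0

/-- `σ₄ = -M̃₄/α₄` where `α₄ ≠ 0`, and `σ₄ = 0` where `α₄ = 0`. -/
def sigma4 (ν μ N : ℝ) (m : ℝ → ℝ) (ξ : Fin 4 → ℝ) : ℂ :=
  if alpha4 ν μ (ξ 0) (ξ 1) (ξ 2) (ξ 3) = 0 then 0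
  else -Mt4 ν μ N m ξ / alpha4 ν μ (ξ 0) (ξ 1) (ξ 2) (ξ 3)

/-- The symmetrized quintilinear multiplier
`M₅ = -(4/5) i [σ₄(ξ₁,ξ₂,ξ₃,ξ₄+ξ₅)(ξ₄+ξ₅)]_{sym}`. -/
def M5 (ν μ N : ℝ) (m : ℝ → ℝ) (ξ : Fin 5 → ℝ) : ℂ :=
  -(4 / 5) * Complex.I * ((120 : ℂ)⁻¹ *
    ∑ p : Equiv.Perm (Fin 5),
      sigma4 ν μ N m ![ξ (p 0), ξ (p 1), ξ (p 2), ξ (p 3) + ξ (p 4)] *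
        ((ξ (p 3) + ξ (p 4) : ℝ) : ℂ))

/-- The operator `I = I_{N,s}` (Fourier multiplier `m` in the space variable),
acting on space-time functions. -/
def Iop (m : ℝ → ℝ) (u : ℝ → ℝ → ℂ) (x t : ℝ) : ℂ :=
  (2 * π)⁻¹ • ∫ ξ : ℝ, (↑(m ξ) : ℂ) * Complex.exp (Complex.I * ξ * x) * FT (fun y => u y t) ξ

/-- The operator `∂_x I` (Fourier multiplier `i ξ m(ξ)` in the space variable),
acting on space-time functions. -/
def dxIop (m : ℝ → ℝ) (u : ℝ → ℝ → ℂ) (x t : ℝ) : ℂ :=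
  (2 * π)⁻¹ • ∫ ξ : ℝ,
    Complex.I * ξ * (↑(m ξ) : ℂ) * Complex.exp (Complex.I * ξ * x) * FT (fun y => u y t) ξ

/-- The weight `(1+|x|)^q` with values in `ℝ≥0∞`. -/
def jb (q x : ℝ) : ℝ≥0∞ := ENNReal.ofReal ((1 + |x|) ^ q)

lemma one_le_br (x : ℝ) : 1 ≤ 1 + |x| := by linarith [abs_nonneg x]

lemma br_pos (x : ℝ) : 0 < 1 + |x| := by linarith [abs_nonneg x]

lemma jb_neg (q x : ℝ) : jb q (-x) = jb q x := by simp [jb]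

lemma jb_sub_comm (q x y : ℝ) : jb q (x - y) = jb q (y - x) := by
  rw [← jb_neg, neg_sub]

@[fun_prop]
lemma measurable_jb (q : ℝ) : Measurable (jb q) := by
  unfold jb; fun_prop

lemma jb_mul (q r x : ℝ) : jb q x * jb r x = jb (q + r) x := by
  rw [jb, jb, jb, ← ENNReal.ofReal_mul (by have := br_pos x; positivity),
    rpow_add (br_pos x)]

lemma jb_ne_top (q x : ℝ) : jb q x ≠ ∞ := ENNReal.ofReal_ne_top

lemma jb_zero (x : ℝ) : jb 0 x = 1 := by simp [jb]

lemma jb_le_one {q : ℝ} (hq : q ≤ 0) (x : ℝ) : jb q x ≤ 1 := by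
  rw [jb, ENNReal.ofReal_le_one]
  exact rpow_le_one_of_one_le_of_nonpos (one_le_br x) hq

lemma jb_sq (q x : ℝ) : jb q x ^ 2 = jb (2 * q) x := by
  rw [sq, jb_mul, two_mul]

lemma lintegral_jb_lt_top {p : ℝ} (hp : 1 < p) : ∫⁻ y, jb (-p) y < ∞ := by
  have := finite_integral_one_add_norm (E := ℝ) (μ := volume) (r := p) (by simpa using hp)
  simpa [jb] using this

lemma lintegral_jb_sub {q : ℝ} (x : ℝ) : ∫⁻ y, jb q (x - y) = ∫⁻ y, jb q y := by
  exact lintegral_sub_left_eq_self (fun y => jb q y) x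

lemma lintegral_jb_sub' {q : ℝ} (x : ℝ) : ∫⁻ y, jb q (y - x) = ∫⁻ y, jb q y := by
  exact lintegral_sub_right_eq_self (fun y => jb q y) x

lemma jb_mul_jb_le {p : ℝ} (hp : 0 ≤ p) (x y : ℝ) :
    jb (-p) x * jb (-p) y ≤
      ENNReal.ofReal (2 ^ p) * jb (-p) (x + y) * (jb (-p) x + jb (-p) y) := by
  have hx := br_pos x
  have hy := br_pos y
  have hxy := br_pos (x + y)
  have htri := abs_add_le x y
  simp only [jb]
  rw [← ENNReal.ofReal_mul (by positivity), ← ENNReal.ofReal_mul (by positivity),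
    ← ENNReal.ofReal_add (by positivity) (by positivity), ← ENNReal.ofReal_mul (by positivity)]
  apply ENNReal.ofReal_le_ofReal
  have key : ∀ u v : ℝ, 1 ≤ u → 1 ≤ v → 1 + |x + y| ≤ 2 * v →
      u ^ (-p) * v ^ (-p) ≤ 2 ^ p * (1 + |x + y|) ^ (-p) * u ^ (-p) := by
    intro u v hu hv h
    have h1 : v ^ (-p) ≤ 2 ^ p * (1 + |x + y|) ^ (-p) := by
      have : (2 * v) ^ (-p) ≤ (1 + |x + y|) ^ (-p) :=
        rpow_le_rpow_of_nonpos hxy h (by linarith)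
      rw [mul_rpow (by norm_num) (by linarith), rpow_neg (by norm_num)] at this
      have h2 : (0:ℝ) < 2 ^ p := by positivity
      calc v ^ (-p) = 2 ^ p * ((2 ^ p)⁻¹ * v ^ (-p)) := by field_simp
        _ ≤ _ := by gcongr
    calc _ = v ^ (-p) * u ^ (-p) := mul_comm _ _
      _ ≤ _ := by gcongr
  rw [mul_add]
  rcases le_total |x| |y| with h | h
  · have := key (1 + |x|) (1 + |y|) (one_le_br _) (one_le_br _) (by linarith)
    have h3 : 0 ≤ 2 ^ p * (1 + |x + y|) ^ (-p) * (1 + |y|) ^ (-p) := by positivity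
    linarith
  · have := key (1 + |y|) (1 + |x|) (one_le_br _) (one_le_br _) (by linarith)
    have h3 : 0 ≤ 2 ^ p * (1 + |x + y|) ^ (-p) * (1 + |x|) ^ (-p) := by positivity
    rw [mul_comm (( 1 + |x|) ^ (-p))]
    linarith

lemma lintegral_jb_conv_le {p : ℝ} (hp : 0 ≤ p) (A B t : ℝ) :
    ∫⁻ s, jb (-p) (s - A) * jb (-p) (t - s - B) ≤
      ENNReal.ofReal (2 ^ p) * (2 * ∫⁻ y, jb (-p) y) * jb (-p) (t - A - B) := by
  calc ∫⁻ s, jb (-p) (s - A) * jb (-p) (t - s - B)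
      ≤ ∫⁻ s, ENNReal.ofReal (2 ^ p) * jb (-p) (t - A - B) *
          (jb (-p) (s - A) + jb (-p) (t - B - s)) := by
        apply lintegral_mono
        intro s
        have := jb_mul_jb_le hp (s - A) (t - s - B)
        rw [show s - A + (t - s - B) = t - A - B by ring] at this
        simpa only [show t - B - s = t - s - B by ring] using this
    _ = _ := by
        rw [lintegral_const_mul _ (by fun_prop), lintegral_add_left (by fun_prop),
          lintegral_jb_sub, lintegral_jb_sub']
        ring

lemma lintegral_comp_mul {a : ℝ} (ha : 0 < a) (f : ℝ → ℝ≥0∞) (hf : Measurable f) :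
    ∫⁻ x, f (a * x) = ENNReal.ofReal a⁻¹ * ∫⁻ x, f x := by
  have h := Real.map_volume_mul_left ha.ne'
  rw [← lintegral_map hf (by fun_prop), h, lintegral_smul_measure, abs_of_pos (by positivity),
    smul_eq_mul]

lemma lintegral_linear_mul_jb_sq_le {p : ℝ} (hp : 0 ≤ p) (g : ℝ) :
    ∫⁻ x, ENNReal.ofReal (2 * |x| + 1) * jb (-p) (x ^ 2 + g) ≤
      6 + 4 * ∫⁻ y, jb (-p) y := by
  have hinj : ∀ S : Set ℝ, MeasurableSet S → Set.InjOn (fun x : ℝ => x ^ 2 + g) S →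
      ∫⁻ x in S, ENNReal.ofReal (|2 * x|) * jb (-p) (x ^ 2 + g) ≤ ∫⁻ y, jb (-p) y := by
    intro S hS hi
    rw [← lintegral_image_eq_lintegral_abs_deriv_mul (f := fun x => x ^ 2 + g)
      (f' := fun x => 2 * x) hS (fun x _ => by
        have : HasDerivAt (fun x : ℝ => x ^ 2 + g) (2 * x) x := by
          simpa using (hasDerivAt_pow 2 x).add_const g
        exact this.hasDerivWithinAt) hi (jb (-p))]
    exact setLIntegral_le_lintegral _ _
  have h1 := hinj (Set.Ici 0) measurableSet_Ici (by
    intro x hx y hy h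
    simp only [Set.mem_Ici] at hx hy
    exact (pow_left_inj₀ hx hy two_ne_zero).1 (by simpa using h))
  have h2 := hinj (Set.Ici 0)ᶜ measurableSet_Ici.compl (by
    intro x hx y hy h
    simp only [Set.mem_compl_iff, Set.mem_Ici, not_le] at hx hy
    have h2 : (-x) ^ 2 = (-y) ^ 2 := by simpa using h
    exact neg_injective ((pow_left_inj₀ (by linarith) (by linarith) two_ne_zero).1 h2))
  have hall : ∫⁻ x, ENNReal.ofReal (|2 * x|) * jb (-p) (x ^ 2 + g) ≤ 2 * ∫⁻ y, jb (-p) y := by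
    rw [← lintegral_add_compl _ (measurableSet_Ici (a := (0:ℝ))), two_mul]
    exact add_le_add h1 h2
  calc ∫⁻ x, ENNReal.ofReal (2 * |x| + 1) * jb (-p) (x ^ 2 + g)
      ≤ ∫⁻ x, (Set.indicator (Set.Icc (-1) 1) (fun _ => (3:ℝ≥0∞)) x +
          2 * (ENNReal.ofReal (|2 * x|) * jb (-p) (x ^ 2 + g))) := by
        apply lintegral_mono
        intro x
        by_cases hx : x ∈ Set.Icc (-1 : ℝ) 1
        · have hx' : |x| ≤ 1 := abs_le.2 hx
          simp only [Set.indicator_of_mem hx]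
          refine le_trans ?_ le_self_add
          calc ENNReal.ofReal (2 * |x| + 1) * jb (-p) (x ^ 2 + g) ≤ 3 * 1 := by
                gcongr
                · exact ENNReal.ofReal_le_of_le_toReal (by simp; linarith)
                · exact jb_le_one (by linarith) _
            _ = 3 := by simp
        · have hx' : 1 ≤ |x| := by
            by_contra h
            exact hx (abs_le.1 (not_le.1 h).le)
          simp only [Set.indicator_of_notMem hx, zero_add, ← mul_assoc]
          gcongr
          rw [show (2:ℝ≥0∞) = ENNReal.ofReal 2 by simp, ← ENNReal.ofReal_mul (by norm_num)]
          apply ENNReal.ofReal_le_ofReal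
          rw [abs_mul, abs_two]
          linarith
    _ = 6 + 2 * ∫⁻ x, ENNReal.ofReal (|2 * x|) * jb (-p) (x ^ 2 + g) := by
        rw [lintegral_add_left (by fun_prop (disch := measurability)),
          lintegral_indicator measurableSet_Icc, lintegral_const_mul _ (by fun_prop)]
        congr 1
        simp
        rw [show (1:ℝ) + 1 = 2 by norm_num]
        norm_num
    _ ≤ 6 + 2 * (2 * ∫⁻ y, jb (-p) y) := by gcongr
    _ = _ := by rw [← mul_assoc]; norm_num

/-- Change of variables for a quadratic phase. -/
lemma lintegral_quadratic_le {p : ℝ} (hp : 0 ≤ p) {α : ℝ} (hα : α ≠ 0) (β γ : ℝ) :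
    ∫⁻ y, ENNReal.ofReal (|2 * α * y + β| + √|α|) * jb (-p) (α * y ^ 2 + β * y + γ) ≤
      6 + 4 * ∫⁻ y, jb (-p) y := by
  have ha : 0 < |α| := abs_pos.2 hα
  set r := √|α| with hr
  have hr0 : 0 < r := Real.sqrt_pos.2 ha
  have hrr : r ^ 2 = |α| := Real.sq_sqrt ha.le
  set g := (γ - β ^ 2 / (4 * α)) * (SignType.sign α : ℝ) with hg
  have hsign : (SignType.sign α : ℝ) * α = |α| := sign_mul_self α
  have hs2 : (SignType.sign α : ℝ) = 1 ∨ (SignType.sign α : ℝ) = -1 := by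
    rcases lt_or_gt_of_ne hα with h | h
    · right; simp [h]
    · left; simp [h]
  have hpt : ∀ y, ENNReal.ofReal (|2 * α * y + β| + r) * jb (-p) (α * y ^ 2 + β * y + γ) =
      (fun y => (fun x => ENNReal.ofReal r * (ENNReal.ofReal (2 * |x| + 1) *
        jb (-p) (x ^ 2 + g))) (r * y)) (y + β / (2 * α)) := by
    intro y
    have e1 : |2 * α * y + β| + r = r * (2 * |r * (y + β / (2 * α))| + 1) := by
      rw [show 2 * α * y + β = 2 * α * (y + β / (2 * α)) by field_simp, abs_mul, abs_mul,
        abs_mul, abs_two, ← hrr, abs_of_pos hr0]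
      ring
    have e2 : α * y ^ 2 + β * y + γ =
        (SignType.sign α : ℝ) * ((r * (y + β / (2 * α))) ^ 2 + g) := by
      rw [mul_pow, hrr, ← hsign, hg]
      have : (SignType.sign α : ℝ) * (SignType.sign α : ℝ) = 1 := by
        rcases hs2 with h | h <;> rw [h] <;> norm_num
      have h3 : α * y ^ 2 + β * y + γ = α * (y + β / (2 * α)) ^ 2 + (γ - β ^ 2 / (4 * α)) := by
        field_simp; ring
      rw [h3]
      linear_combination (-(α * (y + β / (2 * α)) ^ 2 + (γ - β ^ 2 / (4 * α)))) * this
    have e3 : jb (-p) (α * y ^ 2 + β * y + γ) = jb (-p) ((r * (y + β / (2 * α))) ^ 2 + g) := by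
      rw [e2]
      rcases hs2 with h | h <;> rw [h]
      · rw [one_mul]
      · rw [neg_one_mul, jb_neg]
    simp only [e3]
    rw [e1, ENNReal.ofReal_mul hr0.le, mul_assoc]
  simp_rw [hpt]
  rw [lintegral_add_right_eq_self (fun y => (fun x => ENNReal.ofReal r *
    (ENNReal.ofReal (2 * |x| + 1) * jb (-p) (x ^ 2 + g))) (r * y)),
    lintegral_comp_mul hr0 (fun x => ENNReal.ofReal r * (ENNReal.ofReal (2 * |x| + 1) *
      jb (-p) (x ^ 2 + g))) (by fun_prop), lintegral_const_mul _ (by fun_prop), ← mul_assoc,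
    ← ENNReal.ofReal_mul (by positivity), inv_mul_cancel₀ hr0.ne', ENNReal.ofReal_one, one_mul]
  exact lintegral_linear_mul_jb_sq_le hp g

/-- Transversality weight: low frequencies, plus the difference of group velocities where at
least one frequency is large. -/
def transWeight (ν μ K A ζ ζ' : ℝ) : ℝ :=
  (if |ζ| ≤ K ∧ |ζ'| ≤ K then 1 else 0) +
    (if A ≤ |ζ| ∨ A ≤ |ζ'| then |dphase ν μ ζ - dphase ν μ ζ'| + √|ζ + ζ'| else 0)

lemma transWeight_nonneg (ν μ K A ζ ζ' : ℝ) : 0 ≤ transWeight ν μ K A ζ ζ' := by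
  unfold transWeight; positivity

lemma measurable_phase (ν μ : ℝ) : Measurable (phase ν μ) := by
  unfold phase; fun_prop

lemma measurable_dphase (ν μ : ℝ) : Measurable (dphase ν μ) := by
  unfold dphase; fun_prop

lemma measurable_transWeight (ν μ K A : ℝ) :
    Measurable (fun z : ℝ × ℝ => transWeight ν μ K A z.1 z.2) := by
  unfold transWeight
  have h := measurable_dphase ν μ
  have h1 : Measurable (fun z : ℝ × ℝ => |z.1|) := by fun_prop
  have h2 : Measurable (fun z : ℝ × ℝ => |z.2|) := by fun_prop
  refine Measurable.add (Measurable.ite ?_ (by fun_prop) (by fun_prop))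
    (Measurable.ite ?_ (by fun_prop) (by fun_prop))
  · exact (measurableSet_le h1 measurable_const).inter (measurableSet_le h2 measurable_const)
  · exact (measurableSet_le measurable_const h1).union (measurableSet_le measurable_const h2)

/-- The bound for one choice of signs of the two frequencies. -/
lemma lintegral_sign_le {p : ℝ} (hp : 0 ≤ p) (D α β γ : ℝ) (hD : 0 ≤ D) (P : Prop) :
    ∫⁻ y, (if P ∧ α ≠ 0 then ENNReal.ofReal (D * (|2 * α * y + β| + √|α|)) *
      jb (-p) (α * y ^ 2 + β * y + γ) else 0) ≤
      ENNReal.ofReal D * (6 + 4 * ∫⁻ y, jb (-p) y) := by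
  by_cases h : P ∧ α ≠ 0
  · have e : ∀ y, (if P ∧ α ≠ 0 then ENNReal.ofReal (D * (|2 * α * y + β| + √|α|)) *
        jb (-p) (α * y ^ 2 + β * y + γ) else 0) = ENNReal.ofReal D *
          (ENNReal.ofReal (|2 * α * y + β| + √|α|) * jb (-p) (α * y ^ 2 + β * y + γ)) := by
      intro y
      rw [if_pos h, ENNReal.ofReal_mul hD, mul_assoc]
    simp_rw [e]
    rw [lintegral_const_mul _ (by fun_prop)]
    gcongr
    exact lintegral_quadratic_le hp h.2 β γ
  · simp [h]

lemma lintegral_transWeight_le {ν μ K A p : ℝ} (hp : 0 ≤ p) (hμ : μ ≠ 0)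
    (hνA : |ν| ≤ |μ| * A) (c x : ℝ) :
    ∫⁻ ζ, ENNReal.ofReal (transWeight ν μ K A ζ (c - ζ)) *
        jb (-p) (x - phase ν μ ζ - phase ν μ (c - ζ)) ≤
      ENNReal.ofReal (2 * K) +
        4 * (ENNReal.ofReal (1 + (√|μ|)⁻¹) * (6 + 4 * ∫⁻ y, jb (-p) y)) := by
  have hμ0 : 0 < |μ| := abs_pos.2 hμ
  set D := 1 + (√|μ|)⁻¹ with hD
  have hD0 : 0 ≤ D := by positivity
  set α : ℝ → ℝ → ℝ := fun e e' => 3 * μ * c - ν * (e + e') with hα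
  set β : ℝ → ℝ := fun e' => 2 * ν * e' * c - 3 * μ * c ^ 2 with hβ
  set γ : ℝ → ℝ := fun e' => μ * c ^ 3 - ν * e' * c ^ 2 - x with hγ
  set G : ℝ → ℝ → ℝ → ℝ≥0∞ := fun e e' y =>
    if |μ| * |c| ≤ |α e e'| ∧ α e e' ≠ 0 then
      ENNReal.ofReal (D * (|2 * α e e' * y + β e'| + √|α e e'|)) *
      jb (-p) (α e e' * y ^ 2 + β e' * y + γ e') else 0 with hG
  have hGm : ∀ e e', Measurable (G e e') := fun e e' => by
    simp only [hG]
    exact Measurable.ite (MeasurableSet.const _) (by fun_prop) (by fun_prop)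
  have hGi : ∀ e e', ∫⁻ y, G e e' y ≤ ENNReal.ofReal D * (6 + 4 * ∫⁻ y, jb (-p) y) :=
    fun e e' => lintegral_sign_le hp D _ _ _ hD0 _
  have hpt : ∀ ζ, ENNReal.ofReal (transWeight ν μ K A ζ (c - ζ)) *
        jb (-p) (x - phase ν μ ζ - phase ν μ (c - ζ)) ≤
      Set.indicator (Set.Icc (-K) K) (fun _ => 1) ζ +
        (G 1 1 ζ + G 1 (-1) ζ + G (-1) 1 ζ + G (-1) (-1) ζ) := by
    intro ζ
    rw [transWeight, ENNReal.ofReal_add (by positivity) (by positivity), add_mul]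
    refine add_le_add ?_ ?_
    · split_ifs with h
      · rw [Set.indicator_of_mem (by exact abs_le.1 h.1)]
        simpa using jb_le_one (by linarith) _
      · simp
    · split_ifs with h
      swap
      · simp
      have key : ∀ e e' : ℝ, (e = 1 ∨ e = -1) → (e' = 1 ∨ e' = -1) → |ζ| = e * ζ →
          |c - ζ| = e' * (c - ζ) → ENNReal.ofReal (|dphase ν μ ζ - dphase ν μ (c - ζ)| +
            √|ζ + (c - ζ)|) * jb (-p) (x - phase ν μ ζ - phase ν μ (c - ζ)) ≤ G e e' ζ := by
        intro e e' he he' h1 h2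
        have hd : dphase ν μ ζ - dphase ν μ (c - ζ) = 2 * α e e' * ζ + β e' := by
          simp only [dphase, h1, h2, hα, hβ]; ring
        have hph : x - phase ν μ ζ - phase ν μ (c - ζ) =
            -(α e e' * ζ ^ 2 + β e' * ζ + γ e') := by
          simp only [phase, h1, h2, hα, hβ, hγ]; ring
        rw [hd, hph, jb_neg, add_sub_cancel]
        by_cases hgood : |μ| * |c| ≤ |α e e'| ∧ α e e' ≠ 0
        · simp only [hG]
          rw [if_pos hgood]
          gcongr
          have h4 : √|c| ≤ (√|μ|)⁻¹ * √|α e e'| := by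
            rw [← Real.sqrt_inv, ← Real.sqrt_mul (by positivity)]
            apply Real.sqrt_le_sqrt
            rw [inv_mul_eq_div, le_div_iff₀ hμ0]
            linarith [hgood.1]
          have h5 : 0 ≤ (√|μ|)⁻¹ * |2 * α e e' * ζ + β e'| := by positivity
          have h6 := Real.sqrt_nonneg |α e e'|
          rw [hD]; nlinarith
        · suffices hz : |2 * α e e' * ζ + β e'| + √|c| = 0 by rw [hz]; simp
          rcases eq_or_ne c 0 with hc | hc
          · rw [← hd, hc]; simp [dphase]
          exfalso
          apply hgood
          have hcase : |μ| * |c| ≤ |α e e'| := by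
            by_cases hee : e' = -e
            · simp only [hα, hee]
              rw [add_neg_cancel, mul_zero, sub_zero, abs_mul, abs_mul]
              have : (0:ℝ) ≤ |μ| * |c| := by positivity
              norm_num; linarith
            · have hee2 : e' = e := by
                rcases he with rfl | rfl <;> rcases he' with rfl | rfl <;>
                  first | rfl | exact absurd (by norm_num) hee
              have hcA : A ≤ |c| := by
                have h7 : |c| = |ζ| + |c - ζ| := by
                  rw [h1, h2, hee2]
                  have hs : |ζ| + |c - ζ| = e * c := by rw [h1, h2, hee2]; ring
                  have : |c| = |e * c| := by
                    rw [abs_mul]; rcases he with rfl | rfl <;> simp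
                  rw [this, ← hs, abs_of_nonneg (by positivity), h1, h2, hee2]
                rw [h7]
                rcases h with h | h
                · linarith [abs_nonneg (c - ζ)]
                · linarith [abs_nonneg ζ]
              have h8 : |ν * (e + e')| ≤ 2 * (|μ| * |c|) := by
                rw [hee2, abs_mul]
                have : |e + e| = 2 := by rcases he with rfl | rfl <;> norm_num
                rw [this]
                have : |μ| * A ≤ |μ| * |c| := by gcongr
                linarith
              have h9 : |3 * μ * c| = 3 * (|μ| * |c|) := by
                rw [abs_mul, abs_mul]; norm_num; ring
              have := abs_sub_abs_le_abs_sub (3 * μ * c) (ν * (e + e'))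
              simp only [hα]
              linarith
          refine ⟨hcase, ?_⟩
          have : 0 < |μ| * |c| := by have := abs_pos.2 hc; positivity
          exact abs_pos.1 (by linarith)
      rcases le_total 0 ζ with hz | hz <;> rcases le_total 0 (c - ζ) with hz' | hz'
      · refine (key 1 1 (by simp) (by simp) (by rw [abs_of_nonneg hz, one_mul])
          (by rw [abs_of_nonneg hz', one_mul])).trans ?_
        rw [add_assoc, add_assoc]; exact le_self_add
      · refine (key 1 (-1) (by simp) (by simp) (by rw [abs_of_nonneg hz, one_mul])
          (by rw [abs_of_nonpos hz', neg_one_mul])).trans ?_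
        rw [add_assoc, add_assoc]
        exact le_trans le_self_add le_add_self
      · refine (key (-1) 1 (by simp) (by simp) (by rw [abs_of_nonpos hz, neg_one_mul])
          (by rw [abs_of_nonneg hz', one_mul])).trans ?_
        exact le_trans le_add_self le_self_add
      · refine (key (-1) (-1) (by simp) (by simp) (by rw [abs_of_nonpos hz, neg_one_mul])
          (by rw [abs_of_nonpos hz', neg_one_mul])).trans le_add_self
  refine (lintegral_mono hpt).trans ?_
  rw [lintegral_add_left (Measurable.indicator (by fun_prop) measurableSet_Icc),
    lintegral_indicator measurableSet_Icc]
  refine add_le_add (by simp [two_mul]) ?_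
  rw [lintegral_add_right _ (hGm _ _), lintegral_add_right _ (hGm _ _),
    lintegral_add_right _ (hGm _ _)]
  calc _ ≤ _ := add_le_add (add_le_add (add_le_add (hGi _ _) (hGi _ _)) (hGi _ _)) (hGi _ _)
    _ = _ := by ring

lemma rpow_nine_quarters_mul_le {r q z : ℝ} (hr : r ≤ q) (hq : q ≤ 3 / 2) (hz : 1 ≤ z) :
    (9 / 4 * z) ^ r ≤ 27 / 8 * z ^ q := by
  rw [mul_rpow (by norm_num) (by linarith)]
  have h1 : (9 / 4 : ℝ) ^ r ≤ 27 / 8 := by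
    calc (9 / 4 : ℝ) ^ r ≤ (9 / 4 : ℝ) ^ (3 / 2 : ℝ) :=
          rpow_le_rpow_of_exponent_le (by norm_num) (by linarith)
      _ = 27 / 8 := by
          rw [show (9 / 4 : ℝ) = (3 / 2) ^ (2 : ℝ) by norm_num, ← rpow_mul (by norm_num)]
          norm_num
  have h2 : z ^ r ≤ z ^ q := rpow_le_rpow_of_exponent_le hz hr
  gcongr

lemma smoothing_bound_low {ρ ε l a b : ℝ} (hρ : 0 ≤ ρ) (hε : 0 < ε) (hε8 : ε ≤ 1 / 8)
    (hρε : 2 * ρ ≤ 3 / 2 - 3 * ε) (ha : 2 ≤ a) (hb : 2 ≤ b) (hl : 0 < l) (hl1 : l ≤ 1) :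
    l ^ 2 * ((1 + a) * (1 + b) / (1 + l)) ^ (2 * ρ) * (1 + l * a * b) ^ (-1 + ε) ≤
      27 / 8 * (l * √(a * b)) := by
  have hab : 4 ≤ a * b := by nlinarith
  have h1 : ((1 + a) * (1 + b) / (1 + l)) ^ (2 * ρ) ≤ 27 / 8 * (a * b) ^ (3 / 2 - 3 * ε) := by
    refine le_trans (rpow_le_rpow (by positivity) ?_ (by linarith))
      (rpow_nine_quarters_mul_le hρε (by linarith) (by linarith))
    rw [div_le_iff₀ (by linarith)]
    have : (1 + a) * (1 + b) ≤ 9 / 4 * (a * b) := by nlinarith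
    nlinarith
  have h2 : (1 + l * a * b) ^ (-1 + ε) ≤ (l * (a * b)) ^ (-1 + ε) :=
    rpow_le_rpow_of_nonpos (by positivity) (by linarith) (by linarith)
  calc _ ≤ l ^ 2 * (27 / 8 * (a * b) ^ (3 / 2 - 3 * ε)) * (l * (a * b)) ^ (-1 + ε) := by
        gcongr
    _ = 27 / 8 * (l ^ (1 + ε) * (a * b) ^ (1 / 2 - 2 * ε)) := by
        have e1 : (a * b) ^ (1 / 2 - 2 * ε) = (a * b) ^ (3 / 2 - 3 * ε) * (a * b) ^ (-1 + ε) := by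
          rw [← rpow_add (by linarith)]; congr 1; ring
        have e2 : l ^ (1 + ε) = l ^ 2 * l ^ (-1 + ε) := by
          rw [← rpow_natCast l 2, ← rpow_add hl]; congr 1; push_cast; ring
        rw [e1, e2, mul_rpow hl.le (by linarith)]
        generalize (a * b) ^ (-1 + ε) = X
        generalize l ^ (-1 + ε) = Y
        ring
    _ ≤ 27 / 8 * (l * √(a * b)) := by
        have h3 : l ^ (1 + ε) ≤ l := by
          simpa using rpow_le_rpow_of_exponent_ge hl hl1 (by linarith : (1:ℝ) ≤ 1 + ε)
        have h4 : (a * b) ^ (1 / 2 - 2 * ε) ≤ √(a * b) := by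
          rw [Real.sqrt_eq_rpow]
          exact rpow_le_rpow_of_exponent_le (by linarith) (by linarith)
        gcongr

lemma smoothing_bound_high {ρ ε l a b : ℝ} (hρ : 0 ≤ ρ) (hε : 0 < ε) (hε8 : ε ≤ 1 / 8)
    (hρε : 2 * ρ ≤ 3 / 2 - 3 * ε) (ha : 2 ≤ a) (hb : 2 ≤ b) (hl : 1 ≤ l) (hlab : l ≤ a + b) :
    l ^ 2 * ((1 + a) * (1 + b) / (1 + l)) ^ (2 * ρ) * (1 + l * a * b) ^ (-1 + ε) ≤
      27 / 8 * (√(a * b) / √l + √√(a * b)) := by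
  have hl0 : 0 < l := by linarith
  obtain ⟨z, hz⟩ : ∃ z, z = a * b / l := ⟨_, rfl⟩
  have hzl : a * b = z * l := by rw [hz]; field_simp
  have hz1 : 1 ≤ z := by
    rw [hz, one_le_div hl0]; nlinarith
  have hz0 : 0 < z := by linarith
  have h1 : ((1 + a) * (1 + b) / (1 + l)) ^ (2 * ρ) ≤ 27 / 8 * z ^ (3 / 2 - 3 * ε) := by
    refine le_trans (rpow_le_rpow (by positivity) ?_ (by linarith))
      (rpow_nine_quarters_mul_le hρε (by linarith) hz1)
    rw [div_le_iff₀ (by linarith)]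
    have : (1 + a) * (1 + b) ≤ 9 / 4 * (a * b) := by nlinarith
    nlinarith
  have h2 : (1 + l * a * b) ^ (-1 + ε) ≤ (l ^ 2 * z) ^ (-1 + ε) := by
    refine rpow_le_rpow_of_nonpos (by positivity) ?_ (by linarith)
    rw [mul_assoc, hzl]; nlinarith
  calc _ ≤ l ^ 2 * (27 / 8 * z ^ (3 / 2 - 3 * ε)) * (l ^ 2 * z) ^ (-1 + ε) := by
        gcongr
    _ = 27 / 8 * (l ^ (2 * ε) * z ^ (1 / 2 - 2 * ε)) := by
        have e1 : z ^ (1 / 2 - 2 * ε) = z ^ (3 / 2 - 3 * ε) * z ^ (-1 + ε) := by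
          rw [← rpow_add hz0]; congr 1; ring
        have e2 : l ^ (2 * ε) = l ^ 2 * (l ^ 2) ^ (-1 + ε) := by
          rw [← rpow_natCast l 2, ← rpow_mul hl0.le, ← rpow_add hl0]; congr 1; push_cast; ring
        rw [e1, e2, mul_rpow (by positivity) hz0.le]
        generalize z ^ (-1 + ε) = X
        generalize (l ^ 2) ^ (-1 + ε) = Y
        ring
    _ ≤ 27 / 8 * (√(a * b) / √l + √√(a * b)) := by
        gcongr
        rcases le_total l z with h | h
        · have : l ^ (2 * ε) * z ^ (1 / 2 - 2 * ε) ≤ √(a * b) / √l := by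
            rw [← Real.sqrt_div' _ hl0.le, ← hz, Real.sqrt_eq_rpow]
            calc _ ≤ z ^ (2 * ε) * z ^ (1 / 2 - 2 * ε) := by gcongr
              _ = z ^ (1 / 2 : ℝ) := by rw [← rpow_add hz0]; ring_nf
          linarith [Real.sqrt_nonneg √(a * b)]
        · have : l ^ (2 * ε) * z ^ (1 / 2 - 2 * ε) ≤ √√(a * b) := by
            rw [Real.sqrt_eq_rpow, Real.sqrt_eq_rpow, ← rpow_mul (by positivity), hzl,
              mul_rpow hz0.le hl0.le]
            calc _ = l ^ (1 / 2 * (1 / 2) : ℝ) * (l ^ (2 * ε - 1 / 4) * z ^ (1 / 2 - 2 * ε)) := by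
                  rw [← mul_assoc, ← rpow_add hl0]; ring_nf
              _ ≤ l ^ (1 / 2 * (1 / 2) : ℝ) * (z ^ (2 * ε - 1 / 4) * z ^ (1 / 2 - 2 * ε)) := by
                  gcongr ?_ * (?_ * ?_)
                  exact rpow_le_rpow_of_nonpos hz0 h (by linarith)
              _ = _ := by rw [← rpow_add hz0, mul_comm]; ring_nf
          have : 0 ≤ √(a * b) / √l := by positivity
          linarith

/-- Geometric comparison in the non-degenerate region, in terms of the moduli of the three
frequencies. -/
lemma smoothing_compare {l a b E : ℝ} (ha : 2 ≤ a) (hb : 2 ≤ b) (hl : 0 ≤ l)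
    (htri : l = a + b ∨ l = a - b ∨ l = b - a)
    (hlow : l ≤ 1 → E ≤ l * √(a * b))
    (hhigh : 1 ≤ l → E ≤ √(a * b) / √l + √√(a * b)) :
    E ≤ 4 * (|a ^ 2 - b ^ 2| + √l) ∧ E ≤ 4 * (|l ^ 2 - b ^ 2| + √a) ∧
      E ≤ 4 * (|l ^ 2 - a ^ 2| + √b) := by
  have hab : 4 ≤ a * b := by nlinarith
  have hS1 : 1 ≤ √(a * b) := Real.one_le_sqrt.2 (by linarith)
  have hSle : √(a * b) ≤ a * b := by
    rw [Real.sqrt_le_left (by linarith)]; nlinarith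
  have hSamgm : √(a * b) ≤ (a + b) := by
    rw [Real.sqrt_le_left (by linarith)]; nlinarith
  have hSS : √√(a * b) ≤ √(a * b) := by
    rw [Real.sqrt_le_left (by linarith)]; nlinarith
  have hEle : 1 ≤ l → E ≤ 2 * √(a * b) := by
    intro h
    have : √(a * b) / √l ≤ √(a * b) := div_le_self (by linarith) (Real.one_le_sqrt.2 h)
    linarith [hhigh h]
  have hE2 : E ≤ 2 * √(a * b) := by
    rcases le_total l 1 with h | h
    · nlinarith [hlow h]
    · exact hEle h
  have hEl : E ≤ 2 * (l * √(a * b)) := by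
    rcases le_total l 1 with h | h
    · nlinarith [hlow h]
    · nlinarith [hEle h]
  have hside : ∀ c d : ℝ, 2 ≤ c → 2 ≤ d → c * d = a * b → (l = c + d ∨ l = c - d ∨ l = d - c) →
      E ≤ 4 * (|l ^ 2 - d ^ 2| + √c) := by
    intro c d hc hd hcd h
    have hsc := Real.sqrt_nonneg c
    have hfar : |l ^ 2 - d ^ 2| = c * (l + d) → E ≤ 4 * (|l ^ 2 - d ^ 2| + √c) := by
      intro h; rw [h]; nlinarith
    rcases h with h | h | h
    · apply hfar
      rw [show l ^ 2 - d ^ 2 = c * (l + d) by rw [h]; ring, abs_of_nonneg (by positivity)]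
    · have e : |l ^ 2 - d ^ 2| = c * |l - d| := by
        rw [show l ^ 2 - d ^ 2 = c * (l - d) by rw [h]; ring, abs_mul,
          abs_of_nonneg (by linarith : 0 ≤ c)]
      rw [e]
      by_cases h2 : c / 2 ≤ |l - d|
      · nlinarith
      · have h3 := (abs_lt.1 (not_le.1 h2)).1
        have hc4 : c ≤ 4 * l := by linarith
        have hdc : d ≤ c := by linarith
        have hSc : √(a * b) ≤ c := by
          rw [← hcd, Real.sqrt_le_left (by linarith)]; nlinarith
        have hSSc : √√(a * b) ≤ √c := Real.sqrt_le_sqrt hSc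
        have hpos : 0 ≤ c * |l - d| := by positivity
        rcases le_total l 1 with h4 | h4
        · have h5 : √c ≤ 2 := by rw [Real.sqrt_le_left (by norm_num)]; linarith
          have h6 : c = √c * √c := (Real.mul_self_sqrt (by linarith)).symm
          nlinarith [hlow h4]
        · have : √(a * b) / √l ≤ 2 * √c := by
            rw [div_le_iff₀ (by positivity), Real.sqrt_le_left (by positivity)]
            have h6 : √c ^ 2 = c := Real.sq_sqrt (by linarith)
            have h7 : √l ^ 2 = l := Real.sq_sqrt hl
            calc a * b = c * d := hcd.symm
              _ ≤ 4 * c * l := by nlinarith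
              _ = (2 * √c * √l) ^ 2 := by rw [mul_pow, mul_pow, h6, h7]; ring
          linarith [hhigh h4]
    · apply hfar
      rw [show l ^ 2 - d ^ 2 = -(c * (l + d)) by rw [h]; ring, abs_neg,
        abs_of_nonneg (by positivity)]
  refine ⟨?_, hside a b ha hb rfl htri, hside b a hb ha (mul_comm _ _) (by
    rcases htri with h | h | h
    · left; linarith
    · right; right; exact h
    · right; left; exact h)⟩
  have hsl := Real.sqrt_nonneg l
  have hnear : |a ^ 2 - b ^ 2| = l * (a + b) → E ≤ 4 * (|a ^ 2 - b ^ 2| + √l) := by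
    intro h; rw [h]; nlinarith
  rcases htri with h | h | h
  · have h0 : 0 ≤ |a ^ 2 - b ^ 2| := abs_nonneg _
    have h1 : 1 ≤ l := by linarith
    have hSl : √(a * b) ≤ l := by linarith
    have h2 : √(a * b) / √l ≤ √l := by
      rw [div_le_iff₀ (by positivity), Real.mul_self_sqrt hl]; exact hSl
    have h3 : √√(a * b) ≤ √l := Real.sqrt_le_sqrt hSl
    linarith [hhigh h1]
  · apply hnear
    rw [show a ^ 2 - b ^ 2 = l * (a + b) by rw [h]; ring, abs_of_nonneg (by positivity)]
  · apply hnear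
    rw [show a ^ 2 - b ^ 2 = -(l * (a + b)) by rw [h]; ring, abs_neg,
      abs_of_nonneg (by positivity)]

lemma abs_dphase_sub_ge {ν μ A ζ ζ' : ℝ} (hν : |ν| ≤ |μ| * A) (h : A ≤ |ζ| ∨ A ≤ |ζ'|) :
    |μ| * |ζ ^ 2 - ζ' ^ 2| ≤ |dphase ν μ ζ - dphase ν μ ζ'| := by
  have hS : A ≤ |ζ| + |ζ'| := by
    rcases h with h | h
    · linarith [abs_nonneg ζ']
    · linarith [abs_nonneg ζ]
  have hS0 : 0 ≤ |ζ| + |ζ'| := by positivity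
  have e1 : dphase ν μ ζ - dphase ν μ ζ' =
      (|ζ| - |ζ'|) * (3 * μ * (|ζ| + |ζ'|) - 2 * ν) := by
    simp only [dphase, ← sq_abs ζ, ← sq_abs ζ']; ring
  have e2 : ζ ^ 2 - ζ' ^ 2 = (|ζ| - |ζ'|) * (|ζ| + |ζ'|) := by
    rw [← sq_abs ζ, ← sq_abs ζ']; ring
  rw [e1, e2, abs_mul, abs_mul, abs_of_nonneg hS0]
  have h1 := abs_sub_abs_le_abs_sub (3 * μ * (|ζ| + |ζ'|)) (2 * ν)
  have h2 : |3 * μ * (|ζ| + |ζ'|)| = 3 * (|μ| * (|ζ| + |ζ'|)) := by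
    rw [abs_mul, abs_mul, abs_of_nonneg hS0]; norm_num; ring
  have h3 : |2 * ν| = 2 * |ν| := by rw [abs_mul]; norm_num
  have h4 : |μ| * A ≤ |μ| * (|ζ| + |ζ'|) := by gcongr
  calc |μ| * (|(|ζ| - |ζ'|)| * (|ζ| + |ζ'|)) = |(|ζ| - |ζ'|)| * (|μ| * (|ζ| + |ζ'|)) := by ring
    _ ≤ _ := by gcongr; linarith

lemma abs_resonance_ge {ν μ A ξ₁ ξ₂ : ℝ} (hA : 0 < A) (hν : |ν| ≤ |μ| * A) (h₁ : A ≤ |ξ₁|)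
    (h₂ : A ≤ |ξ₂|) :
    |μ| * (|ξ₁ + ξ₂| * |ξ₁| * |ξ₂|) ≤
      |phase ν μ (ξ₁ + ξ₂) - phase ν μ ξ₁ - phase ν μ ξ₂| := by
  set S := (ξ₁ + ξ₂) * |ξ₁ + ξ₂| - ξ₁ * |ξ₁| - ξ₂ * |ξ₂| with hS
  have e1 : phase ν μ (ξ₁ + ξ₂) - phase ν μ ξ₁ - phase ν μ ξ₂ =
      3 * μ * ((ξ₁ + ξ₂) * ξ₁ * ξ₂) - ν * S := by
    simp only [phase, hS]; ring
  have hSA : A * |S| ≤ 2 * (|ξ₁ + ξ₂| * |ξ₁| * |ξ₂|) := by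
    have hS2 : |S| ≤ 2 * (|ξ₁| * |ξ₂|) ∧ A ≤ |ξ₁ + ξ₂| ∨
        |S| ≤ 2 * (|ξ₁ + ξ₂| * |ξ₁|) ∨ |S| ≤ 2 * (|ξ₁ + ξ₂| * |ξ₂|) := by
      rcases le_total 0 ξ₁ with a | a <;> rcases le_total 0 ξ₂ with b | b
      · left
        rw [hS, abs_of_nonneg a, abs_of_nonneg b, abs_of_nonneg (add_nonneg a b)]
        rw [abs_of_nonneg a] at h₁
        refine ⟨le_of_eq ?_, by linarith⟩
        rw [show (ξ₁ + ξ₂) * (ξ₁ + ξ₂) - ξ₁ * ξ₁ - ξ₂ * ξ₂ = 2 * (ξ₁ * ξ₂) by ring,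
          abs_of_nonneg (by positivity)]
      · right
        rcases le_total 0 (ξ₁ + ξ₂) with c | c
        · right
          rw [hS, abs_of_nonneg a, abs_of_nonpos b, abs_of_nonneg c]
          refine le_of_eq ?_
          rw [show (ξ₁ + ξ₂) * (ξ₁ + ξ₂) - ξ₁ * ξ₁ - ξ₂ * -ξ₂ = 2 * ((ξ₁ + ξ₂) * ξ₂) by ring,
            abs_mul, abs_mul, abs_of_nonneg c, abs_of_nonpos b]
          norm_num
        · left
          rw [hS, abs_of_nonneg a, abs_of_nonpos b, abs_of_nonpos c]
          refine le_of_eq ?_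
          rw [show (ξ₁ + ξ₂) * -(ξ₁ + ξ₂) - ξ₁ * ξ₁ - ξ₂ * -ξ₂ = 2 * (-(ξ₁ + ξ₂) * ξ₁) by ring,
            abs_mul, abs_mul, abs_neg, abs_of_nonpos c, abs_of_nonneg a]
          norm_num
      · right
        rcases le_total 0 (ξ₁ + ξ₂) with c | c
        · left
          rw [hS, abs_of_nonpos a, abs_of_nonneg b, abs_of_nonneg c]
          refine le_of_eq ?_
          rw [show (ξ₁ + ξ₂) * (ξ₁ + ξ₂) - ξ₁ * -ξ₁ - ξ₂ * ξ₂ = 2 * ((ξ₁ + ξ₂) * ξ₁) by ring,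
            abs_mul, abs_mul, abs_of_nonneg c, abs_of_nonpos a]
          norm_num
        · right
          rw [hS, abs_of_nonpos a, abs_of_nonneg b, abs_of_nonpos c]
          refine le_of_eq ?_
          rw [show (ξ₁ + ξ₂) * -(ξ₁ + ξ₂) - ξ₁ * -ξ₁ - ξ₂ * ξ₂ = 2 * (-(ξ₁ + ξ₂) * ξ₂) by ring,
            abs_mul, abs_mul, abs_neg, abs_of_nonpos c, abs_of_nonneg b]
          norm_num
      · left
        rw [hS, abs_of_nonpos a, abs_of_nonpos b, abs_of_nonpos (add_nonpos a b)]
        rw [abs_of_nonpos a] at h₁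
        refine ⟨le_of_eq ?_, by linarith⟩
        rw [show (ξ₁ + ξ₂) * -(ξ₁ + ξ₂) - ξ₁ * -ξ₁ - ξ₂ * -ξ₂ = -(2 * (-ξ₁ * -ξ₂)) by ring,
          abs_neg, abs_of_nonneg (by have : 0 ≤ -ξ₁ := by linarith
                                     have : 0 ≤ -ξ₂ := by linarith
                                     positivity)]
    rcases hS2 with ⟨h, h'⟩ | h | h
    · calc A * |S| ≤ |ξ₁ + ξ₂| * (2 * (|ξ₁| * |ξ₂|)) := by gcongr
        _ = _ := by ring
    · calc A * |S| ≤ |ξ₂| * (2 * (|ξ₁ + ξ₂| * |ξ₁|)) := by gcongr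
        _ = _ := by ring
    · calc A * |S| ≤ |ξ₁| * (2 * (|ξ₁ + ξ₂| * |ξ₂|)) := by gcongr
        _ = _ := by ring
  rw [e1]
  have h1 := abs_sub_abs_le_abs_sub (3 * μ * ((ξ₁ + ξ₂) * ξ₁ * ξ₂)) (ν * S)
  have h2 : |3 * μ * ((ξ₁ + ξ₂) * ξ₁ * ξ₂)| = 3 * (|μ| * (|ξ₁ + ξ₂| * |ξ₁| * |ξ₂|)) := by
    simp only [abs_mul]; norm_num; ring
  have h3 : |ν * S| ≤ 2 * (|μ| * (|ξ₁ + ξ₂| * |ξ₁| * |ξ₂|)) := by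
    rw [abs_mul]
    calc |ν| * |S| ≤ |μ| * A * |S| := by gcongr
      _ = |μ| * (A * |S|) := by ring
      _ ≤ |μ| * (2 * (|ξ₁ + ξ₂| * |ξ₁| * |ξ₂|)) := by gcongr
      _ = _ := by ring
  linarith

/-- Distribution of the resonance gain to the largest modulation. -/
lemma modulation_split {ε c X W x y z B₀ B₁ B₂ : ℝ} (hε : 0 < ε) (hε1 : ε ≤ 1) (hc : 0 < c)
    (hc1 : c ≤ 1) (hX : 1 ≤ X) (hW : 0 ≤ W) (hx : 1 ≤ x) (hy : 1 ≤ y) (hz : 1 ≤ z)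
    (hres : c * X ≤ max x (max y z)) (h₀ : W * X ^ (-1 + ε) ≤ B₀) (h₁ : W * X ^ (-1 + ε) ≤ B₁)
    (h₂ : W * X ^ (-1 + ε) ≤ B₂) :
    W * x ^ (-1 + ε) * y ^ (-(1 + ε)) * z ^ (-(1 + ε)) ≤
      c⁻¹ * (B₀ * (y ^ (-(1 + ε)) * z ^ (-(1 + ε))) + B₁ * (x ^ (-(1 + ε)) * z ^ (-(1 + ε))) +
        B₂ * (x ^ (-(1 + ε)) * y ^ (-(1 + ε)))) := by
  have hx0 : 0 < x := by linarith
  have hy0 : 0 < y := by linarith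
  have hz0 : 0 < z := by linarith
  have hnn : 0 ≤ W * X ^ (-1 + ε) := by positivity
  have hB₀ : 0 ≤ B₀ := hnn.trans h₀
  have hB₁ : 0 ≤ B₁ := hnn.trans h₁
  have hB₂ : 0 ≤ B₂ := hnn.trans h₂
  have hgain : ∀ m B : ℝ, c * X ≤ m → W * X ^ (-1 + ε) ≤ B → W * m ^ (-1 + ε) ≤ c⁻¹ * B := by
    intro m B hm hB
    have h1 : m ^ (-1 + ε) ≤ (c * X) ^ (-1 + ε) :=
      rpow_le_rpow_of_nonpos (by positivity) hm (by linarith)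
    have h2 : c ^ (-1 + ε) ≤ c⁻¹ := by
      rw [← rpow_neg_one]
      exact rpow_le_rpow_of_exponent_ge hc hc1 (by linarith)
    calc W * m ^ (-1 + ε) ≤ W * (c ^ (-1 + ε) * X ^ (-1 + ε)) := by
          rw [← mul_rpow hc.le (by linarith)]; gcongr
      _ = c ^ (-1 + ε) * (W * X ^ (-1 + ε)) := by ring
      _ ≤ c⁻¹ * B := by gcongr
  have hswap : ∀ m : ℝ, x ≤ m → 1 ≤ m →
      x ^ (-1 + ε) * m ^ (-(1 + ε)) ≤ x ^ (-(1 + ε)) * m ^ (-1 + ε) := by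
    intro m hm hm1
    have hm0 : 0 < m := by linarith
    calc x ^ (-1 + ε) * m ^ (-(1 + ε)) = x ^ (2 * ε) * x ^ (-(1 + ε)) * m ^ (-(1 + ε)) := by
          rw [← rpow_add hx0]; ring_nf
      _ ≤ m ^ (2 * ε) * x ^ (-(1 + ε)) * m ^ (-(1 + ε)) := by gcongr
      _ = x ^ (-(1 + ε)) * (m ^ (2 * ε) * m ^ (-(1 + ε))) := by ring
      _ = _ := by rw [← rpow_add hm0]; ring_nf
  have P₀ : 0 ≤ c⁻¹ * (B₀ * (y ^ (-(1 + ε)) * z ^ (-(1 + ε)))) := by positivity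
  have P₁ : 0 ≤ c⁻¹ * (B₁ * (x ^ (-(1 + ε)) * z ^ (-(1 + ε)))) := by positivity
  have P₂ : 0 ≤ c⁻¹ * (B₂ * (x ^ (-(1 + ε)) * y ^ (-(1 + ε)))) := by positivity
  rw [mul_add, mul_add]
  by_cases hmx : max y z ≤ x
  · rw [max_eq_left hmx] at hres
    have : W * x ^ (-1 + ε) * (y ^ (-(1 + ε)) * z ^ (-(1 + ε))) ≤
        c⁻¹ * B₀ * (y ^ (-(1 + ε)) * z ^ (-(1 + ε))) := by
      exact mul_le_mul_of_nonneg_right (hgain x B₀ hres h₀) (by positivity)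
    linarith
  · rw [max_eq_right (not_le.1 hmx).le] at hres
    rcases le_total z y with h | h
    · rw [max_eq_left h] at hres hmx
      have h3 := hswap y (not_le.1 hmx).le hy
      have : W * (x ^ (-1 + ε) * y ^ (-(1 + ε))) * z ^ (-(1 + ε)) ≤
          c⁻¹ * (B₁ * (x ^ (-(1 + ε)) * z ^ (-(1 + ε)))) := by
        calc _ ≤ W * (x ^ (-(1 + ε)) * y ^ (-1 + ε)) * z ^ (-(1 + ε)) := by gcongr
          _ = (W * y ^ (-1 + ε)) * (x ^ (-(1 + ε)) * z ^ (-(1 + ε))) := by ring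
          _ ≤ (c⁻¹ * B₁) * (x ^ (-(1 + ε)) * z ^ (-(1 + ε))) := by
            exact mul_le_mul_of_nonneg_right (hgain y B₁ hres h₁) (by positivity)
          _ = _ := by ring
      linarith
    · rw [max_eq_right h] at hres hmx
      have h3 := hswap z (not_le.1 hmx).le hz
      have : W * (x ^ (-1 + ε) * z ^ (-(1 + ε))) * y ^ (-(1 + ε)) ≤
          c⁻¹ * (B₂ * (x ^ (-(1 + ε)) * y ^ (-(1 + ε)))) := by
        calc _ ≤ W * (x ^ (-(1 + ε)) * z ^ (-1 + ε)) * y ^ (-(1 + ε)) := by gcongr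
          _ = (W * z ^ (-1 + ε)) * (x ^ (-(1 + ε)) * y ^ (-(1 + ε))) := by ring
          _ ≤ (c⁻¹ * B₂) * (x ^ (-(1 + ε)) * y ^ (-(1 + ε))) := by
            exact mul_le_mul_of_nonneg_right (hgain z B₂ hres h₂) (by positivity)
          _ = _ := by ring
      linarith

/-- In the region where one of the input frequencies is small, the frequency weight is controlled
by the transversality weight. -/
lemma weight_le_of_small {ν μ A ρ ξ₁ ξ₂ : ℝ} (hμ : μ ≠ 0) (hA : 2 ≤ A) (hν : |ν| ≤ |μ| * A)
    (hρ : 0 ≤ ρ) (hρ1 : 2 * ρ ≤ 3 / 2) (h : |ξ₁| ≤ A ∨ |ξ₂| ≤ A) :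
    (ξ₁ + ξ₂) ^ 2 * ((1 + |ξ₁|) * (1 + |ξ₂|) / (1 + |ξ₁ + ξ₂|)) ^ (2 * ρ) ≤
      (1 + A) ^ 4 * (16 * A ^ 2 + 2 * |μ|⁻¹) * transWeight ν μ (5 * A) A ξ₁ ξ₂ := by
  have hμ0 : 0 < |μ| := abs_pos.2 hμ
  have hξ := br_pos (ξ₁ + ξ₂)
  have t0 := abs_add_le ξ₁ ξ₂
  have t1 : |ξ₁| ≤ |ξ₁ + ξ₂| + |ξ₂| := by
    simpa using abs_sub_le (ξ₁ + ξ₂) 0 ξ₂ |>.trans_eq' (by simp)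
  have t2 : |ξ₂| ≤ |ξ₁ + ξ₂| + |ξ₁| := by
    simpa using abs_sub_le (ξ₁ + ξ₂) 0 ξ₁ |>.trans_eq' (by simp)
  have n0 := abs_nonneg (ξ₁ + ξ₂)
  have n1 := abs_nonneg ξ₁
  have n2 := abs_nonneg ξ₂
  have hrat : ((1 + |ξ₁|) * (1 + |ξ₂|) / (1 + |ξ₁ + ξ₂|)) ^ (2 * ρ) ≤ (1 + A) ^ 4 := by
    have h1 : (1 + |ξ₁|) * (1 + |ξ₂|) / (1 + |ξ₁ + ξ₂|) ≤ (1 + A) ^ 2 := by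
      rw [div_le_iff₀ hξ]
      rcases h with h | h
      · calc (1 + |ξ₁|) * (1 + |ξ₂|) ≤ (1 + A) * ((1 + A) * (1 + |ξ₁ + ξ₂|)) := by
              gcongr; nlinarith
          _ = _ := by ring
      · calc (1 + |ξ₁|) * (1 + |ξ₂|) ≤ ((1 + A) * (1 + |ξ₁ + ξ₂|)) * (1 + A) := by
              gcongr; nlinarith
          _ = _ := by ring
    calc _ ≤ ((1 + A) ^ 2) ^ (2 * ρ) := by gcongr
      _ ≤ ((1 + A) ^ 2) ^ (2 : ℝ) :=
        rpow_le_rpow_of_exponent_le (by nlinarith) (by linarith)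
      _ = (1 + A) ^ 4 := by rw [rpow_two]; ring
  have hsq : (ξ₁ + ξ₂) ^ 2 ≤ (16 * A ^ 2 + 2 * |μ|⁻¹) * transWeight ν μ (5 * A) A ξ₁ ξ₂ := by
    have hinv : 0 < |μ|⁻¹ := by positivity
    have hsq0 : (ξ₁ + ξ₂) ^ 2 = |ξ₁ + ξ₂| ^ 2 := (sq_abs _).symm
    by_cases hbig : |ξ₁ + ξ₂| ≤ 4 * A
    · have hV : 1 ≤ transWeight ν μ (5 * A) A ξ₁ ξ₂ := by
        have : |ξ₁| ≤ 5 * A ∧ |ξ₂| ≤ 5 * A := by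
          rcases h with h | h <;> constructor <;> linarith
        rw [transWeight, if_pos this]
        have : 0 ≤ (if A ≤ |ξ₁| ∨ A ≤ |ξ₂| then |dphase ν μ ξ₁ - dphase ν μ ξ₂| + √|ξ₁ + ξ₂|
          else 0) := by positivity
        linarith
      rw [hsq0]
      calc |ξ₁ + ξ₂| ^ 2 ≤ 16 * A ^ 2 * 1 := by nlinarith
        _ ≤ _ := by
          gcongr
          linarith
    · rw [not_le] at hbig
      have hor : A ≤ |ξ₁| ∨ A ≤ |ξ₂| := by
        rcases h with h | h
        · right; linarith
        · left; linarith
      have hV : |μ| * |ξ₁ ^ 2 - ξ₂ ^ 2| ≤ transWeight ν μ (5 * A) A ξ₁ ξ₂ := by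
        rw [transWeight, if_pos hor]
        have h0 : (0:ℝ) ≤ if |ξ₁| ≤ 5 * A ∧ |ξ₂| ≤ 5 * A then 1 else 0 := by positivity
        have := abs_dphase_sub_ge hν hor
        have := Real.sqrt_nonneg |ξ₁ + ξ₂|
        linarith
      have hdiff : |ξ₁ + ξ₂| ^ 2 ≤ 2 * |ξ₁ ^ 2 - ξ₂ ^ 2| := by
        have e2 : ξ₁ ^ 2 - ξ₂ ^ 2 = |ξ₁| ^ 2 - |ξ₂| ^ 2 := by rw [sq_abs, sq_abs]
        rw [e2]
        rcases h with h | h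
        · have := neg_abs_le (|ξ₁| ^ 2 - |ξ₂| ^ 2)
          nlinarith
        · have := le_abs_self (|ξ₁| ^ 2 - |ξ₂| ^ 2)
          nlinarith
      rw [hsq0]
      calc |ξ₁ + ξ₂| ^ 2 ≤ 2 * |ξ₁ ^ 2 - ξ₂ ^ 2| := hdiff
        _ = 2 * |μ|⁻¹ * (|μ| * |ξ₁ ^ 2 - ξ₂ ^ 2|) := by field_simp
        _ ≤ 2 * |μ|⁻¹ * transWeight ν μ (5 * A) A ξ₁ ξ₂ := by gcongr
        _ ≤ _ := by
          have := transWeight_nonneg ν μ (5 * A) A ξ₁ ξ₂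
          gcongr
          nlinarith
  calc _ ≤ ((16 * A ^ 2 + 2 * |μ|⁻¹) * transWeight ν μ (5 * A) A ξ₁ ξ₂) * (1 + A) ^ 4 := by
        have := transWeight_nonneg ν μ (5 * A) A ξ₁ ξ₂
        gcongr
    _ = _ := by ring

/-- In the region where both inputs are large, the resonance gain controls the frequency weight by
any of the three transversality weights. -/
lemma weight_le_of_large {ν μ A K ρ ε ξ₁ ξ₂ : ℝ} (hμ : μ ≠ 0) (hA : 2 ≤ A) (hν : |ν| ≤ |μ| * A)
    (hρ : 0 ≤ ρ) (hε : 0 < ε) (hε8 : ε ≤ 1 / 8) (hρε : 2 * ρ ≤ 3 / 2 - 3 * ε)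
    (h₁ : A ≤ |ξ₁|) (h₂ : A ≤ |ξ₂|) :
    ∀ V ∈ ({transWeight ν μ K A ξ₁ ξ₂, transWeight ν μ K A (ξ₁ + ξ₂) (-ξ₂),
      transWeight ν μ K A (ξ₁ + ξ₂) (-ξ₁)} : Set ℝ),
    (ξ₁ + ξ₂) ^ 2 * ((1 + |ξ₁|) * (1 + |ξ₂|) / (1 + |ξ₁ + ξ₂|)) ^ (2 * ρ) *
        (1 + |ξ₁ + ξ₂| * |ξ₁| * |ξ₂|) ^ (-1 + ε) ≤ 27 / 2 * (1 + |μ|⁻¹) * V := by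
  have hμ0 : 0 < |μ| := abs_pos.2 hμ
  have hinv : 0 < |μ|⁻¹ := by positivity
  have htri : |ξ₁ + ξ₂| = |ξ₁| + |ξ₂| ∨ |ξ₁ + ξ₂| = |ξ₁| - |ξ₂| ∨ |ξ₁ + ξ₂| = |ξ₂| - |ξ₁| := by
    rcases abs_cases ξ₁ with a | a <;> rcases abs_cases ξ₂ with b | b <;>
      rcases abs_cases (ξ₁ + ξ₂) with c | c <;> rw [a.1, b.1, c.1] <;>
      first | (left; linarith) | (right; left; linarith) | (right; right; linarith)
  obtain ⟨W, hW⟩ : ∃ W, W = (ξ₁ + ξ₂) ^ 2 *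
    ((1 + |ξ₁|) * (1 + |ξ₂|) / (1 + |ξ₁ + ξ₂|)) ^ (2 * ρ) *
        (1 + |ξ₁ + ξ₂| * |ξ₁| * |ξ₂|) ^ (-1 + ε) := ⟨_, rfl⟩
  rw [← hW]
  have hlow : |ξ₁ + ξ₂| ≤ 1 → 8 / 27 * W ≤ |ξ₁ + ξ₂| * √(|ξ₁| * |ξ₂|) := by
    intro h
    rcases (abs_nonneg (ξ₁ + ξ₂)).eq_or_lt with h0 | h0
    · have : ξ₁ + ξ₂ = 0 := abs_eq_zero.1 h0.symm
      rw [hW, this]; simp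
    · have := smoothing_bound_low hρ hε hε8 hρε (hA.trans h₁) (hA.trans h₂) h0 h
      rw [sq_abs, ← hW] at this
      linarith
  have hhigh : 1 ≤ |ξ₁ + ξ₂| → 8 / 27 * W ≤
      √(|ξ₁| * |ξ₂|) / √|ξ₁ + ξ₂| + √√(|ξ₁| * |ξ₂|) := by
    intro h
    have := smoothing_bound_high hρ hε hε8 hρε (hA.trans h₁) (hA.trans h₂) h (abs_add_le ξ₁ ξ₂)
    rw [sq_abs, ← hW] at this
    linarith
  obtain ⟨c0, c1, c2⟩ := smoothing_compare (hA.trans h₁) (hA.trans h₂) (abs_nonneg _) htri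
    hlow hhigh
  have hV : ∀ ζ ζ' : ℝ, (A ≤ |ζ| ∨ A ≤ |ζ'|) →
      |ζ ^ 2 - ζ' ^ 2| + √|ζ + ζ'| ≤ (1 + |μ|⁻¹) * transWeight ν μ K A ζ ζ' := by
    intro ζ ζ' hor
    have e1 := abs_dphase_sub_ge hν hor
    have e2 : |dphase ν μ ζ - dphase ν μ ζ'| + √|ζ + ζ'| ≤ transWeight ν μ K A ζ ζ' := by
      rw [transWeight, if_pos hor]
      have : (0:ℝ) ≤ if |ζ| ≤ K ∧ |ζ'| ≤ K then 1 else 0 := by positivity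
      linarith
    have e3 : |ζ ^ 2 - ζ' ^ 2| ≤ |μ|⁻¹ * |dphase ν μ ζ - dphase ν μ ζ'| := by
      rw [inv_mul_eq_div, le_div_iff₀ hμ0]; linarith
    have := abs_nonneg (dphase ν μ ζ - dphase ν μ ζ')
    have := Real.sqrt_nonneg |ζ + ζ'|
    calc _ ≤ |μ|⁻¹ * |dphase ν μ ζ - dphase ν μ ζ'| + √|ζ + ζ'| := by linarith
      _ ≤ (1 + |μ|⁻¹) * (|dphase ν μ ζ - dphase ν μ ζ'| + √|ζ + ζ'|) := by nlinarith
      _ ≤ _ := by gcongr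
  simp only [Set.mem_insert_iff, Set.mem_singleton_iff]
  rintro V (rfl | rfl | rfl)
  · have := hV ξ₁ ξ₂ (Or.inl h₁)
    simp only [sq_abs] at c0
    linarith
  · have := hV (ξ₁ + ξ₂) (-ξ₂) (Or.inr (by rwa [abs_neg]))
    rw [add_neg_cancel_right, neg_sq] at this
    simp only [sq_abs] at c1
    linarith
  · have := hV (ξ₁ + ξ₂) (-ξ₁) (Or.inr (by rwa [abs_neg]))
    rw [neg_sq, show ξ₁ + ξ₂ + -ξ₁ = ξ₂ by ring] at this
    simp only [sq_abs] at c2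
    linarith

/-- Constant in the pointwise kernel bound. -/
def kernelConst (μ A : ℝ) : ℝ :=
  (1 + A) ^ 4 * (16 * A ^ 2 + 2 * |μ|⁻¹) + (min 1 |μ| / 3)⁻¹ * (27 / 2 * (1 + |μ|⁻¹))

/-- The pointwise bound of the bilinear kernel by three kernels of transversality type. -/
lemma kernel_sq_le {ν μ A ρ ε ξ₁ ξ₂ s₀ s₁ s₂ : ℝ} (hμ : μ ≠ 0) (hA : 2 ≤ A)
    (hν : |ν| ≤ |μ| * A) (hρ : 0 ≤ ρ) (hε : 0 < ε) (hε8 : ε ≤ 1 / 8)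
    (hρε : 2 * ρ ≤ 3 / 2 - 3 * ε)
    (hs : s₁ + s₂ = s₀ + (phase ν μ (ξ₁ + ξ₂) - phase ν μ ξ₁ - phase ν μ ξ₂)) :
    (ξ₁ + ξ₂) ^ 2 * ((1 + |ξ₁|) * (1 + |ξ₂|) / (1 + |ξ₁ + ξ₂|)) ^ (2 * ρ) *
        (1 + |s₀|) ^ (-1 + ε) * (1 + |s₁|) ^ (-(1 + ε)) * (1 + |s₂|) ^ (-(1 + ε)) ≤
      kernelConst μ A *
        (transWeight ν μ (5 * A) A ξ₁ ξ₂ *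
            ((1 + |s₁|) ^ (-(1 + ε)) * (1 + |s₂|) ^ (-(1 + ε))) +
          transWeight ν μ (5 * A) A (ξ₁ + ξ₂) (-ξ₂) *
            ((1 + |s₀|) ^ (-(1 + ε)) * (1 + |s₂|) ^ (-(1 + ε))) +
          transWeight ν μ (5 * A) A (ξ₁ + ξ₂) (-ξ₁) *
            ((1 + |s₀|) ^ (-(1 + ε)) * (1 + |s₁|) ^ (-(1 + ε)))) := by
  have hμ0 : 0 < |μ| := abs_pos.2 hμ
  have hinv : 0 < |μ|⁻¹ := by positivity
  have b0 := one_le_br s₀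
  have b1 := one_le_br s₁
  have b2 := one_le_br s₂
  set x := 1 + |s₀| with hx
  set y := 1 + |s₁| with hy
  set z := 1 + |s₂| with hz
  set V₀ := transWeight ν μ (5 * A) A ξ₁ ξ₂ with hV₀
  set V₁ := transWeight ν μ (5 * A) A (ξ₁ + ξ₂) (-ξ₂) with hV₁
  set V₂ := transWeight ν μ (5 * A) A (ξ₁ + ξ₂) (-ξ₁) with hV₂
  have v0 : 0 ≤ V₀ := transWeight_nonneg ..
  have v1 : 0 ≤ V₁ := transWeight_nonneg ..
  have v2 : 0 ≤ V₂ := transWeight_nonneg ..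
  set c := min 1 |μ| / 3 with hc
  have hmin : 0 < min 1 |μ| := lt_min one_pos hμ0
  have hc0 : 0 < c := by positivity
  have hc1 : c ≤ 1 := by rw [hc]; linarith [min_le_left 1 |μ|]
  have hW : 0 ≤ (ξ₁ + ξ₂) ^ 2 *
      ((1 + |ξ₁|) * (1 + |ξ₂|) / (1 + |ξ₁ + ξ₂|)) ^ (2 * ρ) := by positivity
  have hP₀ : 0 ≤ V₀ * (y ^ (-(1 + ε)) * z ^ (-(1 + ε))) := by positivity
  have hP₁ : 0 ≤ V₁ * (x ^ (-(1 + ε)) * z ^ (-(1 + ε))) := by positivity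
  have hP₂ : 0 ≤ V₂ * (x ^ (-(1 + ε)) * y ^ (-(1 + ε))) := by positivity
  by_cases hsmall : |ξ₁| ≤ A ∨ |ξ₂| ≤ A
  · have h := weight_le_of_small hμ hA hν hρ (by linarith) hsmall
    have hx1 : x ^ (-1 + ε) ≤ 1 := rpow_le_one_of_one_le_of_nonpos b0 (by linarith)
    calc _ ≤ ((1 + A) ^ 4 * (16 * A ^ 2 + 2 * |μ|⁻¹) * V₀) * 1 * y ^ (-(1 + ε)) *
          z ^ (-(1 + ε)) := by gcongr
      _ = (1 + A) ^ 4 * (16 * A ^ 2 + 2 * |μ|⁻¹) * (V₀ * (y ^ (-(1 + ε)) * z ^ (-(1 + ε)))) := by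
          ring
      _ ≤ kernelConst μ A * (V₀ * (y ^ (-(1 + ε)) * z ^ (-(1 + ε)))) := by
          gcongr
          rw [kernelConst, ← hc]
          have : 0 ≤ c⁻¹ * (27 / 2 * (1 + |μ|⁻¹)) := by positivity
          linarith
      _ ≤ _ := by
          have : 0 ≤ kernelConst μ A := by
            have : 0 ≤ A := by linarith
            rw [kernelConst]; positivity
          gcongr
          linarith
  · push Not at hsmall
    have h := weight_le_of_large (K := 5 * A) hμ hA hν hρ hε hε8 hρε hsmall.1.le hsmall.2.le
    have hX : (1:ℝ) ≤ 1 + |ξ₁ + ξ₂| * |ξ₁| * |ξ₂| := by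
      have : 0 ≤ |ξ₁ + ξ₂| * |ξ₁| * |ξ₂| := by positivity
      linarith
    have hres : c * (1 + |ξ₁ + ξ₂| * |ξ₁| * |ξ₂|) ≤ max x (max y z) := by
      have hR := abs_resonance_ge (by linarith : 0 < A) hν hsmall.1.le hsmall.2.le
      rw [show phase ν μ (ξ₁ + ξ₂) - phase ν μ ξ₁ - phase ν μ ξ₂ = s₁ + s₂ - s₀ by linarith]
        at hR
      have t : |s₁ + s₂ - s₀| ≤ |s₁| + |s₂| + |s₀| :=
        (abs_sub _ _).trans (by gcongr; exact abs_add_le _ _)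
      have m0 := le_max_left x (max y z)
      have m1 := (le_max_left y z).trans (le_max_right x (max y z))
      have m2 := (le_max_right y z).trans (le_max_right x (max y z))
      have hl : 0 ≤ |ξ₁ + ξ₂| * |ξ₁| * |ξ₂| := by positivity
      have k1 : min 1 |μ| * (|ξ₁ + ξ₂| * |ξ₁| * |ξ₂|) ≤ |μ| * (|ξ₁ + ξ₂| * |ξ₁| * |ξ₂|) := by
        gcongr; exact min_le_right _ _
      have k2 := min_le_left 1 |μ|
      rw [hc]
      linarith
    have hspl := modulation_split hε (by linarith) hc0 hc1 hX hW b0 b1 b2 hres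
      (h V₀ (by simp [hV₀])) (h V₁ (by simp [hV₁])) (h V₂ (by simp [hV₂]))
    refine hspl.trans ?_
    calc _ = c⁻¹ * (27 / 2 * (1 + |μ|⁻¹)) * (V₀ * (y ^ (-(1 + ε)) * z ^ (-(1 + ε))) +
          V₁ * (x ^ (-(1 + ε)) * z ^ (-(1 + ε))) + V₂ * (x ^ (-(1 + ε)) * y ^ (-(1 + ε)))) := by
          ring
      _ ≤ _ := by
          gcongr
          rw [kernelConst, ← hc]
          have : 0 ≤ A := by linarith
          have : 0 ≤ (1 + A) ^ 4 * (16 * A ^ 2 + 2 * |μ|⁻¹) := by positivity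
          linarith

section Schur

variable {α : Type*} [MeasurableSpace α] {m : Measure α}

lemma lintegral_mul_sq_le {f g : α → ℝ≥0∞} (hf : AEMeasurable f m) (hg : AEMeasurable g m) :
    (∫⁻ x, f x * g x ∂m) ^ 2 ≤ (∫⁻ x, f x ^ 2 ∂m) * ∫⁻ x, g x ^ 2 ∂m := by
  have h := ENNReal.lintegral_mul_le_Lp_mul_Lq m (Real.HolderConjugate.two_two) hf hg
  calc (∫⁻ x, f x * g x ∂m) ^ 2 ≤ ((∫⁻ x, f x ^ (2:ℝ) ∂m) ^ (1 / 2 : ℝ) *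
        (∫⁻ x, g x ^ (2:ℝ) ∂m) ^ (1 / 2 : ℝ)) ^ 2 := by gcongr; exact h
    _ = _ := by
        rw [mul_pow, ← ENNReal.rpow_natCast, ← ENNReal.rpow_natCast, ← ENNReal.rpow_mul,
          ← ENNReal.rpow_mul]
        simp

lemma lintegral_const_mul_add_add {f g h : α → ℝ≥0∞} (hf : Measurable f) (hg : Measurable g)
    (hh : Measurable h) (c : ℝ≥0∞) :
    ∫⁻ x, c * (f x + g x + h x) ∂m = c * (∫⁻ x, f x ∂m + ∫⁻ x, g x ∂m + ∫⁻ x, h x ∂m) := by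
  rw [lintegral_const_mul _ (by fun_prop), lintegral_add_left (by fun_prop),
    lintegral_add_left hf]

/-- An `L²` bound by duality. -/
lemma lintegral_sq_le_of_dual [SigmaFinite m] {T : α → ℝ≥0∞} (hT : Measurable T) {C : ℝ≥0∞}
    (h : ∀ H : α → ℝ≥0∞, Measurable H → (∫⁻ x, T x * H x ∂m) ^ 2 ≤ C * ∫⁻ x, H x ^ 2 ∂m) :
    ∫⁻ x, T x ^ 2 ∂m ≤ C := by
  set S := spanningSets m with hS
  have hSm : ∀ n, MeasurableSet (S n) := measurableSet_spanningSets m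
  set H : ℕ → α → ℝ≥0∞ := fun n => (S n).indicator (fun x => min (T x) n) with hH
  have hHm : ∀ n, Measurable (H n) := fun n =>
    (hT.min measurable_const).indicator (hSm n)
  have hHT : ∀ n x, H n x ≤ T x := fun n x => by
    simp only [hH]
    exact (Set.indicator_le_self' (by simp) x).trans (min_le_left _ _)
  have hbound : ∀ n, ∫⁻ x, H n x ^ 2 ∂m ≤ C := by
    intro n
    have hfin : ∫⁻ x, H n x ^ 2 ∂m ≠ ∞ := by
      have : ∫⁻ x, H n x ^ 2 ∂m ≤ ∫⁻ x, (S n).indicator (fun _ => (n:ℝ≥0∞) ^ 2) x ∂m := by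
        apply lintegral_mono
        intro x
        by_cases hx : x ∈ S n
        · simp only [hH, Set.indicator_of_mem hx]
          gcongr; exact min_le_right _ _
        · simp [hH, Set.indicator_of_notMem hx]
      refine ne_top_of_le_ne_top ?_ this
      rw [lintegral_indicator (hSm n), lintegral_const, Measure.restrict_apply_univ]
      exact ENNReal.mul_ne_top (by simp) (measure_spanningSets_lt_top m n).ne
    rcases eq_or_ne (∫⁻ x, H n x ^ 2 ∂m) 0 with h0 | h0
    · rw [h0]; exact zero_le
    have h1 : (∫⁻ x, H n x ^ 2 ∂m) ^ 2 ≤ C * ∫⁻ x, H n x ^ 2 ∂m := by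
      refine le_trans ?_ (h (H n) (hHm n))
      gcongr with x
      rw [sq]
      gcongr
      exact hHT n x
    rw [sq] at h1
    exact (ENNReal.mul_le_mul_iff_left h0 hfin).1 h1
  have hmono : ∀ᵐ x ∂m, Monotone fun n => H n x ^ 2 := by
    refine ae_of_all _ fun x i j hij => ?_
    have : H i x ≤ H j x := by
      simp only [hH]
      by_cases hx : x ∈ S i
      · rw [Set.indicator_of_mem hx, Set.indicator_of_mem (monotone_spanningSets m hij hx)]
        gcongr
      · rw [Set.indicator_of_notMem hx]; exact zero_le
    exact pow_le_pow_left₀ zero_le this 2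
  have hlim : ∀ᵐ x ∂m, Filter.Tendsto (fun n => H n x ^ 2) Filter.atTop (nhds (T x ^ 2)) := by
    refine ae_of_all _ fun x => ?_
    refine ENNReal.Tendsto.pow ?_
    have h1 : Filter.Tendsto (fun n : ℕ => min (T x) (n:ℝ≥0∞)) Filter.atTop (nhds (T x)) := by
      simpa using (tendsto_const_nhds (x := T x)).min ENNReal.tendsto_nat_nhds_top
    refine h1.congr' ?_
    filter_upwards [Filter.eventually_ge_atTop (spanningSetsIndex m x)] with n hn
    simp only [hH]
    rw [Set.indicator_of_mem (mem_spanningSets_of_index_le m x hn)]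
  exact le_of_tendsto' (lintegral_tendsto_of_tendsto_of_monotone
    (fun n => ((hHm n).pow_const 2).aemeasurable) hmono hlim) hbound

end Schur

lemma le_rpow_half_of_sq_le {x y : ℝ≥0∞} (h : x ^ 2 ≤ y) : x ≤ y ^ (1 / 2 : ℝ) := by
  calc x = (x ^ 2) ^ (1 / 2 : ℝ) := by
        rw [← ENNReal.rpow_natCast, ← ENNReal.rpow_mul]; simp
    _ ≤ _ := ENNReal.rpow_le_rpow h (by norm_num)

lemma rpow_half_sq (x : ℝ≥0∞) : (x ^ (1 / 2 : ℝ)) ^ 2 = x := by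
  rw [← ENNReal.rpow_natCast, ← ENNReal.rpow_mul]; simp

section Group

variable {E : Type*} [MeasurableSpace E] [AddCommGroup E] [MeasurableAdd₂ E] [MeasurableNeg E]
  {m : Measure E} [SigmaFinite m] [m.IsAddLeftInvariant]

lemma lintegral_conv_eq {G H : E → ℝ≥0∞} (hG : Measurable G) (hH : Measurable H) :
    ∫⁻ P, ∫⁻ q, G q * H (P - q) ∂m ∂m = (∫⁻ q, G q ∂m) * ∫⁻ q, H q ∂m := by
  have hsub : Measurable fun z : E × E => z.1 - z.2 := by
    simp_rw [sub_eq_add_neg]; fun_prop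
  rw [lintegral_lintegral_swap (by
    exact ((hG.comp measurable_snd).mul (hH.comp hsub)).aemeasurable)]
  have : ∀ q, ∫⁻ P, G q * H (P - q) ∂m = G q * ∫⁻ P, H P ∂m := by
    intro q
    have : Measurable fun P => H (P - q) := hH.comp (hsub.comp (measurable_id.prodMk
      measurable_const))
    rw [lintegral_const_mul _ this, lintegral_sub_right_eq_self]
  simp_rw [this]
  rw [lintegral_mul_const _ hG]

/-- Schur-type estimate for a trilinear form with kernel square-integrable along fibres. -/
lemma trilinear_schur {F G H : E → ℝ≥0∞} {κ : E → E → ℝ≥0∞} (hF : Measurable F)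
    (hG : Measurable G) (hH : Measurable H) (hκ : Measurable (Function.uncurry κ)) {M : ℝ≥0∞}
    (hM : ∀ P, ∫⁻ q, κ P q ^ 2 ∂m ≤ M) :
    (∫⁻ P, ∫⁻ q, F P * (G q * H (P - q) * κ P q) ∂m ∂m) ^ 2 ≤
      M * ((∫⁻ q, F q ^ 2 ∂m) * (∫⁻ q, G q ^ 2 ∂m) * ∫⁻ q, H q ^ 2 ∂m) := by
  have hsub : Measurable fun z : E × E => z.1 - z.2 := by
    simp_rw [sub_eq_add_neg]; fun_prop
  have hGH : Measurable fun z : E × E => G z.2 * H (z.1 - z.2) :=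
    (hG.comp measurable_snd).mul (hH.comp hsub)
  have hfull : Measurable fun z : E × E => G z.2 * H (z.1 - z.2) * κ z.1 z.2 := hGH.mul hκ
  have hin : ∀ P, (∫⁻ q, G q * H (P - q) * κ P q ∂m) ^ 2 ≤
      (∫⁻ q, G q ^ 2 * H (P - q) ^ 2 ∂m) * M := by
    intro P
    have h1 : Measurable fun q => G q * H (P - q) := hGH.comp measurable_prodMk_left
    have h2 : Measurable fun q => κ P q := hκ.comp measurable_prodMk_left
    refine (lintegral_mul_sq_le h1.aemeasurable h2.aemeasurable).trans ?_
    simp only [mul_pow]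
    gcongr
    exact hM P
  have e1 : ∀ P, ∫⁻ q, F P * (G q * H (P - q) * κ P q) ∂m =
      F P * ∫⁻ q, G q * H (P - q) * κ P q ∂m := fun P =>
    lintegral_const_mul _ (hfull.comp measurable_prodMk_left)
  simp_rw [e1]
  refine (lintegral_mul_sq_le hF.aemeasurable
    hfull.lintegral_prod_right'.aemeasurable).trans ?_
  calc _ ≤ (∫⁻ q, F q ^ 2 ∂m) * ∫⁻ P, (∫⁻ q, G q ^ 2 * H (P - q) ^ 2 ∂m) * M ∂m := by
        gcongr with P; exact hin P
    _ = (∫⁻ q, F q ^ 2 ∂m) * (((∫⁻ q, G q ^ 2 ∂m) * ∫⁻ q, H q ^ 2 ∂m) * M) := by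
        rw [lintegral_mul_const, lintegral_conv_eq (hG.pow_const 2) (hH.pow_const 2)]
        exact (((hG.comp measurable_snd).pow_const 2).mul
          ((hH.comp hsub).pow_const 2)).lintegral_prod_right'
    _ = _ := by ring

/-- A bilinear convolution operator whose squared kernel is controlled by three kernels
related by the symmetries of the convolution. -/
lemma bilinear_of_schur [m.IsNegInvariant] {k Q : E → E → ℝ≥0∞} (hk : Measurable (Function.uncurry k))
    (hQ : Measurable (Function.uncurry Q)) {L M : ℝ≥0∞}
    (hM : ∀ P, ∫⁻ q, Q q (P - q) ∂m ≤ M)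
    (hkQ : ∀ q q', k q q' ^ 2 ≤ L * (Q q q' + Q (q + q') (-q') + Q (q + q') (-q)))
    {F G : E → ℝ≥0∞} (hF : Measurable F) (hG : Measurable G) :
    ∫⁻ P, (∫⁻ q, k q (P - q) * (F q * G (P - q)) ∂m) ^ 2 ∂m ≤
      9 * L * M * ((∫⁻ q, F q ^ 2 ∂m) * ∫⁻ q, G q ^ 2 ∂m) := by
  have hsub : Measurable fun z : E × E => z.1 - z.2 := by
    simp_rw [sub_eq_add_neg]; fun_prop
  have hkP : Measurable fun z : E × E => k z.2 (z.1 - z.2) * (F z.2 * G (z.1 - z.2)) :=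
    (hk.comp (measurable_snd.prodMk hsub)).mul ((hF.comp measurable_snd).mul (hG.comp hsub))
  refine lintegral_sq_le_of_dual hkP.lintegral_prod_right' fun H hH => ?_
  set κ : E → E → ℝ≥0∞ := fun P q => Q q (P - q) ^ (1 / 2 : ℝ) with hκ
  have hκm : Measurable (Function.uncurry κ) :=
    (hQ.comp (measurable_snd.prodMk hsub)).pow_const _
  have hκM : ∀ P, ∫⁻ q, κ P q ^ 2 ∂m ≤ M := fun P => by
    simp only [hκ, rpow_half_sq]; exact hM P
  set R := M * ((∫⁻ q, H q ^ 2 ∂m) * (∫⁻ q, F q ^ 2 ∂m) * ∫⁻ q, G q ^ 2 ∂m) with hR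
  have h1 : ∫⁻ P, ∫⁻ q, H P * (F q * G (P - q) * κ P q) ∂m ∂m ≤ R ^ (1 / 2 : ℝ) :=
    le_rpow_half_of_sq_le (trilinear_schur hH hF hG hκm hκM)
  have hneg : ∀ {f : E → ℝ≥0∞}, Measurable f → Measurable fun x => f (-x) :=
    fun hf => hf.comp measurable_neg
  have hnegi : ∀ f : E → ℝ≥0∞, ∫⁻ q, f (-q) ^ 2 ∂m = ∫⁻ q, f q ^ 2 ∂m := fun f =>
    lintegral_neg_eq_self (fun x => f x ^ 2)
  have hswap : ∀ F' G' : E → ℝ≥0∞, Measurable F' → Measurable G' →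
      ∫⁻ P, ∫⁻ q, H P * (F' q * G' (P - q) * κ q P) ∂m ∂m =
        ∫⁻ q, ∫⁻ P, F' q * (H P * G' (-(q - P)) * κ q P) ∂m ∂m := by
    intro F' G' hF' hG'
    rw [lintegral_lintegral_swap]
    · simp only [neg_sub]
      congr! 4
      ring
    · exact ((hH.comp measurable_fst).mul (((hF'.comp measurable_snd).mul (hG'.comp hsub)).mul
        (hκm.comp measurable_swap))).aemeasurable
  have h2 : ∫⁻ P, ∫⁻ q, H P * (F q * G (P - q) * κ q P) ∂m ∂m ≤ R ^ (1 / 2 : ℝ) := by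
    rw [hswap F G hF hG]
    refine le_rpow_half_of_sq_le ((trilinear_schur hF hH (hneg hG) hκm hκM).trans (le_of_eq ?_))
    rw [hnegi, hR]; ring
  have h3 : ∫⁻ P, ∫⁻ q, H P * (G q * F (P - q) * κ q P) ∂m ∂m ≤ R ^ (1 / 2 : ℝ) := by
    rw [hswap G F hG hF]
    refine le_rpow_half_of_sq_le ((trilinear_schur hG hH (hneg hF) hκm hκM).trans (le_of_eq ?_))
    rw [hnegi, hR]; ring
  have h3' : ∫⁻ P, ∫⁻ q, H P * (F q * G (P - q) * κ (P - q) P) ∂m ∂m ≤ R ^ (1 / 2 : ℝ) := by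
    refine le_trans (le_of_eq ?_) h3
    congr! 2 with P
    rw [← lintegral_sub_left_eq_self (fun q => H P * (G q * F (P - q) * κ q P)) P]
    simp only [sub_sub_cancel]
    congr! 2
    ring
  have hkle : ∀ P q, k q (P - q) ≤ L ^ (1 / 2 : ℝ) * (κ P q + κ q P + κ (P - q) P) := by
    intro P q
    have h := le_rpow_half_of_sq_le (hkQ q (P - q))
    rw [ENNReal.mul_rpow_of_nonneg _ _ (by norm_num)] at h
    refine h.trans ?_
    gcongr
    refine (ENNReal.rpow_add_le_add_rpow _ _ (by norm_num) (by norm_num)).trans ?_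
    refine add_le_add ((ENNReal.rpow_add_le_add_rpow _ _ (by norm_num) (by norm_num)).trans
      (le_of_eq ?_)) (le_of_eq ?_)
    · simp only [hκ, add_sub_cancel, neg_sub]
    · simp only [hκ, add_sub_cancel, sub_sub_cancel_left]
  have hm1 : Measurable fun z : E × E => H z.1 * (F z.2 * G (z.1 - z.2) * κ z.1 z.2) :=
    (hH.comp measurable_fst).mul (((hF.comp measurable_snd).mul (hG.comp hsub)).mul hκm)
  have hm2 : Measurable fun z : E × E => H z.1 * (F z.2 * G (z.1 - z.2) * κ z.2 z.1) :=
    (hH.comp measurable_fst).mul (((hF.comp measurable_snd).mul (hG.comp hsub)).mul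
      (hκm.comp measurable_swap))
  have hm3 : Measurable fun z : E × E => H z.1 * (F z.2 * G (z.1 - z.2) * κ (z.1 - z.2) z.1) :=
    (hH.comp measurable_fst).mul (((hF.comp measurable_snd).mul (hG.comp hsub)).mul
      (hκm.comp (hsub.prodMk measurable_fst)))
  have htot : ∫⁻ P, (∫⁻ q, k q (P - q) * (F q * G (P - q)) ∂m) * H P ∂m ≤
      L ^ (1 / 2 : ℝ) * (3 * R ^ (1 / 2 : ℝ)) := by
    calc _ ≤ ∫⁻ P, ∫⁻ q, L ^ (1 / 2 : ℝ) * (H P * (F q * G (P - q) * κ P q) +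
          H P * (F q * G (P - q) * κ q P) + H P * (F q * G (P - q) * κ (P - q) P)) ∂m ∂m := by
          apply lintegral_mono
          intro P
          dsimp only
          have hkP' : Measurable fun q => k q (P - q) * (F q * G (P - q)) :=
            hkP.comp measurable_prodMk_left
          rw [mul_comm, ← lintegral_const_mul _ hkP']
          apply lintegral_mono
          intro q
          calc H P * (k q (P - q) * (F q * G (P - q)))
              ≤ H P * ((L ^ (1 / 2 : ℝ) * (κ P q + κ q P + κ (P - q) P)) *
                (F q * G (P - q))) := by gcongr; exact hkle P q
            _ = _ := by ring
      _ = L ^ (1 / 2 : ℝ) * (∫⁻ P, ∫⁻ q, H P * (F q * G (P - q) * κ P q) ∂m ∂m +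
          ∫⁻ P, ∫⁻ q, H P * (F q * G (P - q) * κ q P) ∂m ∂m +
          ∫⁻ P, ∫⁻ q, H P * (F q * G (P - q) * κ (P - q) P) ∂m ∂m) := by
          have e : ∀ P, ∫⁻ q, L ^ (1 / 2 : ℝ) * (H P * (F q * G (P - q) * κ P q) +
              H P * (F q * G (P - q) * κ q P) + H P * (F q * G (P - q) * κ (P - q) P)) ∂m =
              L ^ (1 / 2 : ℝ) * (∫⁻ q, H P * (F q * G (P - q) * κ P q) ∂m +
              ∫⁻ q, H P * (F q * G (P - q) * κ q P) ∂m +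
              ∫⁻ q, H P * (F q * G (P - q) * κ (P - q) P) ∂m) := by
            exact fun P => lintegral_const_mul_add_add (hm1.comp measurable_prodMk_left)
              (hm2.comp measurable_prodMk_left) (hm3.comp measurable_prodMk_left) _
          simp_rw [e]
          exact lintegral_const_mul_add_add hm1.lintegral_prod_right' hm2.lintegral_prod_right'
            hm3.lintegral_prod_right' _
      _ ≤ L ^ (1 / 2 : ℝ) * (R ^ (1 / 2 : ℝ) + R ^ (1 / 2 : ℝ) + R ^ (1 / 2 : ℝ)) := by gcongr
      _ = _ := by ring
  calc _ ≤ (L ^ (1 / 2 : ℝ) * (3 * R ^ (1 / 2 : ℝ))) ^ 2 := by gcongr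
    _ = L * (9 * R) := by
        rw [mul_pow, mul_pow, rpow_half_sq, rpow_half_sq]; norm_num
    _ = _ := by rw [hR]; ring

end Group

lemma phase_scale {a : ℝ} (ha : 0 < a) (ν μ ξ : ℝ) :
    phase (ν * a) μ (a * ξ) = a ^ 3 * phase ν μ ξ := by
  rw [phase, phase, abs_mul, abs_of_pos ha]; ring

lemma phase_neg (ν μ ξ : ℝ) : phase ν μ (-ξ) = -phase ν μ ξ := by
  rw [phase, phase, abs_neg]; ring

/-- Transversality kernel on the Fourier side, at spatial scale `a`. -/
def transKernel (ν μ A p a : ℝ) (q q' : ℝ × ℝ) : ℝ≥0∞ :=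
  ENNReal.ofReal (transWeight (ν * a) μ (5 * A) A (a * q.1) (a * q'.1)) *
    (jb (-p) (a ^ 3 * (q.2 - phase ν μ q.1)) * jb (-p) (a ^ 3 * (q'.2 - phase ν μ q'.1)))

lemma measurable_transKernel (ν μ A p a : ℝ) :
    Measurable (Function.uncurry (transKernel ν μ A p a)) := by
  have h1 := measurable_transWeight (ν * a) μ (5 * A) A
  have h2 := measurable_phase ν μ
  have h3 : Measurable fun z : (ℝ × ℝ) × (ℝ × ℝ) =>
      transWeight (ν * a) μ (5 * A) A (a * z.1.1) (a * z.2.1) :=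
    h1.comp (g := fun z : ℝ × ℝ => transWeight (ν * a) μ (5 * A) A z.1 z.2)
      (f := fun z : (ℝ × ℝ) × (ℝ × ℝ) => (a * z.1.1, a * z.2.1)) (by fun_prop)
  unfold transKernel Function.uncurry
  fun_prop

/-- The constant bounding the fibre integrals of the transversality kernel. -/
def transConst (μ A p : ℝ) : ℝ≥0∞ :=
  ENNReal.ofReal (2 ^ p) * (2 * ∫⁻ y, jb (-p) y) *
    (ENNReal.ofReal (2 * (5 * A)) +
      4 * (ENNReal.ofReal (1 + (√|μ|)⁻¹) * (6 + 4 * ∫⁻ y, jb (-p) y)))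

lemma transConst_lt_top (μ A : ℝ) {p : ℝ} (hp : 1 < p) : transConst μ A p < ∞ := by
  have := (lintegral_jb_lt_top hp).ne
  unfold transConst
  finiteness

lemma measurable_fibre {Q : ℝ × ℝ → ℝ × ℝ → ℝ≥0∞} (hQ : Measurable (Function.uncurry Q))
    (P : ℝ × ℝ) : Measurable fun q => Q q (P - q) := by
  have h : Measurable fun q : ℝ × ℝ => (q, P - q) := by fun_prop
  exact hQ.comp h

lemma lintegral_transKernel_le {ν μ A p a : ℝ} (hp : 0 ≤ p) (hμ : μ ≠ 0) (ha : 0 < a)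
    (ha1 : a ≤ 1) (hνA : |ν| ≤ |μ| * A) (P : ℝ × ℝ) :
    ∫⁻ q, transKernel ν μ A p a q (P - q) ≤ ENNReal.ofReal ((a ^ 4)⁻¹) * transConst μ A p := by
  obtain ⟨X, T⟩ := P
  have hm : Measurable fun q => transKernel ν μ A p a q ((X, T) - q) :=
    measurable_fibre (measurable_transKernel ν μ A p a) (X, T)
  have ha3 : 0 < a ^ 3 := by positivity
  have hνa : |ν * a| ≤ |μ| * A := by
    rw [abs_mul, abs_of_pos ha]
    exact (mul_le_of_le_one_right (abs_nonneg _) ha1).trans hνA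
  set c₁ := ENNReal.ofReal (2 ^ p) * (2 * ∫⁻ y, jb (-p) y) with hc₁
  have hφm := measurable_phase (ν * a) μ
  have htw : Measurable fun ζ => transWeight (ν * a) μ (5 * A) A ζ (a * X - ζ) :=
    (measurable_transWeight (ν * a) μ (5 * A) A).comp
      (measurable_id.prodMk (measurable_const.sub measurable_id))
  rw [Measure.volume_eq_prod, lintegral_prod _ hm.aemeasurable]
  have hinner : ∀ ξ, ∫⁻ τ, transKernel ν μ A p a (ξ, τ) ((X, T) - (ξ, τ)) ≤
      ENNReal.ofReal (a ^ 3)⁻¹ * c₁ *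
        (ENNReal.ofReal (transWeight (ν * a) μ (5 * A) A (a * ξ) (a * X - a * ξ)) *
          jb (-p) (a ^ 3 * T - phase (ν * a) μ (a * ξ) - phase (ν * a) μ (a * X - a * ξ))) := by
    intro ξ
    set w := ENNReal.ofReal (transWeight (ν * a) μ (5 * A) A (a * ξ) (a * X - a * ξ)) with hw
    set α := phase (ν * a) μ (a * ξ) with hα
    set β := phase (ν * a) μ (a * X - a * ξ) with hβ
    have e : ∀ τ, transKernel ν μ A p a (ξ, τ) ((X, T) - (ξ, τ)) =
        w * (fun s => jb (-p) (s - α) * jb (-p) (a ^ 3 * T - s - β)) (a ^ 3 * τ) := by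
      intro τ
      simp only [transKernel, hw, Prod.mk_sub_mk, hα, hβ, ← mul_sub a X ξ, phase_scale ha]
      rw [mul_sub (a ^ 3) τ, mul_sub (a ^ 3) (T - τ), mul_sub (a ^ 3) T]
    simp_rw [e]
    rw [lintegral_const_mul _ (by fun_prop), lintegral_comp_mul ha3
      (fun s => jb (-p) (s - α) * jb (-p) (a ^ 3 * T - s - β)) (by fun_prop)]
    calc _ ≤ w * (ENNReal.ofReal (a ^ 3)⁻¹ * (c₁ * jb (-p) (a ^ 3 * T - α - β))) := by
          gcongr; exact lintegral_jb_conv_le hp _ _ _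
      _ = _ := by ring
  set g : ℝ → ℝ≥0∞ := fun ζ =>
    ENNReal.ofReal (transWeight (ν * a) μ (5 * A) A ζ (a * X - ζ)) *
      jb (-p) (a ^ 3 * T - phase (ν * a) μ ζ - phase (ν * a) μ (a * X - ζ)) with hg
  have hgm : Measurable g := by rw [hg]; fun_prop
  calc _ ≤ ∫⁻ ξ, ENNReal.ofReal (a ^ 3)⁻¹ * c₁ * g (a * ξ) := lintegral_mono hinner
    _ = ENNReal.ofReal (a ^ 3)⁻¹ * c₁ * (ENNReal.ofReal a⁻¹ *
        ∫⁻ ζ, g ζ) := by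
        rw [lintegral_const_mul _ (by fun_prop), lintegral_comp_mul ha g hgm]
    _ ≤ ENNReal.ofReal (a ^ 3)⁻¹ * c₁ * (ENNReal.ofReal a⁻¹ *
        (ENNReal.ofReal (2 * (5 * A)) +
          4 * (ENNReal.ofReal (1 + (√|μ|)⁻¹) * (6 + 4 * ∫⁻ y, jb (-p) y)))) := by
        gcongr
        exact lintegral_transWeight_le hp hμ hνa _ _
    _ = _ := by
        rw [transConst, ← hc₁, show (a ^ 4)⁻¹ = (a ^ 3)⁻¹ * a⁻¹ by field_simp,
          ENNReal.ofReal_mul (p := (a ^ 3)⁻¹) (by positivity)]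
        ring

/-- The rescaled bilinear kernel of `∂ₓ(uv)` in Bourgain spaces. -/
def bilinKernel (ν μ ρ ε a : ℝ) (q q' : ℝ × ℝ) : ℝ≥0∞ :=
  ENNReal.ofReal (|q.1 + q'.1| *
      ((1 + |a * q.1|) * (1 + |a * q'.1|) / (1 + |a * (q.1 + q'.1)|)) ^ ρ) *
    (jb ((-1 + ε) / 2) (a ^ 3 * (q.2 + q'.2 - phase ν μ (q.1 + q'.1))) *
      (jb (-((1 + ε) / 2)) (a ^ 3 * (q.2 - phase ν μ q.1)) *
        jb (-((1 + ε) / 2)) (a ^ 3 * (q'.2 - phase ν μ q'.1))))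

lemma measurable_bilinKernel (ν μ ρ ε a : ℝ) :
    Measurable (Function.uncurry (bilinKernel ν μ ρ ε a)) := by
  have h2 := measurable_phase ν μ
  unfold bilinKernel Function.uncurry
  fun_prop

lemma bilinKernel_sq_le {ν μ A ρ ε a : ℝ} (hμ : μ ≠ 0) (hA : 2 ≤ A) (hνA : |ν| ≤ |μ| * A)
    (hρ : 0 ≤ ρ) (hε : 0 < ε) (hε8 : ε ≤ 1 / 8) (hρε : 2 * ρ ≤ 3 / 2 - 3 * ε) (ha : 0 < a)
    (ha1 : a ≤ 1) (q q' : ℝ × ℝ) :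
    bilinKernel ν μ ρ ε a q q' ^ 2 ≤ ENNReal.ofReal ((a ^ 2)⁻¹ * kernelConst μ A) *
      (transKernel ν μ A (1 + ε) a q q' + transKernel ν μ A (1 + ε) a (q + q') (-q') +
        transKernel ν μ A (1 + ε) a (q + q') (-q)) := by
  obtain ⟨ξ₁, τ₁⟩ := q
  obtain ⟨ξ₂, τ₂⟩ := q'
  have hνa : |ν * a| ≤ |μ| * A := by
    rw [abs_mul, abs_of_pos ha]
    exact (mul_le_of_le_one_right (abs_nonneg _) ha1).trans hνA
  set s₁ := a ^ 3 * (τ₁ - phase ν μ ξ₁) with hs₁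
  set s₂ := a ^ 3 * (τ₂ - phase ν μ ξ₂) with hs₂
  set s₀ := a ^ 3 * (τ₁ + τ₂ - phase ν μ (ξ₁ + ξ₂)) with hs₀
  have hs : s₁ + s₂ = s₀ + (phase (ν * a) μ (a * ξ₁ + a * ξ₂) - phase (ν * a) μ (a * ξ₁) -
      phase (ν * a) μ (a * ξ₂)) := by
    rw [← mul_add a, phase_scale ha, phase_scale ha, phase_scale ha]; ring
  have key := kernel_sq_le (s₀ := s₀) hμ hA hνa hρ hε hε8 hρε hs
  have b₁ := br_pos (a * ξ₁)
  have b₂ := br_pos (a * ξ₂)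
  have b₀ := br_pos (a * ξ₁ + a * ξ₂)
  have c₁ := br_pos s₁
  have c₂ := br_pos s₂
  have c₀ := br_pos s₀
  have hKn : 0 ≤ kernelConst μ A := by
    have : 0 ≤ A := by linarith
    rw [kernelConst]; positivity
  have t1 := transWeight_nonneg (ν * a) μ (5 * A) A (a * ξ₁) (a * ξ₂)
  have t2 := transWeight_nonneg (ν * a) μ (5 * A) A (a * ξ₁ + a * ξ₂) (-(a * ξ₂))
  have t3 := transWeight_nonneg (ν * a) μ (5 * A) A (a * ξ₁ + a * ξ₂) (-(a * ξ₁))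
  have e1 : bilinKernel ν μ ρ ε a (ξ₁, τ₁) (ξ₂, τ₂) ^ 2 = ENNReal.ofReal ((a ^ 2)⁻¹ *
      ((a * ξ₁ + a * ξ₂) ^ 2 * ((1 + |a * ξ₁|) * (1 + |a * ξ₂|) / (1 + |a * ξ₁ + a * ξ₂|)) ^
        (2 * ρ) * (1 + |s₀|) ^ (-1 + ε) * (1 + |s₁|) ^ (-(1 + ε)) * (1 + |s₂|) ^ (-(1 + ε)))) := by
    simp only [bilinKernel, ← hs₁, ← hs₂, ← hs₀, mul_pow, jb_sq, mul_add a]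
    rw [← ENNReal.ofReal_pow (by positivity), mul_pow, ← rpow_natCast (_ ^ ρ),
      ← rpow_mul (by positivity), sq_abs]
    simp only [jb]
    rw [← ENNReal.ofReal_mul (by positivity), ← ENNReal.ofReal_mul (by positivity),
      ← ENNReal.ofReal_mul (by positivity)]
    congr 1
    rw [show 2 * ((-1 + ε) / 2) = -1 + ε by ring, show 2 * -((1 + ε) / 2) = -(1 + ε) by ring,
      show (ρ * (2 : ℕ) : ℝ) = 2 * ρ by push_cast; ring, ← mul_add a ξ₁]
    field_simp
  have e2 : transKernel ν μ A (1 + ε) a (ξ₁, τ₁) (ξ₂, τ₂) =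
      ENNReal.ofReal (transWeight (ν * a) μ (5 * A) A (a * ξ₁) (a * ξ₂) *
        ((1 + |s₁|) ^ (-(1 + ε)) * (1 + |s₂|) ^ (-(1 + ε)))) := by
    simp only [transKernel, ← hs₁, ← hs₂, jb]
    rw [ENNReal.ofReal_mul t1, ENNReal.ofReal_mul (by positivity)]
  have e3 : transKernel ν μ A (1 + ε) a ((ξ₁, τ₁) + (ξ₂, τ₂)) (-(ξ₂, τ₂)) =
      ENNReal.ofReal (transWeight (ν * a) μ (5 * A) A (a * ξ₁ + a * ξ₂) (-(a * ξ₂)) *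
        ((1 + |s₀|) ^ (-(1 + ε)) * (1 + |s₂|) ^ (-(1 + ε)))) := by
    simp only [transKernel, Prod.mk_add_mk, Prod.neg_mk, phase_neg, ← hs₀]
    rw [show a ^ 3 * (-τ₂ - -phase ν μ ξ₂) = -s₂ by rw [hs₂]; ring, jb_neg, mul_add a, mul_neg]
    simp only [jb]
    rw [ENNReal.ofReal_mul t2, ENNReal.ofReal_mul (by positivity)]
  have e4 : transKernel ν μ A (1 + ε) a ((ξ₁, τ₁) + (ξ₂, τ₂)) (-(ξ₁, τ₁)) =
      ENNReal.ofReal (transWeight (ν * a) μ (5 * A) A (a * ξ₁ + a * ξ₂) (-(a * ξ₁)) *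
        ((1 + |s₀|) ^ (-(1 + ε)) * (1 + |s₁|) ^ (-(1 + ε)))) := by
    simp only [transKernel, Prod.mk_add_mk, Prod.neg_mk, phase_neg, ← hs₀]
    rw [show a ^ 3 * (-τ₁ - -phase ν μ ξ₁) = -s₁ by rw [hs₁]; ring, jb_neg, mul_add a, mul_neg]
    simp only [jb]
    rw [ENNReal.ofReal_mul t3, ENNReal.ofReal_mul (by positivity)]
  rw [e1, e2, e3, e4, ← ENNReal.ofReal_add (by positivity) (by positivity),
    ← ENNReal.ofReal_add (by positivity) (by positivity), ← ENNReal.ofReal_mul (by positivity)]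
  apply ENNReal.ofReal_le_ofReal
  rw [mul_assoc ((a ^ 2)⁻¹)]
  exact mul_le_mul_of_nonneg_left key (by positivity)

lemma bilinKernel_bound {ν μ A ρ ε a : ℝ} (hμ : μ ≠ 0) (hA : 2 ≤ A) (hνA : |ν| ≤ |μ| * A)
    (hρ : 0 ≤ ρ) (hε : 0 < ε) (hε8 : ε ≤ 1 / 8) (hρε : 2 * ρ ≤ 3 / 2 - 3 * ε) (ha : 0 < a)
    (ha1 : a ≤ 1) {F G : ℝ × ℝ → ℝ≥0∞} (hF : Measurable F) (hG : Measurable G) :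
    ∫⁻ P, (∫⁻ q, bilinKernel ν μ ρ ε a q (P - q) * (F q * G (P - q))) ^ 2 ≤
      9 * ENNReal.ofReal (kernelConst μ A) * transConst μ A (1 + ε) * ENNReal.ofReal ((a ^ 6)⁻¹) *
        ((∫⁻ q, F q ^ 2) * ∫⁻ q, G q ^ 2) := by
  refine (bilinear_of_schur (measurable_bilinKernel ν μ ρ ε a)
    (measurable_transKernel ν μ A (1 + ε) a)
    (lintegral_transKernel_le (by linarith) hμ ha ha1 hνA)
    (bilinKernel_sq_le hμ hA hνA hρ hε hε8 hρε ha ha1) hF hG).trans (le_of_eq ?_)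
  rw [show (a ^ 6)⁻¹ = (a ^ 2)⁻¹ * (a ^ 4)⁻¹ by field_simp, ENNReal.ofReal_mul (by positivity),
    ENNReal.ofReal_mul (by positivity)]
  ring

namespace AdmissibleMultiplier

variable {N s : ℝ} {m : ℝ → ℝ}

lemma eq_rpow_of_le (hm : AdmissibleMultiplier N s m) (hN : 0 < N) {ξ : ℝ} (h : 2 * N ≤ |ξ|) :
    m ξ = (|ξ| / N) ^ s := by
  rw [hm.eq_pow ξ h, div_rpow (abs_nonneg _) hN.le, rpow_neg hN.le]; field_simp

lemma half_mul_le (hm : AdmissibleMultiplier N s m) (hN : 0 < N) (hs : s ∈ Set.Icc (-1 : ℝ) 0)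
    (ξ : ℝ) : 1 / 2 * (1 + |ξ| / N) ^ s ≤ m ξ := by
  have hw : 1 ≤ 1 + |ξ| / N := by have : 0 ≤ |ξ| / N := by positivity
                                  linarith
  have hw1 : (1 + |ξ| / N) ^ s ≤ 1 := rpow_le_one_of_one_le_of_nonpos hw hs.2
  rcases le_total (2 * N) |ξ| with h | h
  · have hp : 0 < |ξ| / N := div_pos (by linarith) hN
    rw [hm.eq_rpow_of_le hN h]
    have : (1 + |ξ| / N) ^ s ≤ (|ξ| / N) ^ s := rpow_le_rpow_of_nonpos hp (by linarith) hs.2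
    have : 0 ≤ (1 + |ξ| / N) ^ s := by positivity
    linarith
  · have h2 : m (2 * N) ≤ m ξ := hm.mono _ _ (by rwa [abs_of_pos (by linarith : 0 < 2 * N)])
    rw [hm.eq_rpow_of_le hN (by rw [abs_of_pos (by linarith : 0 < 2 * N)]),
      abs_of_pos (by linarith : 0 < 2 * N), mul_div_cancel_right₀ _ hN.ne'] at h2
    have : (2:ℝ) ^ (-1 : ℝ) ≤ 2 ^ s := rpow_le_rpow_of_exponent_le (by norm_num) hs.1
    rw [rpow_neg_one] at this
    linarith

lemma le_three_mul (hm : AdmissibleMultiplier N s m) (hN : 0 < N) (hs : s ∈ Set.Icc (-1 : ℝ) 0)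
    (ξ : ℝ) : m ξ ≤ 3 * (1 + |ξ| / N) ^ s := by
  have hw : 0 < 1 + |ξ| / N := by positivity
  have hcmp : ∀ c x : ℝ, 1 ≤ c → 0 < x → 1 + |ξ| / N ≤ c * x → x ^ s ≤ c * (1 + |ξ| / N) ^ s := by
    intro c x hc hx h
    have h1 : (c * x) ^ s ≤ (1 + |ξ| / N) ^ s := rpow_le_rpow_of_nonpos hw h hs.2
    rw [mul_rpow (by linarith) hx.le] at h1
    have h2 : c ^ (-1 : ℝ) ≤ c ^ s := rpow_le_rpow_of_exponent_le hc hs.1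
    rw [rpow_neg_one] at h2
    have h3 : c⁻¹ * x ^ s ≤ (1 + |ξ| / N) ^ s := by
      refine le_trans ?_ h1; gcongr
    have := mul_le_mul_of_nonneg_left h3 (by linarith : 0 ≤ c)
    rwa [mul_inv_cancel_left₀ (by linarith)] at this
  rcases le_total (2 * N) |ξ| with h | h
  · have hp : 2 ≤ |ξ| / N := by rwa [le_div_iff₀ hN]
    rw [hm.eq_rpow_of_le hN h]
    exact hcmp 3 _ (by norm_num) (by linarith) (by linarith)
  · have hp : |ξ| / N ≤ 2 := by rwa [div_le_iff₀ hN]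
    have := hcmp 3 1 (by norm_num) one_pos (by linarith)
    rw [one_rpow] at this
    exact (hm.le_one ξ).trans this

end AdmissibleMultiplier

lemma mul_div_scale_le {x y A B c : ℝ} (hx : 0 ≤ x) (hxy : x ≤ y) (hA : 0 ≤ A) (hB : 0 ≤ B)
    (hc : 0 ≤ c) (hcAB : c ≤ A + B) :
    (1 + x * A) * (1 + x * B) / (1 + x * c) ≤ (1 + y * A) * (1 + y * B) / (1 + y * c) := by
  have hy : 0 ≤ y := hx.trans hxy
  rw [div_le_div_iff₀ (by positivity) (by positivity)]
  have h : 0 ≤ (y - x) * ((A + B - c) + (x + y) * (A * B) + A * B * c * (x * y)) := by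
    have h1 : 0 ≤ y - x := by linarith
    have h2 : 0 ≤ A + B - c := by linarith
    positivity
  linarith

lemma AdmissibleMultiplier.le_mul_mul {N s a : ℝ} {m : ℝ → ℝ} (hm : AdmissibleMultiplier N s m)
    (hN : 0 < N) (hs : s ∈ Set.Icc (-1 : ℝ) 0) (ha : 1 / N ≤ a) (ξ₁ ξ₂ : ℝ) :
    m (ξ₁ + ξ₂) ≤ 12 * ((1 + |a * ξ₁|) * (1 + |a * ξ₂|) / (1 + |a * (ξ₁ + ξ₂)|)) ^ (-s) *
      (m ξ₁ * m ξ₂) := by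
  have ha0 : 0 < a := lt_of_lt_of_le (by positivity) ha
  have h0 := hm.le_three_mul hN hs (ξ₁ + ξ₂)
  have h1 := hm.half_mul_le hN hs ξ₁
  have h2 := hm.half_mul_le hN hs ξ₂
  have w1 : 0 < 1 + |ξ₁| / N := by positivity
  have w2 : 0 < 1 + |ξ₂| / N := by positivity
  have w0 : 0 < 1 + |ξ₁ + ξ₂| / N := by positivity
  have hR : (1 + |ξ₁| / N) * (1 + |ξ₂| / N) / (1 + |ξ₁ + ξ₂| / N) ≤
      (1 + |a * ξ₁|) * (1 + |a * ξ₂|) / (1 + |a * (ξ₁ + ξ₂)|) := by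
    have := mul_div_scale_le (by positivity) ha (abs_nonneg ξ₁) (abs_nonneg ξ₂)
      (abs_nonneg (ξ₁ + ξ₂)) (abs_add_le ξ₁ ξ₂)
    simpa only [abs_mul, abs_of_pos ha0, one_div_mul_eq_div] using this
  have hR' := rpow_le_rpow (by positivity) hR (by linarith [hs.2] : 0 ≤ -s)
  have e : ((1 + |ξ₁| / N) * (1 + |ξ₂| / N) / (1 + |ξ₁ + ξ₂| / N)) ^ (-s) *
      ((1 + |ξ₁| / N) ^ s * (1 + |ξ₂| / N) ^ s) = (1 + |ξ₁ + ξ₂| / N) ^ s := by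
    rw [← mul_rpow w1.le w2.le, div_rpow (by positivity) w0.le, rpow_neg (by positivity),
      rpow_neg w0.le]
    have : 0 < ((1 + |ξ₁| / N) * (1 + |ξ₂| / N)) ^ s := by positivity
    have : 0 < (1 + |ξ₁ + ξ₂| / N) ^ s := by positivity
    field_simp
  calc m (ξ₁ + ξ₂) ≤ 3 * (1 + |ξ₁ + ξ₂| / N) ^ s := h0
    _ = 12 * ((1 + |ξ₁| / N) * (1 + |ξ₂| / N) / (1 + |ξ₁ + ξ₂| / N)) ^ (-s) *
        ((1 / 2 * (1 + |ξ₁| / N) ^ s) * (1 / 2 * (1 + |ξ₂| / N) ^ s)) := by rw [← e]; ring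
    _ ≤ _ := by
        have := hm.pos ξ₁
        gcongr

lemma jb_add_le {p : ℝ} (hp : 0 ≤ p) (x y : ℝ) : jb p (x + y) ≤ jb p x * jb p y := by
  have hx := br_pos x
  have hy := br_pos y
  have hxy := br_pos (x + y)
  rw [jb, jb, jb, ← ENNReal.ofReal_mul (by positivity), ← mul_rpow hx.le hy.le]
  apply ENNReal.ofReal_le_ofReal
  apply rpow_le_rpow hxy.le _ hp
  have := abs_add_le x y
  have := mul_nonneg (abs_nonneg x) (abs_nonneg y)
  nlinarith

lemma jb_mono {p q : ℝ} (h : p ≤ q) (x : ℝ) : jb p x ≤ jb q x :=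
  ENNReal.ofReal_le_ofReal (rpow_le_rpow_of_exponent_le (one_le_br x) h)

lemma jb_mul_jb_neg (p x : ℝ) : jb p x * jb (-p) x = 1 := by
  rw [jb_mul, add_neg_cancel, jb_zero]

lemma le_mul_jb_neg {p x : ℝ} {y z : ℝ≥0∞} (h : jb p x * y ≤ z) : y ≤ z * jb (-p) x := by
  calc y = jb p x * y * jb (-p) x := by rw [mul_right_comm, jb_mul_jb_neg, one_mul]
    _ ≤ _ := by gcongr

lemma jb_scale_mul_jb_neg_le {p δ : ℝ} (hp : 0 ≤ p) (hp2 : p ≤ 2) (hδ : 0 < δ) (x : ℝ) :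
    jb p (δ * x) * jb (-p) x ≤ 4 * (ENNReal.ofReal (δ ^ p) + jb (-p) x) := by
  have hx := br_pos x
  have hδx := br_pos (δ * x)
  have h4 : (4 : ℝ≥0∞) = ENNReal.ofReal 4 := by simp
  rw [jb, jb, h4, ← ENNReal.ofReal_mul (by positivity), ← ENNReal.ofReal_add (by positivity)
    (by positivity), ← ENNReal.ofReal_mul (by norm_num)]
  apply ENNReal.ofReal_le_ofReal
  have h22 : (2:ℝ) ^ p ≤ 4 := by
    calc (2:ℝ) ^ p ≤ 2 ^ (2:ℝ) := rpow_le_rpow_of_exponent_le (by norm_num) hp2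
      _ = 4 := by norm_num
  have key : ∀ M : ℝ, 0 ≤ M → δ ≤ M → (1 + |x|)⁻¹ ≤ M →
      (1 + |δ * x|) ^ p * (1 + |x|) ^ (-p) ≤ 4 * M ^ p := by
    intro M hM h1 h2
    rw [rpow_neg hx.le, ← inv_rpow hx.le, ← mul_rpow hδx.le (by positivity)]
    calc ((1 + |δ * x|) * (1 + |x|)⁻¹) ^ p ≤ (2 * M) ^ p := by
          apply rpow_le_rpow (by positivity) _ hp
          rw [← div_eq_mul_inv, div_le_iff₀ hx, abs_mul, abs_of_pos hδ]
          have h3 : 1 ≤ M * (1 + |x|) := by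
            have := mul_le_mul_of_nonneg_right h2 hx.le
            rwa [inv_mul_cancel₀ hx.ne'] at this
          have := mul_le_mul_of_nonneg_right h1 (abs_nonneg x)
          nlinarith
      _ = 2 ^ p * M ^ p := mul_rpow (by norm_num) hM
      _ ≤ _ := by gcongr
  have h1 : 0 ≤ δ ^ p := by positivity
  have h2 : 0 ≤ (1 + |x|) ^ (-p) := by positivity
  rcases le_total δ (1 + |x|)⁻¹ with h | h
  · have := key _ (by positivity) h le_rfl
    rw [inv_rpow hx.le, ← rpow_neg hx.le] at this
    linarith
  · have := key _ hδ.le le_rfl h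
    linarith

/-- The majorant of the Fourier transform of a cutoff at time scale `δ`. -/
def cutKernel (δ x : ℝ) : ℝ≥0∞ := ENNReal.ofReal δ * jb (-4) (δ * x)

@[fun_prop]
lemma measurable_cutKernel (δ : ℝ) : Measurable (cutKernel δ) := by
  unfold cutKernel; fun_prop

lemma lintegral_scaled_jb {δ : ℝ} (hδ : 0 < δ) (q y : ℝ) :
    ∫⁻ x, ENNReal.ofReal δ * jb q (δ * (x - y)) = ∫⁻ z, jb q z := by
  rw [lintegral_const_mul _ (by fun_prop),
    lintegral_sub_right_eq_self (fun x => jb q (δ * x)) y,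
    lintegral_comp_mul hδ (jb q) (by fun_prop), ← mul_assoc, ← ENNReal.ofReal_mul hδ.le,
    mul_inv_cancel₀ hδ.ne']
  simp

lemma lintegral_scaled_jb' {δ : ℝ} (hδ : 0 < δ) (q y : ℝ) :
    ∫⁻ x, ENNReal.ofReal δ * jb q (δ * (y - x)) = ∫⁻ z, jb q z := by
  rw [← lintegral_scaled_jb hδ q y]
  congr! 3 with x
  rw [mul_sub, jb_sub_comm, mul_sub]

lemma conv_cutKernel_eq (δ τ : ℝ) (g : ℝ → ℝ≥0∞) :
    ∫⁻ x, cutKernel δ x * g (τ - x) = ∫⁻ y, cutKernel δ (τ - y) * g y := by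
  rw [← lintegral_sub_left_eq_self (fun x => cutKernel δ x * g (τ - x)) τ]
  simp only [sub_sub_cancel]

/-- Localization in time at scale `δ`, with the weight of positive order rescaled. -/
lemma lintegral_cut_high_le {p δ : ℝ} (hp : 1 ≤ p) (hp2 : p ≤ 2) (hδ : 0 < δ) (hδ1 : δ ≤ 1)
    (c : ℝ) {g : ℝ → ℝ≥0∞} (hg : Measurable g) :
    ∫⁻ τ, jb p (δ * (τ - c)) * (∫⁻ x, cutKernel δ x * g (τ - x)) ^ 2 ≤
      4 * ((∫⁻ z, jb (-2) z) + ∫⁻ z, jb (-p) z) * (∫⁻ z, jb (-4) z) * ENNReal.ofReal δ *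
        ∫⁻ y, jb p (y - c) * g y ^ 2 := by
  set J := 4 * ((∫⁻ z, jb (-2) z) + ∫⁻ z, jb (-p) z) with hJ
  have hfst : ∀ τ, jb p (δ * (τ - c)) * ∫⁻ y, cutKernel δ (τ - y) * jb (-p) (y - c) ≤
      J * ENNReal.ofReal δ := by
    intro τ
    rw [← lintegral_const_mul _ (by fun_prop)]
    calc _ ≤ ∫⁻ y, 4 * (ENNReal.ofReal δ * (ENNReal.ofReal δ * jb (-2) (δ * (τ - y))) +
          ENNReal.ofReal δ * jb (-p) (y - c)) := by
          apply lintegral_mono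
          intro y
          dsimp only
          calc jb p (δ * (τ - c)) * (cutKernel δ (τ - y) * jb (-p) (y - c))
              ≤ (jb p (δ * (τ - y)) * jb p (δ * (y - c))) *
                (cutKernel δ (τ - y) * jb (-p) (y - c)) := by
                gcongr
                rw [show δ * (τ - c) = δ * (τ - y) + δ * (y - c) by ring]
                exact jb_add_le (by linarith) _ _
            _ = ENNReal.ofReal δ * jb (p + -4) (δ * (τ - y)) *
                (jb p (δ * (y - c)) * jb (-p) (y - c)) := by
                rw [cutKernel, ← jb_mul]; ring
            _ ≤ ENNReal.ofReal δ * jb (p + -4) (δ * (τ - y)) *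
                (4 * (ENNReal.ofReal (δ ^ p) + jb (-p) (y - c))) := by
                exact mul_le_mul' le_rfl (jb_scale_mul_jb_neg_le (by linarith) hp2 hδ _)
            _ = 4 * (ENNReal.ofReal (δ ^ p) * (ENNReal.ofReal δ * jb (p + -4) (δ * (τ - y))) +
                ENNReal.ofReal δ * (jb (p + -4) (δ * (τ - y)) * jb (-p) (y - c))) := by ring
            _ ≤ 4 * (ENNReal.ofReal δ * (ENNReal.ofReal δ * jb (-2) (δ * (τ - y))) +
                ENNReal.ofReal δ * (1 * jb (-p) (y - c))) := by
                gcongr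
                · calc δ ^ p ≤ δ ^ (1:ℝ) := rpow_le_rpow_of_exponent_ge hδ hδ1 hp
                    _ = δ := rpow_one δ
                · exact jb_mono (by linarith) _
                · exact jb_le_one (by linarith) _
            _ = _ := by rw [one_mul]
      _ = _ := by
          rw [lintegral_const_mul _ (by fun_prop), lintegral_add_left (by fun_prop),
            lintegral_const_mul _ (by fun_prop), lintegral_scaled_jb' hδ,
            lintegral_const_mul _ (by fun_prop), lintegral_jb_sub', hJ]
          ring
  have hpt : ∀ τ, jb p (δ * (τ - c)) * (∫⁻ x, cutKernel δ x * g (τ - x)) ^ 2 ≤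
      J * ENNReal.ofReal δ * ∫⁻ y, cutKernel δ (τ - y) * (jb p (y - c) * g y ^ 2) := by
    intro τ
    rw [conv_cutKernel_eq]
    have h := lintegral_mul_sq_le (m := volume)
      (f := fun y => (cutKernel δ (τ - y) * jb (-p) (y - c)) ^ (1 / 2 : ℝ))
      (g := fun y => (cutKernel δ (τ - y) * (jb p (y - c) * g y ^ 2)) ^ (1 / 2 : ℝ))
      (by fun_prop) (by fun_prop)
    simp only [rpow_half_sq] at h
    have e : ∀ y, (cutKernel δ (τ - y) * jb (-p) (y - c)) ^ (1 / 2 : ℝ) *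
        (cutKernel δ (τ - y) * (jb p (y - c) * g y ^ 2)) ^ (1 / 2 : ℝ) =
        cutKernel δ (τ - y) * g y := by
      intro y
      rw [← ENNReal.mul_rpow_of_nonneg _ _ (by norm_num),
        show cutKernel δ (τ - y) * jb (-p) (y - c) * (cutKernel δ (τ - y) * (jb p (y - c) * g y ^ 2))
          = (jb p (y - c) * jb (-p) (y - c)) * (cutKernel δ (τ - y) * g y) ^ 2 by ring,
        jb_mul_jb_neg, one_mul, ← ENNReal.rpow_natCast, ← ENNReal.rpow_mul]
      simp
    simp_rw [e] at h
    calc _ ≤ jb p (δ * (τ - c)) * ((∫⁻ y, cutKernel δ (τ - y) * jb (-p) (y - c)) *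
          ∫⁻ y, cutKernel δ (τ - y) * (jb p (y - c) * g y ^ 2)) := by gcongr
      _ ≤ _ := by
          rw [← mul_assoc]
          exact mul_le_mul' (hfst τ) le_rfl
  calc _ ≤ ∫⁻ τ, J * ENNReal.ofReal δ * ∫⁻ y, cutKernel δ (τ - y) * (jb p (y - c) * g y ^ 2) :=
        lintegral_mono hpt
    _ = J * ENNReal.ofReal δ * ∫⁻ τ, ∫⁻ y, (jb p (y - c) * g y ^ 2) * cutKernel δ (τ - y) := by
        simp_rw [mul_comm (cutKernel δ _)]
        rw [lintegral_const_mul]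
        exact Measurable.lintegral_prod_right' (f := fun z : ℝ × ℝ =>
          (jb p (z.2 - c) * g z.2 ^ 2) * cutKernel δ (z.1 - z.2)) (by fun_prop)
    _ = J * ENNReal.ofReal δ * ((∫⁻ y, jb p (y - c) * g y ^ 2) * ∫⁻ x, cutKernel δ x) := by
        rw [lintegral_conv_eq (G := fun y => jb p (y - c) * g y ^ 2) (by fun_prop) (by fun_prop)]
    _ = _ := by
        have := lintegral_scaled_jb hδ (-4) 0
        simp only [sub_zero] at this
        simp only [cutKernel, this]
        ring

/-- The integral of `|z|^{-q}` near the origin. -/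
def powConst (q : ℝ) : ℝ≥0∞ := ∫⁻ z in Set.Icc (-1 : ℝ) 1, ENNReal.ofReal (|z| ^ (-q))

lemma powConst_lt_top {q : ℝ} (hq : q < 1) : powConst q < ∞ := by
  have h0 : IntegrableOn (fun z : ℝ => |z| ^ (-q)) (Set.Icc 0 1) := by
    rw [integrableOn_Icc_iff_integrableOn_Ioc]
    have h := (intervalIntegral.intervalIntegrable_rpow' (a := 0) (b := 1)
      (by linarith : -1 < -q)).1
    refine h.congr_fun (fun z hz => ?_) measurableSet_Ioc
    simp only [abs_of_pos hz.1]
  have h1 : IntegrableOn (fun z : ℝ => |z| ^ (-q)) (Set.Icc (-1) 0) := by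
    have h := h0.comp_neg
    simpa using h
  have h2 : IntegrableOn (fun z : ℝ => |z| ^ (-q)) (Set.Icc (-1) 1) := by
    rw [← Set.Icc_union_Icc_eq_Icc (by norm_num : (-1:ℝ) ≤ 0) (by norm_num : (0:ℝ) ≤ 1)]
    exact h1.union h0
  have h3 := h2.hasFiniteIntegral
  rw [hasFiniteIntegral_iff_ofReal (ae_of_all _ fun z => by positivity)] at h3
  exact h3

lemma lintegral_cutKernel_mul_jb_le {q δ : ℝ} (hq : 0 ≤ q) (hδ : 0 < δ) (y c : ℝ) :
    ∫⁻ τ, ENNReal.ofReal δ * jb (-2) (δ * (τ - y)) * jb (-q) (τ - c) ≤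
      ENNReal.ofReal (δ ^ q) * ((∫⁻ z, jb (-2) z) + powConst q) := by
  have hae : ∀ᵐ τ : ℝ, τ ≠ c := by simp [ae_iff, measure_singleton]
  have hpt : ∀ᵐ τ, ENNReal.ofReal δ * jb (-2) (δ * (τ - y)) * jb (-q) (τ - c) ≤
      ENNReal.ofReal (δ ^ q) * (ENNReal.ofReal δ * jb (-2) (δ * (τ - y)) + ENNReal.ofReal δ *
        (Set.Icc (-1 : ℝ) 1).indicator (fun z => ENNReal.ofReal (|z| ^ (-q))) (δ * (τ - c))) := by
    filter_upwards [hae] with τ hne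
    have hx : 0 < |τ - c| := abs_pos.2 (sub_ne_zero.2 hne)
    have habs : |δ * (τ - c)| = δ * |τ - c| := by rw [abs_mul, abs_of_pos hδ]
    have hdec : jb (-q) (τ - c) ≤
        ENNReal.ofReal (δ ^ q) * ENNReal.ofReal (|δ * (τ - c)| ^ (-q)) := by
      rw [jb, ← ENNReal.ofReal_mul (by positivity)]
      apply ENNReal.ofReal_le_ofReal
      rw [habs, mul_rpow hδ.le hx.le, ← mul_assoc, ← rpow_add hδ, add_neg_cancel, rpow_zero,
        one_mul]
      exact rpow_le_rpow_of_nonpos hx (by linarith) (by linarith)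
    by_cases hz : δ * (τ - c) ∈ Set.Icc (-1 : ℝ) 1
    · rw [Set.indicator_of_mem hz]
      calc _ ≤ ENNReal.ofReal δ * 1 *
            (ENNReal.ofReal (δ ^ q) * ENNReal.ofReal (|δ * (τ - c)| ^ (-q))) := by
            gcongr; exact jb_le_one (by norm_num) _
        _ = ENNReal.ofReal (δ ^ q) * (ENNReal.ofReal δ * ENNReal.ofReal (|δ * (τ - c)| ^ (-q))) := by
            ring
        _ ≤ _ := by gcongr; exact le_add_self
    · rw [Set.indicator_of_notMem hz]
      rw [Set.mem_Icc, ← abs_le, not_le] at hz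
      have h1 : ENNReal.ofReal (|δ * (τ - c)| ^ (-q)) ≤ 1 := by
        rw [ENNReal.ofReal_le_one]
        exact rpow_le_one_of_one_le_of_nonpos hz.le (by linarith)
      calc _ ≤ ENNReal.ofReal δ * jb (-2) (δ * (τ - y)) * (ENNReal.ofReal (δ ^ q) * 1) := by
            gcongr; exact hdec.trans (by gcongr)
        _ = _ := by ring
  have hm : Measurable ((Set.Icc (-1 : ℝ) 1).indicator
      (fun z => ENNReal.ofReal (|z| ^ (-q)))) :=
    Measurable.indicator (by fun_prop) measurableSet_Icc
  refine (lintegral_mono_ae hpt).trans (le_of_eq ?_)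
  rw [lintegral_const_mul _ (by fun_prop), lintegral_add_left (by fun_prop),
    lintegral_scaled_jb hδ, lintegral_const_mul _ (by fun_prop),
    lintegral_sub_right_eq_self (fun x => (Set.Icc (-1 : ℝ) 1).indicator
      (fun z => ENNReal.ofReal (|z| ^ (-q))) (δ * x)) c, lintegral_comp_mul hδ _ hm, ← mul_assoc,
    ← ENNReal.ofReal_mul hδ.le, mul_inv_cancel₀ hδ.ne', lintegral_indicator measurableSet_Icc]
  simp [powConst]

lemma scale_rpow_mul_jb_le {q δ δ' : ℝ} (hq : 0 ≤ q) (hδ : 0 < δ) (hδδ' : δ ≤ δ') (x : ℝ) :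
    ENNReal.ofReal (δ ^ q) * jb (-q) (δ * x) ≤ ENNReal.ofReal (δ' ^ q) * jb (-q) (δ' * x) := by
  have hδ' : 0 < δ' := hδ.trans_le hδδ'
  have h1 := br_pos (δ * x)
  have h2 := br_pos (δ' * x)
  rw [jb, jb, ← ENNReal.ofReal_mul (by positivity), ← ENNReal.ofReal_mul (by positivity)]
  apply ENNReal.ofReal_le_ofReal
  rw [rpow_neg h1.le, rpow_neg h2.le, ← div_eq_mul_inv, ← div_eq_mul_inv, ← div_rpow hδ.le h1.le,
    ← div_rpow hδ'.le h2.le]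
  apply rpow_le_rpow (by positivity) _ hq
  rw [div_le_div_iff₀ h1 h2, abs_mul, abs_mul, abs_of_pos hδ, abs_of_pos hδ']
  nlinarith [abs_nonneg x]

/-- Localization in time at scale `δ`, with the weight of negative order rescaled. -/
lemma lintegral_cut_low_le {q δ δ' : ℝ} (hq : 0 ≤ q) (hq1 : q ≤ 1) (hδ : 0 < δ)
    (hδδ' : δ ≤ δ') (c : ℝ) {g : ℝ → ℝ≥0∞} (hg : Measurable g) :
    ∫⁻ τ, jb (-q) (τ - c) * (∫⁻ x, cutKernel δ x * g (τ - x)) ^ 2 ≤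
      (∫⁻ z, jb (-4) z) * (8 * ((∫⁻ z, jb (-2) z) + powConst q)) * ENNReal.ofReal (δ' ^ q) *
        ∫⁻ y, jb (-q) (δ' * (y - c)) * g y ^ 2 := by
  have hJ : ∫⁻ x, cutKernel δ x = ∫⁻ z, jb (-4) z := by
    simpa [cutKernel] using lintegral_scaled_jb hδ (-4) 0
  have hJτ : ∀ τ, ∫⁻ y, cutKernel δ (τ - y) = ∫⁻ z, jb (-4) z := fun τ => by
    rw [lintegral_sub_left_eq_self (fun y => cutKernel δ y) τ, hJ]
  have hpt : ∀ τ, (∫⁻ x, cutKernel δ x * g (τ - x)) ^ 2 ≤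
      (∫⁻ z, jb (-4) z) * ∫⁻ y, cutKernel δ (τ - y) * g y ^ 2 := by
    intro τ
    rw [conv_cutKernel_eq]
    have h := lintegral_mul_sq_le (m := volume)
      (f := fun y => cutKernel δ (τ - y) ^ (1 / 2 : ℝ))
      (g := fun y => (cutKernel δ (τ - y) * g y ^ 2) ^ (1 / 2 : ℝ))
      (by fun_prop) (by fun_prop)
    simp only [rpow_half_sq] at h
    have e : ∀ y, cutKernel δ (τ - y) ^ (1 / 2 : ℝ) *
        (cutKernel δ (τ - y) * g y ^ 2) ^ (1 / 2 : ℝ) = cutKernel δ (τ - y) * g y := by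
      intro y
      rw [← ENNReal.mul_rpow_of_nonneg _ _ (by norm_num),
        show cutKernel δ (τ - y) * (cutKernel δ (τ - y) * g y ^ 2) =
          (cutKernel δ (τ - y) * g y) ^ 2 by ring, ← ENNReal.rpow_natCast, ← ENNReal.rpow_mul]
      simp
    simp_rw [e] at h
    rwa [hJτ] at h
  have hker : ∀ y, ∫⁻ τ, jb (-q) (τ - c) * cutKernel δ (τ - y) ≤
      8 * ((∫⁻ z, jb (-2) z) + powConst q) * (ENNReal.ofReal (δ' ^ q) * jb (-q) (δ' * (y - c))) := by
    intro y
    have h : jb q (δ * (y - c)) * ∫⁻ τ, jb (-q) (τ - c) * cutKernel δ (τ - y) ≤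
        ENNReal.ofReal (δ ^ q) * (8 * ((∫⁻ z, jb (-2) z) + powConst q)) := by
      rw [← lintegral_const_mul _ (by fun_prop)]
      calc _ ≤ ∫⁻ τ, 4 * (ENNReal.ofReal (δ ^ q) * (ENNReal.ofReal δ * jb (-2) (δ * (τ - y))) +
            ENNReal.ofReal δ * jb (-2) (δ * (τ - y)) * jb (-q) (τ - c)) := by
            apply lintegral_mono
            intro τ
            dsimp only
            calc jb q (δ * (y - c)) * (jb (-q) (τ - c) * cutKernel δ (τ - y))
                ≤ (jb q (δ * (y - τ)) * jb q (δ * (τ - c))) *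
                  (jb (-q) (τ - c) * cutKernel δ (τ - y)) := by
                  gcongr
                  rw [show δ * (y - c) = δ * (y - τ) + δ * (τ - c) by ring]
                  exact jb_add_le hq _ _
              _ = (ENNReal.ofReal δ * jb (q + -4) (δ * (τ - y))) *
                  (jb q (δ * (τ - c)) * jb (-q) (τ - c)) := by
                  rw [cutKernel, ← jb_mul, show δ * (y - τ) = -(δ * (τ - y)) by ring, jb_neg]
                  ring
              _ ≤ (ENNReal.ofReal δ * jb (-2) (δ * (τ - y))) *
                  (4 * (ENNReal.ofReal (δ ^ q) + jb (-q) (τ - c))) := by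
                  refine mul_le_mul' (mul_le_mul' le_rfl (jb_mono (by linarith) _))
                    (jb_scale_mul_jb_neg_le hq (by linarith) hδ _)
              _ = _ := by ring
        _ ≤ 4 * (ENNReal.ofReal (δ ^ q) * (∫⁻ z, jb (-2) z) +
            ENNReal.ofReal (δ ^ q) * ((∫⁻ z, jb (-2) z) + powConst q)) := by
            rw [lintegral_const_mul _ (by fun_prop), lintegral_add_left (by fun_prop),
              lintegral_const_mul _ (by fun_prop), lintegral_scaled_jb hδ]
            gcongr
            exact lintegral_cutKernel_mul_jb_le hq hδ y c
        _ ≤ 4 * (ENNReal.ofReal (δ ^ q) * ((∫⁻ z, jb (-2) z) + powConst q) +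
            ENNReal.ofReal (δ ^ q) * ((∫⁻ z, jb (-2) z) + powConst q)) := by
            gcongr; exact le_self_add
        _ = _ := by ring
    calc _ ≤ ENNReal.ofReal (δ ^ q) * (8 * ((∫⁻ z, jb (-2) z) + powConst q)) *
          jb (-q) (δ * (y - c)) := le_mul_jb_neg h
      _ = 8 * ((∫⁻ z, jb (-2) z) + powConst q) *
          (ENNReal.ofReal (δ ^ q) * jb (-q) (δ * (y - c))) := by ring
      _ ≤ _ := by
          exact mul_le_mul' le_rfl (scale_rpow_mul_jb_le hq hδ hδδ' _)
  have hm : Measurable fun z : ℝ × ℝ =>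
      jb (-q) (z.1 - c) * (cutKernel δ (z.1 - z.2) * g z.2 ^ 2) := by fun_prop
  calc _ ≤ ∫⁻ τ, (∫⁻ z, jb (-4) z) *
        ∫⁻ y, jb (-q) (τ - c) * (cutKernel δ (τ - y) * g y ^ 2) := by
        apply lintegral_mono
        intro τ
        dsimp only
        rw [lintegral_const_mul _ (by fun_prop), mul_left_comm]
        exact mul_le_mul' le_rfl (hpt τ)
    _ = (∫⁻ z, jb (-4) z) * ∫⁻ y, (∫⁻ τ, jb (-q) (τ - c) * cutKernel δ (τ - y)) * g y ^ 2 := by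
        rw [lintegral_const_mul _ hm.lintegral_prod_right', lintegral_lintegral_swap hm.aemeasurable]
        congr! 3 with y
        rw [← lintegral_mul_const _ (by fun_prop)]
        simp_rw [mul_assoc]
    _ ≤ (∫⁻ z, jb (-4) z) * ∫⁻ y, (8 * ((∫⁻ z, jb (-2) z) + powConst q) *
          (ENNReal.ofReal (δ' ^ q) * jb (-q) (δ' * (y - c)))) * g y ^ 2 := by
        exact mul_le_mul' le_rfl (lintegral_mono fun y => mul_le_mul' (hker y) le_rfl)
    _ = (∫⁻ z, jb (-4) z) * ((8 * ((∫⁻ z, jb (-2) z) + powConst q) * ENNReal.ofReal (δ' ^ q)) *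
          ∫⁻ y, jb (-q) (δ' * (y - c)) * g y ^ 2) := by
        congr 1
        rw [← lintegral_const_mul _ (by fun_prop)]
        congr! 2 with y
        ring
    _ = _ := by
        generalize ∫⁻ y, jb (-q) (δ' * (y - c)) * g y ^ 2 = Z
        ring

lemma AdmissibleMultiplier.hasTemperateGrowth {N s : ℝ} {m : ℝ → ℝ}
    (hm : AdmissibleMultiplier N s m) (hN : 0 < N) (hs : s ≤ 0) : m.HasTemperateGrowth := by
  refine ⟨hm.smooth, fun n => ?_⟩
  have hcont : Continuous (iteratedDeriv n m) := hm.smooth.continuous_iteratedDeriv n (by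
    exact_mod_cast le_top)
  obtain ⟨C, hC⟩ := (isCompact_Icc (a := -(2 * N)) (b := 2 * N)).exists_bound_of_continuousOn
    hcont.continuousOn
  set D : ℝ := N ^ (-s) * (‖(descPochhammer ℝ n).eval s‖ * (2 * N) ^ (s - n))
  have hright : ∀ x, 2 * N < x → ‖iteratedDeriv n m x‖ ≤ D := fun x hx => by
    have hev : m =ᶠ[nhds x] fun y => N ^ (-s) * y ^ s := by
      filter_upwards [lt_mem_nhds hx] with y hy
      have hy0 : 0 < y := by linarith
      rw [hm.eq_pow y (by rw [abs_of_pos hy0]; exact hy.le), abs_of_pos hy0]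
    have hx0 : 0 < x := by linarith
    rw [hev.iteratedDeriv_eq n, iteratedDeriv_const_mul_field, iteratedDeriv_eq_iterate,
      Real.iter_deriv_rpow_const, norm_mul, norm_mul,
      Real.norm_of_nonneg (by positivity : 0 ≤ N ^ (-s)),
      Real.norm_of_nonneg (by positivity : 0 ≤ x ^ (s - n))]
    have : x ^ (s - n) ≤ (2 * N) ^ (s - n) :=
      Real.rpow_le_rpow_of_nonpos (by positivity) hx.le (by
        have : (0 : ℝ) ≤ n := n.cast_nonneg
        linarith)
    simp only [D]
    gcongr
  refine ⟨0, max C D, fun x => ?_⟩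
  rw [norm_iteratedFDeriv_eq_norm_iteratedDeriv, pow_zero, mul_one]
  rcases lt_or_ge (2 * N) x with h | h
  · exact (hright x h).trans (le_max_right _ _)
  rcases lt_or_ge x (-(2 * N)) with h' | h'
  · have heq : m = fun y => m (-y) := funext fun y => (hm.even y).symm
    have h1 : ‖iteratedDeriv n m x‖ = ‖iteratedDeriv n m (-x)‖ := by
      conv_lhs => rw [heq]
      rw [iteratedDeriv_comp_neg, norm_smul]
      simp
    rw [h1]
    exact (hright (-x) (by linarith)).trans (le_max_right _ _)
  · exact (hC x ⟨h', h⟩).trans (le_max_left _ _)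

/-- The Euclidean plane scaled by `2π`, so that Mathlib's Fourier transform becomes the one with
kernel `exp (-i z · P)`. -/
def scaledPlane : WithLp 2 (ℝ × ℝ) ≃L[ℝ] ℝ × ℝ :=
  (WithLp.prodContinuousLinearEquiv 2 ℝ ℝ ℝ).trans
    (ContinuousLinearEquiv.smulLeft (Units.mk0 (2 * π) (by positivity)))

lemma scaledPlane_apply (x : WithLp 2 (ℝ × ℝ)) : scaledPlane x = (2 * π) • x.ofLp := rfl

lemma scaledPlane_symm_apply (P : ℝ × ℝ) :
    scaledPlane.symm P = WithLp.toLp 2 ((2 * π)⁻¹ • P) := by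
  rw [ContinuousLinearEquiv.symm_apply_eq, scaledPlane_apply, smul_smul,
    mul_inv_cancel₀ (by positivity), one_smul]

open FourierTransform in
/-- The space-time Fourier transform as an operator on Schwartz functions. -/
def schwartzFT (u : SchwartzMap (ℝ × ℝ) ℂ) : SchwartzMap (ℝ × ℝ) ℂ :=
  SchwartzMap.compCLMOfContinuousLinearEquiv ℂ scaledPlane.symm
    (𝓕 (SchwartzMap.compCLMOfContinuousLinearEquiv ℂ
      (WithLp.prodContinuousLinearEquiv 2 ℝ ℝ ℝ) u))

open FourierTransform in
/-- The inverse of `schwartzFT`. -/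
def schwartzFTInv (W : SchwartzMap (ℝ × ℝ) ℂ) : SchwartzMap (ℝ × ℝ) ℂ :=
  SchwartzMap.compCLMOfContinuousLinearEquiv ℂ (WithLp.prodContinuousLinearEquiv 2 ℝ ℝ ℝ).symm
    (𝓕⁻ (SchwartzMap.compCLMOfContinuousLinearEquiv ℂ scaledPlane W))

lemma compCLMOfContinuousLinearEquiv_symm_comp {D E : Type*} [NormedAddCommGroup D]
    [NormedSpace ℝ D] [NormedAddCommGroup E] [NormedSpace ℝ E] (g : D ≃L[ℝ] E)
    (f : SchwartzMap D ℂ) :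
    SchwartzMap.compCLMOfContinuousLinearEquiv ℂ g
      (SchwartzMap.compCLMOfContinuousLinearEquiv ℂ g.symm f) = f := by
  ext x
  simp

lemma compCLMOfContinuousLinearEquiv_comp_symm {D E : Type*} [NormedAddCommGroup D]
    [NormedSpace ℝ D] [NormedAddCommGroup E] [NormedSpace ℝ E] (g : D ≃L[ℝ] E)
    (f : SchwartzMap E ℂ) :
    SchwartzMap.compCLMOfContinuousLinearEquiv ℂ g.symm
      (SchwartzMap.compCLMOfContinuousLinearEquiv ℂ g f) = f := by
  ext x
  simp

lemma schwartzFTInv_schwartzFT (u : SchwartzMap (ℝ × ℝ) ℂ) :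
    schwartzFTInv (schwartzFT u) = u := by
  rw [schwartzFTInv, schwartzFT, compCLMOfContinuousLinearEquiv_symm_comp,
    FourierTransform.fourierInv_fourier_eq, compCLMOfContinuousLinearEquiv_comp_symm]

lemma schwartzFT_schwartzFTInv (W : SchwartzMap (ℝ × ℝ) ℂ) :
    schwartzFT (schwartzFTInv W) = W := by
  rw [schwartzFTInv, schwartzFT, compCLMOfContinuousLinearEquiv_symm_comp,
    FourierTransform.fourier_fourierInv_eq, compCLMOfContinuousLinearEquiv_comp_symm]

lemma schwartzFT_apply (u : SchwartzMap (ℝ × ℝ) ℂ) (P : ℝ × ℝ) :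
    schwartzFT u P = ∫ z : ℝ × ℝ, Complex.exp (-(Complex.I * (P.1 * z.1 + P.2 * z.2))) * u z := by
  rw [schwartzFT, SchwartzMap.compCLMOfContinuousLinearEquiv_apply, Function.comp_apply,
    SchwartzMap.fourier_coe, Real.fourier_eq', scaledPlane_symm_apply,
    ← (WithLp.volume_preserving_toLp ℝ ℝ).integral_comp
      (MeasurableEquiv.toLp 2 (ℝ × ℝ)).measurableEmbedding]
  refine integral_congr_ae (.of_forall fun z => ?_)
  have h : (-2 * π * inner ℝ (WithLp.toLp 2 z) (WithLp.toLp 2 ((2 * π)⁻¹ • P)) : ℝ) =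
      -(P.1 * z.1 + P.2 * z.2) := by
    rw [WithLp.prod_inner_apply]
    simp
    field_simp
    ring
  simp only [h, SchwartzMap.compCLMOfContinuousLinearEquiv_apply, Function.comp_apply, smul_eq_mul]
  congr 2
  push_cast
  ring

lemma schwartzFTInv_apply (W : SchwartzMap (ℝ × ℝ) ℂ) (z : ℝ × ℝ) :
    schwartzFTInv W z = ((2 * π) ^ 2)⁻¹ •
      ∫ P : ℝ × ℝ, Complex.exp (Complex.I * (P.1 * z.1 + P.2 * z.2)) * W P := by
  have hs := Measure.integral_comp_smul_of_nonneg (volume : Measure (ℝ × ℝ))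
    (fun P : ℝ × ℝ => Complex.exp (Complex.I * (P.1 * z.1 + P.2 * z.2)) * W P) (2 * π)
    (hR := by positivity)
  rw [Module.finrank_prod, Module.finrank_self] at hs
  rw [← hs, schwartzFTInv, SchwartzMap.compCLMOfContinuousLinearEquiv_apply, Function.comp_apply,
    SchwartzMap.fourierInv_coe, Real.fourierInv_eq',
    ← (WithLp.volume_preserving_toLp ℝ ℝ).integral_comp
      (MeasurableEquiv.toLp 2 (ℝ × ℝ)).measurableEmbedding]
  refine integral_congr_ae (.of_forall fun P => ?_)
  simp only [WithLp.prodContinuousLinearEquiv_symm_apply, WithLp.prod_inner_apply,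
    SchwartzMap.compCLMOfContinuousLinearEquiv_apply, Function.comp_apply, scaledPlane_apply,
    smul_eq_mul, Prod.smul_fst, Prod.smul_snd]
  congr 2
  simp
  ring

lemma schwartz_inversion (u : SchwartzMap (ℝ × ℝ) ℂ) (z : ℝ × ℝ) :
    u z = ((2 * π) ^ 2)⁻¹ •
      ∫ P : ℝ × ℝ, Complex.exp (Complex.I * (P.1 * z.1 + P.2 * z.2)) * schwartzFT u P := by
  rw [← schwartzFTInv_apply, schwartzFTInv_schwartzFT]

lemma norm_exp_I_mul_real (r : ℝ) : ‖Complex.exp (Complex.I * r)‖ = 1 := by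
  rw [mul_comm, Complex.norm_exp_ofReal_mul_I]

lemma integrable_exp_mul {X : Type*} [MeasurableSpace X] {μ : Measure X} {f : X → ℂ}
    (hf : Integrable f μ) {g : X → ℝ} (hg : Measurable g) :
    Integrable (fun x => Complex.exp (Complex.I * g x) * f x) μ := by
  refine hf.bdd_mul (c := 1) (by fun_prop) (.of_forall fun x => ?_)
  rw [norm_exp_I_mul_real]

lemma FT2_eq_schwartzFT (u : SchwartzMap (ℝ × ℝ) ℂ) (ξ τ : ℝ) :
    FT2 (fun x t => u (x, t)) ξ τ = schwartzFT u (ξ, τ) := by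
  rw [schwartzFT_apply, FT2]
  have h := integrable_exp_mul u.integrable (g := fun z : ℝ × ℝ => -(ξ * z.1 + τ * z.2))
    (by fun_prop) (μ := volume)
  have he : (fun z : ℝ × ℝ => Complex.exp (-(Complex.I * (ξ * z.1 + τ * z.2))) * u z) =
      fun z : ℝ × ℝ => Complex.exp (Complex.I * ((-(ξ * z.1 + τ * z.2) : ℝ) : ℂ)) * u z := by
    ext z
    push_cast
    congr 2
    ring
  rw [← he] at h
  exact (integral_prod _ h).symm

/-- The restriction of a Schwartz function on the plane to a horizontal line. -/
def sliceLeft (u : SchwartzMap (ℝ × ℝ) ℂ) (t : ℝ) : SchwartzMap ℝ ℂ :=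
  SchwartzMap.compCLMOfAntilipschitz ℂ (K := 1) (g := fun x : ℝ => (x, t))
    (by
      have h : (fun x : ℝ => (x, t)) = fun x => ContinuousLinearMap.inl ℝ ℝ ℝ x + (0, t) := by
        ext x <;> simp
      rw [h]
      fun_prop)
    (AntilipschitzWith.of_le_mul_dist fun x y => by simp [Prod.dist_eq]) u

/-- The restriction of a Schwartz function on the plane to a vertical line. -/
def sliceRight (u : SchwartzMap (ℝ × ℝ) ℂ) (x : ℝ) : SchwartzMap ℝ ℂ :=
  SchwartzMap.compCLMOfAntilipschitz ℂ (K := 1) (g := fun t : ℝ => (x, t))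
    (by
      have h : (fun t : ℝ => (x, t)) = fun t => ContinuousLinearMap.inr ℝ ℝ ℝ t + (x, 0) := by
        ext t <;> simp
      rw [h]
      fun_prop)
    (AntilipschitzWith.of_le_mul_dist fun x y => by simp [Prod.dist_eq]) u

lemma sliceLeft_apply (u : SchwartzMap (ℝ × ℝ) ℂ) (t x : ℝ) : sliceLeft u t x = u (x, t) := rfl

open FourierTransform in
lemma FT_eq_fourier (f : ℝ → ℂ) (w : ℝ) : FT f (2 * π * w) = 𝓕 f w := by
  rw [FT, Real.fourier_real_eq_integral_exp_smul]
  refine integral_congr_ae (.of_forall fun x => ?_)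
  simp only [smul_eq_mul]
  congr 2
  push_cast
  ring

lemma FT_inversion {f : ℝ → ℂ} (hc : Continuous f) (hf : Integrable f) (hF : Integrable (FT f))
    (x : ℝ) : f x = (2 * π)⁻¹ • ∫ ξ : ℝ, Complex.exp (Complex.I * ξ * x) * FT f ξ := by
  have h0 : (2 * π : ℝ) ≠ 0 := by positivity
  have h1 : Integrable (FourierTransform.fourier f) := by
    have h := hF.comp_mul_left' h0
    refine h.congr (.of_forall fun w => ?_)
    exact FT_eq_fourier f w
  have h2 := congrFun (hc.fourierInv_fourier_eq hf h1) x
  have h3 := Measure.integral_comp_mul_left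
    (fun ξ : ℝ => Complex.exp (Complex.I * ξ * x) * FT f ξ) (2 * π)
  rw [abs_of_pos (by positivity)] at h3
  rw [← h3, ← h2, Real.fourierInv_eq']
  refine integral_congr_ae (.of_forall fun w => ?_)
  simp only [FT_eq_fourier, smul_eq_mul]
  congr 2
  simp
  ring

open FourierTransform in
lemma SchwartzMap.norm_FT_le (f : SchwartzMap ℝ ℂ) (k : ℕ) :
    ∃ C : ℝ, 0 ≤ C ∧ ∀ ξ, (1 + |ξ|) ^ k * ‖FT f ξ‖ ≤ C := by
  set g : SchwartzMap ℝ ℂ := SchwartzMap.compCLMOfContinuousLinearEquiv ℂ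
    (ContinuousLinearEquiv.smulLeft (Units.mk0 (2 * π)⁻¹ (by positivity)) : ℝ ≃L[ℝ] ℝ) (𝓕 f)
  have hg : ∀ ξ, g ξ = FT f ξ := fun ξ => by
    have h : g ξ = 𝓕 (f : ℝ → ℂ) ((2 * π)⁻¹ * ξ) := rfl
    rw [h, ← FT_eq_fourier, mul_inv_cancel_left₀ (by positivity)]
  have h := fun ξ => SchwartzMap.one_add_le_sup_seminorm_apply (𝕜 := ℝ) (m := (k, 0))
    (le_refl k) (le_refl 0) g ξ
  simp only [norm_iteratedFDeriv_zero, hg, Real.norm_eq_abs] at h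
  exact ⟨_, by positivity, h⟩

lemma FT_continuous {f : ℝ → ℂ} (hf : Integrable f) : Continuous (FT f) := by
  refine continuous_of_dominated (bound := fun x => ‖f x‖) (fun ξ => ?_) (fun ξ => ?_) hf.norm ?_
  · refine AEStronglyMeasurable.mul ?_ hf.aestronglyMeasurable
    exact (by fun_prop : Measurable fun x : ℝ =>
      Complex.exp (-(Complex.I * ξ * x))).aestronglyMeasurable
  · refine .of_forall fun x => ?_
    have h : -(Complex.I * ξ * x) = Complex.I * ((-(ξ * x) : ℝ) : ℂ) := by push_cast; ring
    rw [norm_mul, h, norm_exp_I_mul_real, one_mul]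
  · exact .of_forall fun x => by fun_prop

lemma SchwartzMap.integrable_FT (f : SchwartzMap ℝ ℂ) : Integrable (FT f) := by
  obtain ⟨C, -, hC⟩ := f.norm_FT_le 2
  refine (integrable_inv_one_add_sq.const_mul C).mono'
    (FT_continuous f.integrable).aestronglyMeasurable (.of_forall fun ξ => ?_)
  rw [← div_eq_mul_inv, le_div_iff₀ (by positivity)]
  refine le_trans ?_ (hC ξ)
  rw [mul_comm]
  gcongr
  nlinarith [abs_nonneg ξ, sq_abs ξ]

lemma SchwartzMap.FT_inversion (f : SchwartzMap ℝ ℂ) (x : ℝ) :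
    f x = (2 * π)⁻¹ • ∫ ξ : ℝ, Complex.exp (Complex.I * ξ * x) * FT f ξ :=
  _root_.FT_inversion f.continuous f.integrable f.integrable_FT x

lemma SchwartzMap.norm_le_inv_one_add_sq (u : SchwartzMap (ℝ × ℝ) ℂ) :
    ∃ C : ℝ, ∀ x t, ‖u (x, t)‖ ≤ C * (1 + x ^ 2)⁻¹ := by
  obtain ⟨C, h⟩ : ∃ C, ∀ z, (1 + ‖z‖) ^ 2 * ‖u z‖ ≤ C := by
    have h := fun z => SchwartzMap.one_add_le_sup_seminorm_apply (𝕜 := ℝ) (m := (2, 0))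
      (le_refl 2) (le_refl 0) u z
    simp only [norm_iteratedFDeriv_zero] at h
    exact ⟨_, h⟩
  refine ⟨C, fun x t => ?_⟩
  rw [← div_eq_mul_inv, le_div_iff₀ (by positivity)]
  refine le_trans ?_ (h (x, t))
  rw [mul_comm]
  gcongr
  have h1 : |x| ≤ ‖(x, t)‖ := norm_fst_le (x, t)
  nlinarith [abs_nonneg x, sq_abs x, norm_nonneg (x, t)]

lemma integrable_exp_mul_schwartz (u : SchwartzMap (ℝ × ℝ) ℂ) (ξ τ : ℝ) :
    Integrable fun z : ℝ × ℝ => Complex.exp (-(Complex.I * (ξ * z.1 + τ * z.2))) * u z := by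
  refine (integrable_exp_mul u.integrable (g := fun z : ℝ × ℝ => -(ξ * z.1 + τ * z.2))
    (by fun_prop) (μ := volume)).congr (.of_forall fun z => ?_)
  simp only
  push_cast
  congr 2
  ring

lemma FT_slice_eq (u : SchwartzMap (ℝ × ℝ) ℂ) (η t : ℝ) :
    FT (fun y => u (y, t)) η =
      (2 * π)⁻¹ • ∫ τ : ℝ, Complex.exp (Complex.I * τ * t) * schwartzFT u (η, τ) := by
  set f : ℝ → ℂ := fun t => FT (fun y => u (y, t)) η
  have hnorm : ∀ x : ℝ, ‖Complex.exp (-(Complex.I * η * x))‖ = 1 := fun x => by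
    have h : -(Complex.I * η * x) = Complex.I * ((-(η * x) : ℝ) : ℂ) := by push_cast; ring
    rw [h, norm_exp_I_mul_real]
  obtain ⟨C, hC⟩ := u.norm_le_inv_one_add_sq
  have hc : Continuous f := by
    refine continuous_of_dominated (bound := fun x => C * (1 + x ^ 2)⁻¹) (fun t => ?_) (fun t => ?_)
      (integrable_inv_one_add_sq.const_mul C) ?_
    · exact Continuous.aestronglyMeasurable (by fun_prop)
    · refine .of_forall fun x => ?_
      rw [norm_mul, hnorm, one_mul]
      exact hC x t
    · exact .of_forall fun x => by fun_prop
  have hint : Integrable f := by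
    have h := (integrable_exp_mul_schwartz u η 0).integral_prod_right
    refine h.congr (.of_forall fun t => ?_)
    refine integral_congr_ae (.of_forall fun x => ?_)
    simp [mul_assoc]
  have hFT : FT f = fun τ => schwartzFT u (η, τ) := by
    ext τ
    rw [schwartzFT_apply, FT]
    refine Eq.trans ?_ (integral_prod_symm _ (integrable_exp_mul_schwartz u η τ)).symm
    refine integral_congr_ae (.of_forall fun t => ?_)
    simp only [f, FT]
    rw [← integral_const_mul]
    refine integral_congr_ae (.of_forall fun x => ?_)
    simp only
    rw [← mul_assoc, ← Complex.exp_add]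
    congr 2
    ring
  have hF : Integrable (FT f) := by
    rw [hFT]
    exact (sliceRight (schwartzFT u) η).integrable
  have h := FT_inversion hc hint hF t
  rw [hFT] at h
  exact h

/-- The Fourier multiplier in the space variable with symbol `g`. -/
def spaceMultiplier (g : ℝ → ℂ) (u : SchwartzMap (ℝ × ℝ) ℂ) : SchwartzMap (ℝ × ℝ) ℂ :=
  schwartzFTInv (SchwartzMap.smulLeftCLM ℂ (fun P : ℝ × ℝ => g P.1) (schwartzFT u))

lemma hasTemperateGrowth_comp_fst {g : ℝ → ℂ} (hg : g.HasTemperateGrowth) :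
    (fun P : ℝ × ℝ => g P.1).HasTemperateGrowth :=
  hg.comp (ContinuousLinearMap.fst ℝ ℝ ℝ).hasTemperateGrowth

lemma hasTemperateGrowth_comp_snd {g : ℝ → ℂ} (hg : g.HasTemperateGrowth) :
    (fun P : ℝ × ℝ => g P.2).HasTemperateGrowth :=
  hg.comp (ContinuousLinearMap.snd ℝ ℝ ℝ).hasTemperateGrowth

lemma schwartzFT_spaceMultiplier {g : ℝ → ℂ} (hg : g.HasTemperateGrowth)
    (u : SchwartzMap (ℝ × ℝ) ℂ) (P : ℝ × ℝ) :
    schwartzFT (spaceMultiplier g u) P = g P.1 * schwartzFT u P := by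
  rw [spaceMultiplier, schwartzFT_schwartzFTInv,
    SchwartzMap.smulLeftCLM_apply_apply (hasTemperateGrowth_comp_fst hg), smul_eq_mul]

lemma spaceMultiplier_apply {g : ℝ → ℂ} (hg : g.HasTemperateGrowth)
    (u : SchwartzMap (ℝ × ℝ) ℂ) (x t : ℝ) :
    spaceMultiplier g u (x, t) = (2 * π)⁻¹ • ∫ ξ : ℝ,
      Complex.exp (Complex.I * ξ * x) * (g ξ * FT (fun y => u (y, t)) ξ) := by
  have h := (sliceLeft (spaceMultiplier g u) t).FT_inversion x
  rw [sliceLeft_apply] at h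
  rw [h]
  congr 1
  refine integral_congr_ae (.of_forall fun ξ => ?_)
  have h1 : FT (sliceLeft (spaceMultiplier g u) t) ξ = g ξ * FT (fun y => u (y, t)) ξ := by
    have h2 := FT_slice_eq (spaceMultiplier g u) ξ t
    refine h2.trans ?_
    rw [FT_slice_eq, mul_smul_comm, ← integral_const_mul]
    congr 1
    refine integral_congr_ae (.of_forall fun τ => ?_)
    simp only [schwartzFT_spaceMultiplier hg]
    ring
  simp only [h1]

lemma Iop_eq_spaceMultiplier {m : ℝ → ℝ} (hm : m.HasTemperateGrowth)
    (u : SchwartzMap (ℝ × ℝ) ℂ) (x t : ℝ) :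
    Iop m (fun x t => u (x, t)) x t = spaceMultiplier (fun ξ => (m ξ : ℂ)) u (x, t) := by
  rw [spaceMultiplier_apply (by fun_prop), Iop]
  congr 1
  refine integral_congr_ae (.of_forall fun ξ => ?_)
  simp only
  ring

lemma dxIop_eq_spaceMultiplier {m : ℝ → ℝ} (hm : m.HasTemperateGrowth)
    (u : SchwartzMap (ℝ × ℝ) ℂ) (x t : ℝ) :
    dxIop m (fun x t => u (x, t)) x t =
      spaceMultiplier (fun ξ => Complex.I * ξ * (m ξ : ℂ)) u (x, t) := by
  rw [spaceMultiplier_apply (by fun_prop), dxIop]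
  congr 1
  refine integral_congr_ae (.of_forall fun ξ => ?_)
  simp only
  ring

lemma enorm_schwartzFT_le_of_superposition {X : Type*} [MeasurableSpace X] {σ : Measure X}
    [SFinite σ] {K : X → ℂ} (hK : Integrable K σ) {h : X → ℝ × ℝ} (hh : Measurable h) {c : ℝ}
    (hc : 0 ≤ c) (hc1 : c ≤ 1) (v w : SchwartzMap (ℝ × ℝ) ℂ)
    (hw : ∀ z, w z = (c • ∫ q, Complex.exp (Complex.I * ((h q).1 * z.1 + (h q).2 * z.2)) * K q ∂σ)
      * v z) (P : ℝ × ℝ) :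
    ‖schwartzFT w P‖ₑ ≤ ∫⁻ q, ‖K q‖ₑ * ‖schwartzFT v (P - h q)‖ₑ ∂σ := by
  have hint : Integrable (Function.uncurry fun (z : ℝ × ℝ) (q : X) =>
      Complex.exp (Complex.I * ((-((P.1 - (h q).1) * z.1 + (P.2 - (h q).2) * z.2) : ℝ) : ℂ)) *
        (v z * K q)) (volume.prod σ) :=
    integrable_exp_mul (f := fun p : (ℝ × ℝ) × X => v p.1 * K p.2)
      (v.integrable.mul_prod hK)
      (g := fun p : (ℝ × ℝ) × X => -((P.1 - (h p.2).1) * p.1.1 + (P.2 - (h p.2).2) * p.1.2))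
      (by fun_prop)
  have h1 : schwartzFT w P = c • ∫ q, K q * schwartzFT v (P - h q) ∂σ := by
    have h2 : schwartzFT w P = ∫ z : ℝ × ℝ, c • ∫ q,
        Complex.exp (Complex.I * ((-((P.1 - (h q).1) * z.1 + (P.2 - (h q).2) * z.2) : ℝ) : ℂ)) *
        (v z * K q) ∂σ := by
      rw [schwartzFT_apply]
      refine integral_congr_ae (.of_forall fun z => ?_)
      simp only [hw]
      rw [smul_mul_assoc, mul_smul_comm, ← integral_mul_const, ← integral_const_mul]
      congr 1
      refine integral_congr_ae (.of_forall fun q => ?_)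
      simp only
      have h3 : Complex.exp
          (Complex.I * ((-((P.1 - (h q).1) * z.1 + (P.2 - (h q).2) * z.2) : ℝ) : ℂ)) =
          Complex.exp (-(Complex.I * (P.1 * z.1 + P.2 * z.2))) *
            Complex.exp (Complex.I * ((h q).1 * z.1 + (h q).2 * z.2)) := by
        rw [← Complex.exp_add]
        congr 1
        push_cast
        ring
      rw [h3]
      ring
    rw [h2, integral_smul, integral_integral_swap hint]
    congr 1
    refine integral_congr_ae (.of_forall fun q => ?_)
    simp only
    rw [schwartzFT_apply, ← integral_const_mul]
    refine integral_congr_ae (.of_forall fun z => ?_)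
    simp only [Prod.fst_sub, Prod.snd_sub]
    have h4 : Complex.exp
        (Complex.I * ((-((P.1 - (h q).1) * z.1 + (P.2 - (h q).2) * z.2) : ℝ) : ℂ)) =
        Complex.exp (-(Complex.I * (((P.1 - (h q).1 : ℝ) : ℂ) * z.1 +
          ((P.2 - (h q).2 : ℝ) : ℂ) * z.2))) := by
      congr 1
      push_cast
      ring
    rw [h4]
    ring
  rw [h1, enorm_smul]
  calc ‖c‖ₑ * ‖∫ q, K q * schwartzFT v (P - h q) ∂σ‖ₑ
      ≤ 1 * ∫⁻ q, ‖K q * schwartzFT v (P - h q)‖ₑ ∂σ := by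
        refine mul_le_mul' ?_ (enorm_integral_le_lintegral_enorm _)
        rw [Real.enorm_of_nonneg hc]
        exact ENNReal.ofReal_le_one.mpr hc1
    _ = _ := by
        rw [one_mul]
        simp only [enorm_mul]

lemma enorm_schwartzFT_mul_le (u v w : SchwartzMap (ℝ × ℝ) ℂ) (hw : ∀ z, w z = u z * v z)
    (P : ℝ × ℝ) :
    ‖schwartzFT w P‖ₑ ≤ ∫⁻ q, ‖schwartzFT u q‖ₑ * ‖schwartzFT v (P - q)‖ₑ := by
  have hpi : (1 : ℝ) ≤ (2 * π) ^ 2 := by nlinarith [Real.pi_gt_three]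
  refine enorm_schwartzFT_le_of_superposition (schwartzFT u).integrable measurable_id
    (c := ((2 * π) ^ 2)⁻¹) (by positivity) (inv_le_one_of_one_le₀ hpi) v w (fun z => ?_) P
  rw [hw, schwartz_inversion u z]
  rfl

lemma enorm_schwartzFT_cutoff_le (χ : SchwartzMap ℝ ℂ) :
    ∃ C : ℝ, ∀ δ > (0 : ℝ), ∀ v w : SchwartzMap (ℝ × ℝ) ℂ,
      (∀ z, w z = χ (z.2 / δ) * v z) → ∀ ξ τ,
        ‖schwartzFT w (ξ, τ)‖ₑ ≤
          ENNReal.ofReal C * ∫⁻ x, cutKernel δ x * ‖schwartzFT v (ξ, τ - x)‖ₑ := by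
  obtain ⟨C, hC0, hC⟩ := χ.norm_FT_le 4
  refine ⟨C, fun δ hδ v w hw ξ τ => ?_⟩
  have hpi : (1 : ℝ) ≤ 2 * π := by nlinarith [Real.pi_gt_three]
  have h1 := enorm_schwartzFT_le_of_superposition χ.integrable_FT
    (h := fun l : ℝ => ((0 : ℝ), l / δ)) (by fun_prop)
    (c := (2 * π)⁻¹) (by positivity) (inv_le_one_of_one_le₀ hpi) v w (fun z => by
      rw [hw, χ.FT_inversion]
      congr 2
      refine integral_congr_ae (.of_forall fun l => ?_)
      simp only
      congr 2
      push_cast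
      ring) (ξ, τ)
  refine h1.trans ?_
  set f : ℝ → ℝ≥0∞ := fun l => ‖FT χ l‖ₑ * ‖schwartzFT v ((ξ, τ) - ((0 : ℝ), l / δ))‖ₑ with hf
  have hfm : Measurable f := by
    have h2 := (FT_continuous χ.integrable).measurable
    have h3 := (schwartzFT v).continuous.measurable
    fun_prop
  have h2 := lintegral_comp_mul hδ f hfm
  have h3 : ∫⁻ l, f l = ENNReal.ofReal δ * ∫⁻ x, f (δ * x) := by
    rw [h2, ← mul_assoc, ← ENNReal.ofReal_mul hδ.le, mul_inv_cancel₀ hδ.ne', ENNReal.ofReal_one,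
      one_mul]
  change ∫⁻ l, f l ≤ _
  rw [h3, ← lintegral_const_mul _ (by fun_prop), ← lintegral_const_mul' _ _ ENNReal.ofReal_ne_top]
  refine lintegral_mono fun x => ?_
  simp only [hf, cutKernel]
  have h4 : ((ξ, τ) : ℝ × ℝ) - ((0 : ℝ), δ * x / δ) = (ξ, τ - x) := by
    rw [mul_div_cancel_left₀ _ hδ.ne']
    simp
  rw [h4]
  have h5 : ‖FT χ (δ * x)‖ₑ ≤ ENNReal.ofReal C * jb (-4) (δ * x) := by
    rw [jb, ← ENNReal.ofReal_mul hC0, ← ofReal_norm]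
    refine ENNReal.ofReal_le_ofReal ?_
    rw [Real.rpow_neg (by positivity), ← div_eq_mul_inv, le_div_iff₀ (by positivity), mul_comm]
    exact_mod_cast hC (δ * x)
  calc ENNReal.ofReal δ * (‖FT χ (δ * x)‖ₑ * ‖schwartzFT v (ξ, τ - x)‖ₑ)
      ≤ ENNReal.ofReal δ * ((ENNReal.ofReal C * jb (-4) (δ * x)) * ‖schwartzFT v (ξ, τ - x)‖ₑ) :=
        mul_le_mul' le_rfl (mul_le_mul' h5 le_rfl)
    _ = _ := by ring

/-- The square of the Bourgain norm `X_{0,p/2}`, with the weight `(1 + |τ - φ(ξ)|)^p`. -/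
def bourgainSq (ν μ p : ℝ) (W : SchwartzMap (ℝ × ℝ) ℂ) : ℝ≥0∞ :=
  ∫⁻ ξ, ∫⁻ τ, jb p (τ - phase ν μ ξ) * ‖schwartzFT W (ξ, τ)‖ₑ ^ 2

lemma XNorm_sq_eq (ν μ b : ℝ) (W : SchwartzMap (ℝ × ℝ) ℂ) :
    XNorm ν μ 0 b (fun x t => W (x, t)) ^ 2 = ∫⁻ ξ : ℝ, ∫⁻ τ : ℝ,
      ENNReal.ofReal ((1 + (τ - phase ν μ ξ) ^ 2) ^ b) * ‖schwartzFT W (ξ, τ)‖ₑ ^ 2 := by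
  rw [XNorm, rpow_half_sq]
  simp only [rpow_zero, one_mul, FT2_eq_schwartzFT]
  rfl

lemma jb_two_mul_le {b : ℝ} (hb : 0 ≤ b) (hb1 : b ≤ 1) (x : ℝ) :
    jb (2 * b) x ≤ 2 * ENNReal.ofReal ((1 + x ^ 2) ^ b) := by
  have h2 : (2 : ℝ≥0∞) = ENNReal.ofReal 2 := by simp
  have hx := br_pos x
  rw [h2, jb, ← ENNReal.ofReal_mul (by norm_num)]
  refine ENNReal.ofReal_le_ofReal ?_
  have h3 : (1 + |x|) ^ (2 : ℝ) ≤ 2 * (1 + x ^ 2) := by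
    rw [rpow_two]
    nlinarith [sq_nonneg (1 - |x|), sq_abs x]
  rw [rpow_mul hx.le]
  calc ((1 + |x|) ^ (2 : ℝ)) ^ b ≤ (2 * (1 + x ^ 2)) ^ b := by gcongr
    _ = 2 ^ b * (1 + x ^ 2) ^ b := mul_rpow (by norm_num) (by positivity)
    _ ≤ 2 ^ (1 : ℝ) * (1 + x ^ 2) ^ b := by
        gcongr
        norm_num
    _ = _ := by rw [rpow_one]

lemma ofReal_rpow_le_jb {b : ℝ} (hb : -1 ≤ b) (hb0 : b ≤ 0) (x : ℝ) :
    ENNReal.ofReal ((1 + x ^ 2) ^ b) ≤ 2 * jb (2 * b) x := by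
  have h := jb_two_mul_le (b := -b) (by linarith) (by linarith) x
  have h1 := jb_mul_jb_neg (2 * b) x
  have h2 : ENNReal.ofReal ((1 + x ^ 2) ^ b) * ENNReal.ofReal ((1 + x ^ 2) ^ (-b)) = 1 := by
    rw [← ENNReal.ofReal_mul (by positivity), ← rpow_add (by positivity), add_neg_cancel, rpow_zero,
      ENNReal.ofReal_one]
  rw [mul_neg] at h
  calc ENNReal.ofReal ((1 + x ^ 2) ^ b)
      = ENNReal.ofReal ((1 + x ^ 2) ^ b) * (jb (2 * b) x * jb (-(2 * b)) x) := by rw [h1, mul_one]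
    _ ≤ ENNReal.ofReal ((1 + x ^ 2) ^ b) *
          (jb (2 * b) x * (2 * ENNReal.ofReal ((1 + x ^ 2) ^ (-b)))) :=
        mul_le_mul' le_rfl (mul_le_mul' le_rfl h)
    _ = (ENNReal.ofReal ((1 + x ^ 2) ^ b) * ENNReal.ofReal ((1 + x ^ 2) ^ (-b))) *
          (2 * jb (2 * b) x) := by ring
    _ = _ := by rw [h2, one_mul]

lemma bourgainSq_le_XNorm (ν μ : ℝ) {b : ℝ} (hb : 0 ≤ b) (hb1 : b ≤ 1)
    (W : SchwartzMap (ℝ × ℝ) ℂ) :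
    bourgainSq ν μ (2 * b) W ≤ 2 * XNorm ν μ 0 b (fun x t => W (x, t)) ^ 2 := by
  rw [XNorm_sq_eq, bourgainSq, ← lintegral_const_mul' _ _ (by simp)]
  refine lintegral_mono fun ξ => ?_
  rw [← lintegral_const_mul' _ _ (by simp)]
  refine lintegral_mono fun τ => ?_
  rw [← mul_assoc]
  exact mul_le_mul' (jb_two_mul_le hb hb1 _) le_rfl

lemma XNorm_le_bourgainSq (ν μ : ℝ) {b : ℝ} (hb : -1 ≤ b) (hb0 : b ≤ 0)
    (W : SchwartzMap (ℝ × ℝ) ℂ) :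
    XNorm ν μ 0 b (fun x t => W (x, t)) ^ 2 ≤ 2 * bourgainSq ν μ (2 * b) W := by
  rw [XNorm_sq_eq, bourgainSq, ← lintegral_const_mul' _ _ (by simp)]
  refine lintegral_mono fun ξ => ?_
  rw [← lintegral_const_mul' _ _ (by simp)]
  refine lintegral_mono fun τ => ?_
  rw [← mul_assoc]
  exact mul_le_mul' (ofReal_rpow_le_jb hb hb0 _) le_rfl

lemma measurable_enorm_schwartz (W : SchwartzMap (ℝ × ℝ) ℂ) : Measurable fun P => ‖W P‖ₑ :=
  W.continuous.measurable.enorm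

lemma lintegral_scaled_weight_cutoff_le {ν μ p δ C : ℝ} (hp : 1 ≤ p) (hp2 : p ≤ 2) (hδ : 0 < δ)
    (hδ1 : δ ≤ 1) {m : ℝ → ℝ} (hm : m.HasTemperateGrowth) (hm0 : ∀ ξ, 0 ≤ m ξ)
    (u u' : SchwartzMap (ℝ × ℝ) ℂ)
    (hu : ∀ ξ τ, ‖schwartzFT u' (ξ, τ)‖ₑ ≤
      ENNReal.ofReal C * ∫⁻ x, cutKernel δ x * ‖schwartzFT u (ξ, τ - x)‖ₑ) :
    ∫⁻ P : ℝ × ℝ, (ENNReal.ofReal (m P.1) *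
        (jb (p / 2) (δ * (P.2 - phase ν μ P.1)) * ‖schwartzFT u' P‖ₑ)) ^ 2 ≤
      ENNReal.ofReal C ^ 2 * (4 * ((∫⁻ z, jb (-2) z) + ∫⁻ z, jb (-p) z) * (∫⁻ z, jb (-4) z)) *
        ENNReal.ofReal δ * bourgainSq ν μ p (spaceMultiplier (fun ξ => (m ξ : ℂ)) u) := by
  have hmm : Measurable m := hm.1.continuous.measurable
  have hφ := measurable_phase ν μ
  have hu'm := measurable_enorm_schwartz (schwartzFT u')
  set W := spaceMultiplier (fun ξ => (m ξ : ℂ)) u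
  have hW := measurable_enorm_schwartz (schwartzFT W)
  have hWm : Measurable fun ξ => ∫⁻ τ, jb p (τ - phase ν μ ξ) * ‖schwartzFT W (ξ, τ)‖ₑ ^ 2 :=
    Measurable.lintegral_prod_right'
      (f := fun P : ℝ × ℝ => jb p (P.2 - phase ν μ P.1) * ‖schwartzFT W P‖ₑ ^ 2) (by fun_prop)
  rw [Measure.volume_eq_prod, lintegral_prod _ (Measurable.aemeasurable (by fun_prop)), bourgainSq,
    ← lintegral_const_mul _ hWm]
  refine lintegral_mono fun ξ => ?_
  have hum : Measurable fun τ => ‖schwartzFT u (ξ, τ)‖ₑ :=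
    (measurable_enorm_schwartz (schwartzFT u)).comp measurable_prodMk_left
  have h := lintegral_cut_high_le hp hp2 hδ hδ1 (phase ν μ ξ) hum
  have hWξ : ∀ τ, ‖schwartzFT W (ξ, τ)‖ₑ = ENNReal.ofReal (m ξ) * ‖schwartzFT u (ξ, τ)‖ₑ :=
    fun τ => by
      rw [schwartzFT_spaceMultiplier (by fun_prop), enorm_mul, ← ofReal_norm, Complex.norm_real,
        Real.norm_of_nonneg (hm0 ξ)]
  generalize 4 * ((∫⁻ z, jb (-2) z) + ∫⁻ z, jb (-p) z) * (∫⁻ z, jb (-4) z) = K at h ⊢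
  simp only [hWξ]
  calc ∫⁻ τ, (ENNReal.ofReal (m ξ) *
        (jb (p / 2) (δ * (τ - phase ν μ ξ)) * ‖schwartzFT u' (ξ, τ)‖ₑ)) ^ 2
      ≤ ∫⁻ τ, (ENNReal.ofReal (m ξ) ^ 2 * ENNReal.ofReal C ^ 2) *
          (jb p (δ * (τ - phase ν μ ξ)) *
            (∫⁻ x, cutKernel δ x * ‖schwartzFT u (ξ, τ - x)‖ₑ) ^ 2) := by
        refine lintegral_mono fun τ => ?_
        have hp' : jb p (δ * (τ - phase ν μ ξ)) = jb (p / 2) (δ * (τ - phase ν μ ξ)) ^ 2 := by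
          rw [jb_sq]
          congr 1
          ring
        simp only
        rw [hp', ← mul_pow, ← mul_pow, ← mul_pow]
        refine pow_le_pow_left' ?_ 2
        calc _ ≤ ENNReal.ofReal (m ξ) * (jb (p / 2) (δ * (τ - phase ν μ ξ)) *
              (ENNReal.ofReal C * ∫⁻ x, cutKernel δ x * ‖schwartzFT u (ξ, τ - x)‖ₑ)) :=
              mul_le_mul' le_rfl (mul_le_mul' le_rfl (hu ξ τ))
          _ = _ := by ring
    _ = (ENNReal.ofReal (m ξ) ^ 2 * ENNReal.ofReal C ^ 2) * ∫⁻ τ,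
          (jb p (δ * (τ - phase ν μ ξ)) *
            (∫⁻ x, cutKernel δ x * ‖schwartzFT u (ξ, τ - x)‖ₑ) ^ 2) :=
        lintegral_const_mul' _ _ (by finiteness)
    _ ≤ (ENNReal.ofReal (m ξ) ^ 2 * ENNReal.ofReal C ^ 2) * (K * ENNReal.ofReal δ *
          ∫⁻ τ, jb p (τ - phase ν μ ξ) * ‖schwartzFT u (ξ, τ)‖ₑ ^ 2) := mul_le_mul' le_rfl h
    _ = ENNReal.ofReal C ^ 2 * K * ENNReal.ofReal δ * (ENNReal.ofReal (m ξ) ^ 2 *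
          ∫⁻ τ, jb p (τ - phase ν μ ξ) * ‖schwartzFT u (ξ, τ)‖ₑ ^ 2) := by
        ring
    _ = _ := by
        rw [← lintegral_const_mul' _ _ (by finiteness)]
        congr! 3 with τ
        ring

lemma lintegral_low_weight_cutoff_le {ν μ q δ δ' C : ℝ} (hq : 0 ≤ q) (hq1 : q ≤ 1) (hδ : 0 < δ)
    (hδδ' : δ ≤ δ') (w w' : SchwartzMap (ℝ × ℝ) ℂ)
    (hw : ∀ ξ τ, ‖schwartzFT w' (ξ, τ)‖ₑ ≤
      ENNReal.ofReal C * ∫⁻ x, cutKernel δ x * ‖schwartzFT w (ξ, τ - x)‖ₑ) :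
    bourgainSq ν μ (-q) w' ≤
      ENNReal.ofReal C ^ 2 * ((∫⁻ z, jb (-4) z) * (8 * ((∫⁻ z, jb (-2) z) + powConst q))) *
        ENNReal.ofReal (δ' ^ q) * ∫⁻ P : ℝ × ℝ,
          (jb (-q / 2) (δ' * (P.2 - phase ν μ P.1)) * ‖schwartzFT w P‖ₑ) ^ 2 := by
  have hφ := measurable_phase ν μ
  have hwm := measurable_enorm_schwartz (schwartzFT w)
  have hm : Measurable fun P : ℝ × ℝ =>
      (jb (-q / 2) (δ' * (P.2 - phase ν μ P.1)) * ‖schwartzFT w P‖ₑ) ^ 2 := by fun_prop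
  rw [Measure.volume_eq_prod, lintegral_prod _ hm.aemeasurable, bourgainSq,
    ← lintegral_const_mul _ hm.lintegral_prod_right']
  refine lintegral_mono fun ξ => ?_
  have hum : Measurable fun τ => ‖schwartzFT w (ξ, τ)‖ₑ := hwm.comp measurable_prodMk_left
  have h := lintegral_cut_low_le hq hq1 hδ hδδ' (phase ν μ ξ) hum
  generalize (∫⁻ z, jb (-4) z) * (8 * ((∫⁻ z, jb (-2) z) + powConst q)) = K at h ⊢
  calc ∫⁻ τ, jb (-q) (τ - phase ν μ ξ) * ‖schwartzFT w' (ξ, τ)‖ₑ ^ 2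
      ≤ ∫⁻ τ, ENNReal.ofReal C ^ 2 * (jb (-q) (τ - phase ν μ ξ) *
            (∫⁻ x, cutKernel δ x * ‖schwartzFT w (ξ, τ - x)‖ₑ) ^ 2) := by
        refine lintegral_mono fun τ => ?_
        calc _ ≤ jb (-q) (τ - phase ν μ ξ) *
              (ENNReal.ofReal C * ∫⁻ x, cutKernel δ x * ‖schwartzFT w (ξ, τ - x)‖ₑ) ^ 2 :=
              mul_le_mul' le_rfl (pow_le_pow_left' (hw ξ τ) 2)
          _ = _ := by ring
    _ = ENNReal.ofReal C ^ 2 * ∫⁻ τ, (jb (-q) (τ - phase ν μ ξ) *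
            (∫⁻ x, cutKernel δ x * ‖schwartzFT w (ξ, τ - x)‖ₑ) ^ 2) :=
        lintegral_const_mul' _ _ (by finiteness)
    _ ≤ ENNReal.ofReal C ^ 2 * (K * ENNReal.ofReal (δ' ^ q) *
          ∫⁻ τ, jb (-q) (δ' * (τ - phase ν μ ξ)) * ‖schwartzFT w (ξ, τ)‖ₑ ^ 2) :=
        mul_le_mul' le_rfl h
    _ = ENNReal.ofReal C ^ 2 * K * ENNReal.ofReal (δ' ^ q) *
          ∫⁻ τ, jb (-q) (δ' * (τ - phase ν μ ξ)) * ‖schwartzFT w (ξ, τ)‖ₑ ^ 2 := by ring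
    _ = _ := by
        congr! 3 with τ
        rw [mul_pow, jb_sq]
        congr 2
        ring

lemma weighted_product_le_bilinKernel {ν μ N s ε a : ℝ} {m : ℝ → ℝ}
    (hm : AdmissibleMultiplier N s m) (hN : 0 < N) (hs : s ∈ Set.Icc (-1 : ℝ) 0)
    (ha : 1 / N ≤ a) (q q' : ℝ × ℝ) (x y : ℝ≥0∞) :
    jb ((-1 + ε) / 2) (a ^ 3 * (q.2 + q'.2 - phase ν μ (q.1 + q'.1))) *
        (ENNReal.ofReal (|q.1 + q'.1| * m (q.1 + q'.1)) * (x * y)) ≤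
      12 * (bilinKernel ν μ (-s) ε a q q' *
        ((ENNReal.ofReal (m q.1) * (jb ((1 + ε) / 2) (a ^ 3 * (q.2 - phase ν μ q.1)) * x)) *
          (ENNReal.ofReal (m q'.1) *
            (jb ((1 + ε) / 2) (a ^ 3 * (q'.2 - phase ν μ q'.1)) * y)))) := by
  have h := hm.le_mul_mul hN hs ha q.1 q'.1
  rw [bilinKernel]
  set R := ((1 + |a * q.1|) * (1 + |a * q'.1|) / (1 + |a * (q.1 + q'.1)|)) ^ (-s)
  have hR : 0 ≤ R := by positivity
  have h12 : (12 : ℝ≥0∞) = ENNReal.ofReal 12 := by simp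
  have h1 : ENNReal.ofReal (|q.1 + q'.1| * m (q.1 + q'.1)) ≤
      12 * ENNReal.ofReal (|q.1 + q'.1| * R) * (ENNReal.ofReal (m q.1) * ENNReal.ofReal (m q'.1)) := by
    have hm1 := (hm.pos q.1).le
    rw [h12, ← ENNReal.ofReal_mul (by norm_num), ← ENNReal.ofReal_mul hm1,
      ← ENNReal.ofReal_mul (by positivity)]
    refine ENNReal.ofReal_le_ofReal ?_
    calc |q.1 + q'.1| * m (q.1 + q'.1) ≤ |q.1 + q'.1| * (12 * R * (m q.1 * m q'.1)) := by gcongr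
      _ = _ := by ring
  set z := jb ((-1 + ε) / 2) (a ^ 3 * (q.2 + q'.2 - phase ν μ (q.1 + q'.1)))
  have h2 := jb_mul_jb_neg ((1 + ε) / 2) (a ^ 3 * (q.2 - phase ν μ q.1))
  have h3 := jb_mul_jb_neg ((1 + ε) / 2) (a ^ 3 * (q'.2 - phase ν μ q'.1))
  generalize jb ((1 + ε) / 2) (a ^ 3 * (q.2 - phase ν μ q.1)) = b1 at *
  generalize jb (-((1 + ε) / 2)) (a ^ 3 * (q.2 - phase ν μ q.1)) = b1' at *
  generalize jb ((1 + ε) / 2) (a ^ 3 * (q'.2 - phase ν μ q'.1)) = b2 at *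
  generalize jb (-((1 + ε) / 2)) (a ^ 3 * (q'.2 - phase ν μ q'.1)) = b2' at *
  calc _ ≤ z * ((12 * ENNReal.ofReal (|q.1 + q'.1| * R) *
        (ENNReal.ofReal (m q.1) * ENNReal.ofReal (m q'.1))) * (x * y)) :=
        mul_le_mul' le_rfl (mul_le_mul' h1 le_rfl)
    _ = z * ((12 * ENNReal.ofReal (|q.1 + q'.1| * R) *
        (ENNReal.ofReal (m q.1) * ENNReal.ofReal (m q'.1))) * (x * y)) * (b1 * b1') * (b2 * b2') := by
        rw [h2, h3, mul_one, mul_one]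
    _ = _ := by ring

lemma lintegral_bilinear_le {ν μ A N s ε a : ℝ} {m : ℝ → ℝ} (hμ : μ ≠ 0) (hA : 2 ≤ A)
    (hνA : |ν| ≤ |μ| * A) (hm : AdmissibleMultiplier N s m) (hN : 0 < N)
    (hs : s ∈ Set.Icc (-1 : ℝ) 0) (hε : 0 < ε) (hε8 : ε ≤ 1 / 8)
    (hsε : 2 * -s ≤ 3 / 2 - 3 * ε) (ha : 0 < a) (ha1 : a ≤ 1) (haN : 1 / N ≤ a)
    (u v w : SchwartzMap (ℝ × ℝ) ℂ) (hw : ∀ z, w z = u z * v z) :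
    ∫⁻ P : ℝ × ℝ, (jb ((-1 + ε) / 2) (a ^ 3 * (P.2 - phase ν μ P.1)) *
        ‖schwartzFT (spaceMultiplier (fun ξ => Complex.I * ξ * (m ξ : ℂ)) w) P‖ₑ) ^ 2 ≤
      12 ^ 2 * (9 * ENNReal.ofReal (kernelConst μ A) * transConst μ A (1 + ε) *
        ENNReal.ofReal ((a ^ 6)⁻¹) *
        ((∫⁻ q : ℝ × ℝ, (ENNReal.ofReal (m q.1) *
            (jb ((1 + ε) / 2) (a ^ 3 * (q.2 - phase ν μ q.1)) * ‖schwartzFT u q‖ₑ)) ^ 2) *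
          ∫⁻ q : ℝ × ℝ, (ENNReal.ofReal (m q.1) *
            (jb ((1 + ε) / 2) (a ^ 3 * (q.2 - phase ν μ q.1)) * ‖schwartzFT v q‖ₑ)) ^ 2)) := by
  have hmt := hm.hasTemperateGrowth hN hs.2
  have hmm : Measurable m := hmt.1.continuous.measurable
  have hφ := measurable_phase ν μ
  have hum := measurable_enorm_schwartz (schwartzFT u)
  have hvm := measurable_enorm_schwartz (schwartzFT v)
  set F : ℝ × ℝ → ℝ≥0∞ := fun q => ENNReal.ofReal (m q.1) *
    (jb ((1 + ε) / 2) (a ^ 3 * (q.2 - phase ν μ q.1)) * ‖schwartzFT u q‖ₑ) with hF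
  set G : ℝ × ℝ → ℝ≥0∞ := fun q => ENNReal.ofReal (m q.1) *
    (jb ((1 + ε) / 2) (a ^ 3 * (q.2 - phase ν μ q.1)) * ‖schwartzFT v q‖ₑ) with hG
  have hb := bilinKernel_bound hμ hA hνA (by linarith [hs.2] : 0 ≤ -s) hε hε8 hsε ha ha1
    (by fun_prop : Measurable F) (by fun_prop : Measurable G)
  refine le_trans ?_ (mul_le_mul' le_rfl hb)
  rw [← lintegral_const_mul' _ _ (by finiteness)]
  refine lintegral_mono fun P => ?_
  rw [← mul_pow]
  refine pow_le_pow_left' ?_ 2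
  rw [← lintegral_const_mul' _ _ (by finiteness)]
  have hD : ‖schwartzFT (spaceMultiplier (fun ξ => Complex.I * ξ * (m ξ : ℂ)) w) P‖ₑ ≤
      ENNReal.ofReal (|P.1| * m P.1) * ∫⁻ q, ‖schwartzFT u q‖ₑ * ‖schwartzFT v (P - q)‖ₑ := by
    rw [schwartzFT_spaceMultiplier (by fun_prop), enorm_mul]
    refine mul_le_mul' (le_of_eq ?_) (enorm_schwartzFT_mul_le u v w hw P)
    rw [← ofReal_norm]
    simp [abs_of_pos (hm.pos P.1)]
  calc _ ≤ jb ((-1 + ε) / 2) (a ^ 3 * (P.2 - phase ν μ P.1)) * (ENNReal.ofReal (|P.1| * m P.1) *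
        ∫⁻ q, ‖schwartzFT u q‖ₑ * ‖schwartzFT v (P - q)‖ₑ) := mul_le_mul' le_rfl hD
    _ = ∫⁻ q, jb ((-1 + ε) / 2) (a ^ 3 * (P.2 - phase ν μ P.1)) * (ENNReal.ofReal (|P.1| * m P.1) *
        (‖schwartzFT u q‖ₑ * ‖schwartzFT v (P - q)‖ₑ)) := by
        rw [← lintegral_const_mul' _ _ ENNReal.ofReal_ne_top,
          ← lintegral_const_mul' _ _ (jb_ne_top _ _)]
    _ ≤ _ := by
        refine lintegral_mono fun q => ?_
        have h := weighted_product_le_bilinKernel (ν := ν) (μ := μ) (ε := ε) hm hN hs haN q (P - q)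
          ‖schwartzFT u q‖ₑ ‖schwartzFT v (P - q)‖ₑ
        simp only [Prod.fst_sub, Prod.snd_sub, add_sub_cancel] at h
        exact h

/-- Multiplication of a space-time Schwartz function by the time cutoff `χ (t / δ)`. -/
def timeCutoff (χ : SchwartzMap ℝ ℂ) (δ : ℝ) (u : SchwartzMap (ℝ × ℝ) ℂ) :
    SchwartzMap (ℝ × ℝ) ℂ :=
  SchwartzMap.smulLeftCLM ℂ (fun z : ℝ × ℝ => χ (z.2 / δ)) u

lemma timeCutoff_apply (χ : SchwartzMap ℝ ℂ) (δ : ℝ) (u : SchwartzMap (ℝ × ℝ) ℂ) (z : ℝ × ℝ) :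
    timeCutoff χ δ u z = χ (z.2 / δ) * u z := by
  have h1 : (fun t : ℝ => t / δ).HasTemperateGrowth := by
    have h := ((δ⁻¹ : ℝ) • ContinuousLinearMap.id ℝ ℝ).hasTemperateGrowth
    refine (congrArg Function.HasTemperateGrowth (funext fun t => ?_)).mp h
    simp [div_eq_inv_mul]
  exact SchwartzMap.smulLeftCLM_apply_apply
    (hasTemperateGrowth_comp_snd (g := fun t => χ (t / δ)) (χ.hasTemperateGrowth.comp h1)) u z

/-- The pointwise product of two Schwartz functions. -/
def schwartzMul (u v : SchwartzMap (ℝ × ℝ) ℂ) : SchwartzMap (ℝ × ℝ) ℂ :=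
  SchwartzMap.smulLeftCLM ℂ (fun z => u z) v

lemma schwartzMul_apply (u v : SchwartzMap (ℝ × ℝ) ℂ) (z : ℝ × ℝ) :
    schwartzMul u v z = u z * v z :=
  SchwartzMap.smulLeftCLM_apply_apply u.hasTemperateGrowth v z

lemma dxIop_congr_slice {m : ℝ → ℝ} {f g : ℝ → ℝ → ℂ} {t : ℝ} (h : ∀ y, f y t = g y t) (x : ℝ) :
    dxIop m f x t = dxIop m g x t := by
  simp only [dxIop, h]

lemma cutoff_mul_dxIop_eq {χ χ₂ : SchwartzMap ℝ ℂ} (hχ : ∀ t, χ t ≠ 0 → |t| ≤ 2)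
    (hχ₂ : ∀ t, |t| ≤ 2 → χ₂ t = 1) {m : ℝ → ℝ} (hm : m.HasTemperateGrowth) {δ δ' : ℝ}
    (hδ : 0 < δ) (hδδ' : δ ≤ δ') (u v : SchwartzMap (ℝ × ℝ) ℂ) (x t : ℝ) :
    χ (t / δ) * dxIop m (fun x' t' => u (x', t') * v (x', t')) x t =
      timeCutoff χ δ (spaceMultiplier (fun ξ => Complex.I * ξ * (m ξ : ℂ))
        (schwartzMul (timeCutoff χ₂ δ' u) (timeCutoff χ₂ δ' v))) (x, t) := by
  rw [timeCutoff_apply, ← dxIop_eq_spaceMultiplier hm]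
  by_cases h0 : χ (t / δ) = 0
  · simp [h0]
  · have h1 : χ₂ (t / δ') = 1 := by
      refine hχ₂ _ (le_trans ?_ (hχ _ h0))
      rw [abs_div, abs_div, abs_of_pos hδ, abs_of_pos (hδ.trans_le hδδ')]
      gcongr
    congr 1
    refine dxIop_congr_slice (fun y => ?_) x
    simp [schwartzMul_apply, timeCutoff_apply, h1]

/-- The bilinear estimate localized to the time scale `δ' = a ^ 3`, in squared form. -/
lemma exists_sq_bilinear_bound {ν μ s ε : ℝ} (hμ : μ ≠ 0) (hs : s ∈ Set.Icc (-1 : ℝ) 0)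
    (hε : 0 < ε) (hε8 : ε ≤ 1 / 8) (hsε : 2 * -s ≤ 3 / 2 - 3 * ε) {χ χ₂ : SchwartzMap ℝ ℂ}
    (hχ : ∀ t, χ t ≠ 0 → |t| ≤ 2) (hχ₂ : ∀ t, |t| ≤ 2 → χ₂ t = 1) :
    ∃ M : ℝ≥0∞, M < ∞ ∧ ∀ N > 0, ∀ m : ℝ → ℝ, AdmissibleMultiplier N s m →
      ∀ δ > 0, ∀ a > 0, a ≤ 1 → 1 / N ≤ a → δ ≤ a ^ 3 → ∀ u v : SchwartzMap (ℝ × ℝ) ℂ,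
        XNorm ν μ 0 ((1 + ε) / 2 - 1) (fun x t =>
            χ (t / δ) * dxIop m (fun x' t' => u (x', t') * v (x', t')) x t) ^ 2 ≤
          M * ENNReal.ofReal ((a ^ 3) ^ (1 - ε)) *
            (XNorm ν μ 0 ((1 + ε) / 2) (Iop m (fun x t => u (x, t))) ^ 2 *
              XNorm ν μ 0 ((1 + ε) / 2) (Iop m (fun x t => v (x, t))) ^ 2) := by
  obtain ⟨C₁, hC₁⟩ := enorm_schwartzFT_cutoff_le χ
  obtain ⟨C₂, hC₂⟩ := enorm_schwartzFT_cutoff_le χ₂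
  set A := max 2 (|ν| / |μ|)
  have hνA : |ν| ≤ |μ| * A := by
    rw [← div_le_iff₀' (abs_pos.2 hμ)]
    exact le_max_right _ _
  set K₁ := ENNReal.ofReal C₁ ^ 2 *
    ((∫⁻ z, jb (-4) z) * (8 * ((∫⁻ z, jb (-2) z) + powConst (1 - ε))))
  set K₂ := ENNReal.ofReal C₂ ^ 2 *
    (4 * ((∫⁻ z, jb (-2) z) + ∫⁻ z, jb (-(1 + ε)) z) * (∫⁻ z, jb (-4) z))
  set K₃ := 12 ^ 2 * (9 * ENNReal.ofReal (kernelConst μ A) * transConst μ A (1 + ε))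
  have hj4 : (∫⁻ z, jb (-4) z) ≠ ∞ := (lintegral_jb_lt_top (by norm_num)).ne
  have hj2 : (∫⁻ z, jb (-2) z) ≠ ∞ := (lintegral_jb_lt_top (by norm_num)).ne
  have hjε : (∫⁻ z, jb (-(1 + ε)) z) ≠ ∞ := (lintegral_jb_lt_top (by linarith)).ne
  have hpc : powConst (1 - ε) ≠ ∞ := (powConst_lt_top (by linarith)).ne
  have htc : transConst μ A (1 + ε) ≠ ∞ := (transConst_lt_top μ A (by linarith)).ne
  have hK₁ : K₁ ≠ ∞ := by finiteness
  have hK₂ : K₂ ≠ ∞ := by finiteness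
  have hK₃ : K₃ ≠ ∞ := by finiteness
  refine ⟨2 * (K₁ * (K₃ * ((K₂ * 2) * (K₂ * 2)))), by finiteness, ?_⟩
  intro N hN m hm δ hδ a ha ha1 haN hδa u v
  have hmt := hm.hasTemperateGrowth hN hs.2
  have ha3 : 0 < a ^ 3 := by positivity
  have ha31 : a ^ 3 ≤ 1 := pow_le_one₀ ha.le ha1
  set u' := timeCutoff χ₂ (a ^ 3) u with hu'
  set v' := timeCutoff χ₂ (a ^ 3) v with hv'
  set D := spaceMultiplier (fun ξ => Complex.I * ξ * (m ξ : ℂ)) (schwartzMul u' v')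
  have hfun : (fun x t => χ (t / δ) * dxIop m (fun x' t' => u (x', t') * v (x', t')) x t) =
      fun x t => timeCutoff χ δ D (x, t) := by
    funext x t
    exact cutoff_mul_dxIop_eq hχ hχ₂ hmt hδ hδa u v x t
  have hcut : ∀ f : SchwartzMap (ℝ × ℝ) ℂ,
      ∫⁻ P : ℝ × ℝ, (ENNReal.ofReal (m P.1) * (jb ((1 + ε) / 2) (a ^ 3 * (P.2 - phase ν μ P.1)) *
          ‖schwartzFT (timeCutoff χ₂ (a ^ 3) f) P‖ₑ)) ^ 2 ≤
        K₂ * 2 * (ENNReal.ofReal (a ^ 3) *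
          XNorm ν μ 0 ((1 + ε) / 2) (Iop m (fun x t => f (x, t))) ^ 2) := by
    intro f
    have h1 : Iop m (fun x t => f (x, t)) =
        fun x t => spaceMultiplier (fun ξ => (m ξ : ℂ)) f (x, t) := by
      funext x t
      exact Iop_eq_spaceMultiplier hmt f x t
    have h2 := lintegral_scaled_weight_cutoff_le (ν := ν) (μ := μ) (p := 1 + ε) (by linarith)
      (by linarith) ha3 ha31 hmt (fun ξ => (hm.pos ξ).le) f (timeCutoff χ₂ (a ^ 3) f)
      (hC₂ _ ha3 _ _ (timeCutoff_apply χ₂ (a ^ 3) f))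
    have h3 := bourgainSq_le_XNorm ν μ (b := (1 + ε) / 2) (by linarith) (by linarith)
      (spaceMultiplier (fun ξ => (m ξ : ℂ)) f)
    rw [mul_div_cancel₀ _ (two_ne_zero' ℝ)] at h3
    rw [h1]
    refine (h2.trans (mul_le_mul' le_rfl h3)).trans (le_of_eq ?_)
    simp only [K₂]
    ring
  have hlow := lintegral_low_weight_cutoff_le (ν := ν) (μ := μ) (q := 1 - ε) (by linarith)
    (by linarith) hδ hδa D (timeCutoff χ δ D) (hC₁ δ hδ _ _ (timeCutoff_apply χ δ D))
  have hbil := lintegral_bilinear_le hμ (le_max_left 2 (|ν| / |μ|)) hνA hm hN hs hε hε8 hsε ha ha1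
    haN u' v' (schwartzMul u' v') (schwartzMul_apply u' v')
  have hX := XNorm_le_bourgainSq ν μ (b := (1 + ε) / 2 - 1) (by linarith) (by linarith)
    (timeCutoff χ δ D)
  rw [show 2 * ((1 + ε) / 2 - 1) = -(1 - ε) by ring] at hX
  rw [show -(1 - ε) / 2 = (-1 + ε) / 2 by ring] at hlow
  have ha6 : ENNReal.ofReal ((a ^ 6)⁻¹) * (ENNReal.ofReal (a ^ 3) * ENNReal.ofReal (a ^ 3)) = 1 := by
    rw [← ENNReal.ofReal_mul ha3.le, ← ENNReal.ofReal_mul (by positivity),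
      show (a ^ 6)⁻¹ * (a ^ 3 * a ^ 3) = 1 by field_simp, ENNReal.ofReal_one]
  rw [hfun]
  set X := XNorm ν μ 0 ((1 + ε) / 2) (Iop m (fun x t => u (x, t)))
  set Y := XNorm ν μ 0 ((1 + ε) / 2) (Iop m (fun x t => v (x, t)))
  set T := ENNReal.ofReal ((a ^ 3) ^ (1 - ε))
  calc XNorm ν μ 0 ((1 + ε) / 2 - 1) (fun x t => timeCutoff χ δ D (x, t)) ^ 2
      ≤ 2 * (K₁ * T * (12 ^ 2 * (9 * ENNReal.ofReal (kernelConst μ A) * transConst μ A (1 + ε) *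
          ENNReal.ofReal ((a ^ 6)⁻¹) * ((K₂ * 2 * (ENNReal.ofReal (a ^ 3) * X ^ 2)) *
            (K₂ * 2 * (ENNReal.ofReal (a ^ 3) * Y ^ 2)))))) :=
        hX.trans (mul_le_mul' le_rfl (hlow.trans (mul_le_mul' le_rfl (hbil.trans
          (mul_le_mul' le_rfl (mul_le_mul' le_rfl (mul_le_mul' (hcut u) (hcut v))))))))
    _ = 2 * (K₁ * (K₃ * ((K₂ * 2) * (K₂ * 2)))) * T * (X ^ 2 * Y ^ 2) *
          (ENNReal.ofReal ((a ^ 6)⁻¹) * (ENNReal.ofReal (a ^ 3) * ENNReal.ofReal (a ^ 3))) := by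
        simp only [K₃]
        ring
    _ = _ := by rw [ha6, mul_one]

lemma max_rpow_le {δ N θ κ r : ℝ} (hδ : 0 < δ) (hδ1 : δ ≤ 1) (hN : 1 ≤ N) (hθ : θ ≤ r)
    (hκ : κ ≤ 3 * r) : (max δ (N ^ (-3 : ℝ))) ^ r ≤ δ ^ θ + N ^ (-κ) := by
  have hN0 : 0 < N := by linarith
  rcases max_choice δ (N ^ (-3 : ℝ)) with h | h <;> rw [h]
  · exact (rpow_le_rpow_of_exponent_ge hδ hδ1 hθ).trans (le_add_of_nonneg_right (by positivity))
  · rw [← rpow_mul hN0.le]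
    exact (rpow_le_rpow_of_exponent_le hN (by linarith)).trans
      (le_add_of_nonneg_left (by positivity))

/-- A smooth function supported in `[-r, r]`, as a complex-valued Schwartz function. -/
lemma exists_schwartz_eq_ofReal {ψ : ℝ → ℝ} (hψ : ContDiff ℝ (⊤ : ℕ∞) ψ) {r : ℝ}
    (hsupp : ∀ t, ψ t ≠ 0 → |t| ≤ r) : ∃ χ : SchwartzMap ℝ ℂ, ∀ t, χ t = ψ t := by
  have h1 : HasCompactSupport fun t => (ψ t : ℂ) :=
    HasCompactSupport.of_support_subset_isCompact (isCompact_Icc (a := -r) (b := r)) fun t ht =>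
      abs_le.1 (hsupp t fun h => ht (by simp [h]))
  exact ⟨h1.toSchwartzMap (Complex.ofRealCLM.contDiff.comp hψ), fun t => rfl⟩

/-- **Proposition 3.2** (the key bilinear estimate, full-space version): for
`s ∈ (-3/4, 0)`, a smooth even time cutoff `ψ` (`ψ = 1` on `[-1,1]`, support in
`[-2,2]`), and any `θ ∈ (0,1/2)`, `κ ∈ (0,3/2)`, there exist `b ∈ (1/2,1)`,
`N₁ ≥ 1` and `C > 0`, depending only on `ν, μ, s, θ, κ, ψ`, such that for all
`N ≥ N₁`, all admissible multipliers `m = m_{N,s}`, all `δ ∈ (0,1)` and all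
Schwartz `u, v` on `ℝ²`:
`‖ψ(t/δ) ∂_x I(uv)‖_{X_{0,b-1}} ≤ C (δ^θ + N^{-κ}) ‖Iu‖_{X_{0,b}} ‖Iv‖_{X_{0,b}}`. -/
theorem benjamin_key_bilinear_estimate (ν μ : ℝ) (hμ : μ ≠ 0)
    (s : ℝ) (hs : s ∈ Set.Ioo (-(3 / 4) : ℝ) 0)
    (ψ : ℝ → ℝ) (hψ_smooth : ContDiff ℝ (⊤ : ℕ∞) ψ) (hψ_even : ∀ t : ℝ, ψ (-t) = ψ t)
    (hψ_one : ∀ t : ℝ, |t| ≤ 1 → ψ t = 1)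
    (hψ_supp : Function.support ψ ⊆ Set.Icc (-2 : ℝ) 2)
    (θ : ℝ) (hθ : θ ∈ Set.Ioo (0 : ℝ) (1 / 2)) (κ : ℝ) (hκ : κ ∈ Set.Ioo (0 : ℝ) (3 / 2)) :
    ∃ b ∈ Set.Ioo (1 / 2 : ℝ) 1, ∃ N₁ : ℝ, 1 ≤ N₁ ∧ ∃ C > (0 : ℝ),
      ∀ N : ℝ, N₁ ≤ N → ∀ m : ℝ → ℝ, AdmissibleMultiplier N s m →
        ∀ δ ∈ Set.Ioo (0 : ℝ) 1, ∀ u v : SchwartzMap (ℝ × ℝ) ℂ,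
          XNorm ν μ 0 (b - 1)
              (fun x t =>
                (↑(ψ (t / δ)) : ℂ) *
                  dxIop m (fun x' t' => u (x', t') * v (x', t')) x t) ≤
            ENNReal.ofReal (C * (δ ^ θ + N ^ (-κ))) *
              (XNorm ν μ 0 b (Iop m (fun x t => u (x, t))) *
                XNorm ν μ 0 b (Iop m (fun x t => v (x, t)))) := by
  set ε := min (min ((3 / 2 + 2 * s) / 3) (1 / 8)) (min (1 - 2 * θ) (1 - 2 * κ / 3)) with hε_def
  have hε : 0 < ε := by
    refine lt_min (lt_min ?_ ?_) (lt_min ?_ ?_) <;> linarith [hs.1, hθ.2, hκ.2]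
  have hε₁ : ε ≤ (3 / 2 + 2 * s) / 3 := (min_le_left _ _).trans (min_le_left _ _)
  have hε₂ : ε ≤ 1 / 8 := (min_le_left _ _).trans (min_le_right _ _)
  have hε₃ : ε ≤ 1 - 2 * θ := (min_le_right _ _).trans (min_le_left _ _)
  have hε₄ : ε ≤ 1 - 2 * κ / 3 := (min_le_right _ _).trans (min_le_right _ _)
  have hsupp : ∀ t, ψ t ≠ 0 → |t| ≤ 2 := fun t ht => abs_le.2 (hψ_supp ht)
  obtain ⟨χ, hχ⟩ := exists_schwartz_eq_ofReal hψ_smooth hsupp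
  obtain ⟨χ₂, hχ₂⟩ := exists_schwartz_eq_ofReal (ψ := fun t => ψ (t / 2)) (r := 4)
    (hψ_smooth.comp (contDiff_id.div_const 2)) fun t ht => by
      have h := hsupp _ ht
      rw [abs_div, abs_two] at h
      linarith
  obtain ⟨M, hM, hbound⟩ := exists_sq_bilinear_bound (ν := ν) (s := s) hμ
    ⟨by linarith [hs.1], hs.2.le⟩ hε hε₂ (by linarith) (χ := χ) (χ₂ := χ₂)
    (fun t ht => hsupp t fun h => ht (by simp [hχ, h])) fun t ht => by
      rw [hχ₂, hψ_one _ (by rw [abs_div, abs_two]; linarith), Complex.ofReal_one]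
  refine ⟨(1 + ε) / 2, ⟨by linarith, by linarith⟩, 1, le_rfl, (M ^ (1 / 2 : ℝ)).toReal + 1,
    by positivity, ?_⟩
  intro N hN m hm δ hδ u v
  have hN0 : 0 < N := by linarith
  set d := max δ (N ^ (-3 : ℝ)) with hd
  have hd0 : 0 < d := lt_max_of_lt_left hδ.1
  have hd1 : d ≤ 1 := max_le hδ.2.le (rpow_le_one_of_one_le_of_nonpos hN (by norm_num))
  have ha3 : (d ^ (1 / 3 : ℝ)) ^ 3 = d := by
    rw [← rpow_natCast, ← rpow_mul hd0.le]
    norm_num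
  have haN : 1 / N ≤ d ^ (1 / 3 : ℝ) := by
    calc 1 / N = (N ^ (-3 : ℝ)) ^ (1 / 3 : ℝ) := by
          rw [← rpow_mul hN0.le, one_div, ← rpow_neg_one]
          norm_num
      _ ≤ d ^ (1 / 3 : ℝ) := by
          gcongr
          exact le_max_right _ _
  have h := hbound N hN0 m hm δ hδ.1 (d ^ (1 / 3 : ℝ)) (by positivity)
    (rpow_le_one hd0.le hd1 (by norm_num)) haN (ha3.symm ▸ le_max_left _ _) u v
  simp only [ha3, hχ] at h
  set X := XNorm ν μ 0 ((1 + ε) / 2) (Iop m (fun x t => u (x, t)))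
  set Y := XNorm ν μ 0 ((1 + ε) / 2) (Iop m (fun x t => v (x, t)))
  have hMr : M ^ (1 / 2 : ℝ) ≤ ENNReal.ofReal ((M ^ (1 / 2 : ℝ)).toReal + 1) := by
    rw [← ENNReal.ofReal_toReal (a := M ^ (1 / 2 : ℝ)) (by finiteness)]
    exact ENNReal.ofReal_le_ofReal (by simp)
  have hdr : ENNReal.ofReal (d ^ (1 - ε)) ^ (1 / 2 : ℝ) ≤
      ENNReal.ofReal (δ ^ θ + N ^ (-κ)) := by
    rw [ENNReal.ofReal_rpow_of_nonneg (by positivity) (by norm_num), ← rpow_mul hd0.le]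
    exact ENNReal.ofReal_le_ofReal
      (max_rpow_le hδ.1 hδ.2.le hN (by linarith) (by linarith))
  refine (le_rpow_half_of_sq_le h).trans ?_
  rw [ENNReal.mul_rpow_of_nonneg _ _ (by norm_num), ENNReal.mul_rpow_of_nonneg _ _ (by norm_num),
    ← mul_pow, ← ENNReal.rpow_natCast, ← ENNReal.rpow_mul, ENNReal.ofReal_mul (by positivity)]
  norm_num
  exact mul_le_mul' (mul_le_mul' hMr hdr) le_rfl
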